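/- Let A(t), B(t) ∈ ℤ[t] be such that Δ(t) = −16(4A(t)³ + 27B(t)²) is not the zero polynomial and j(t) = −6912·A(t)³/(4A(t)³ + 27B(t)²) is non-constant, and let a be a nonzero integer. Then for every ε > 0 there is a constant C > 0 (depending only on A, B, a, ε) such that for all real positive x, T and every prime ℓ ≥ 17, Σ_{τ ∈ F(T), Δ(τ) ≠ 0} Π_{E(τ)}(a, x) ≤ Σ_{τ ∈ F(T), Δ(τ) ≠ 0} #{p ≤ x prime : p ∤ N(τ), a_p(τ) ≡ a (mod ℓ)} ≤ C·(T²·x·ℓ^{−1} + ℓ·T²·x^{1/2} + T·x^{3/2+ε}). -/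

import Mathlib

/-- The Farey pairs of order `T`: coprime pairs `(α, β)` of positive integers
with `α, β ≤ T`; the pair `(α, β)` represents the Farey fraction `α/β ∈ F(T)`. -/
noncomputable def fareyPairs (T : ℝ) : Finset (ℕ × ℕ) :=
  (Finset.Icc 1 ⌊T⌋₊ ×ˢ Finset.Icc 1 ⌊T⌋₊).filter fun ab => Nat.Coprime ab.1 ab.2

/-- The Farey fraction `α/β ∈ ℚ` associated to a pair `(α, β)`. -/
def fareyFrac (ab : ℕ × ℕ) : ℚ := (ab.1 : ℚ) / (ab.2 : ℚ)

/-- Evaluation of an integer polynomial at a rational point. -/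
def evalQ (A : Polynomial ℤ) (τ : ℚ) : ℚ := Polynomial.eval₂ (Int.castRingHom ℚ) τ A

/-- The discriminant `Δ(τ) = −16(4A(τ)³ + 27B(τ)²)` of the specialized curve
`E(τ) : Y² = X³ + A(τ)X + B(τ)`. -/
def discQ (A B : Polynomial ℤ) (τ : ℚ) : ℚ :=
  -16 * (4 * evalQ A τ ^ 3 + 27 * evalQ B τ ^ 2)

/-- The reduction of a rational number modulo `p` (for `p` not dividing the
denominator this is the usual reduction). -/
def ratRed (p : ℕ) (q : ℚ) : ZMod p := (q.num : ZMod p) * ((q.den : ZMod p))⁻¹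

/-- The curve `E(τ) : Y² = X³ + A(τ)X + B(τ)` has good reduction at `p` (for this
model): `p` divides neither the denominators of `A(τ)`, `B(τ)` nor the
discriminant `Δ(τ)`, i.e. `p ∤ N(τ)`. -/
def goodRed (A B : Polynomial ℤ) (τ : ℚ) (p : ℕ) : Prop :=
  ¬ (p : ℤ) ∣ (evalQ A τ).den ∧ ¬ (p : ℤ) ∣ (evalQ B τ).den ∧
    ratRed p (discQ A B τ) ≠ 0

/-- The number of affine points `(x, y) ∈ 𝔽_p²` on `y² = x³ + a·x + b`. -/
def affinePoints (p : ℕ) (a b : ZMod p) : ℕ :=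
  ((Finset.range p ×ˢ Finset.range p).filter fun xy =>
    (xy.2 : ZMod p) ^ 2 = (xy.1 : ZMod p) ^ 3 + a * (xy.1 : ZMod p) + b).card

/-- The Frobenius trace `a_p(τ) = p + 1 − #E_p(τ)(𝔽_p)` of the reduction mod `p`
of the curve `E(τ) : Y² = X³ + A(τ)X + B(τ)` (the projective point count is the
affine count plus one, for the point at infinity). -/
def apFrob (A B : Polynomial ℤ) (τ : ℚ) (p : ℕ) : ℤ :=
  (p : ℤ) - affinePoints p (ratRed p (evalQ A τ)) (ratRed p (evalQ B τ))

open Classical in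
/-- `Π_{E(τ)}(a, x)`: the number of primes `p ≤ x` of good reduction for `E(τ)`
with `a_p(τ) = a`. -/
noncomputable def PiTrace (A B : Polynomial ℤ) (τ : ℚ) (a : ℤ) (x : ℝ) : ℕ :=
  ((Finset.range (⌊x⌋₊ + 1)).filter fun p =>
    p.Prime ∧ goodRed A B τ p ∧ apFrob A B τ p = a).card

/-- The `j`-invariant `j(t) = −6912·A(t)³/(4A(t)³ + 27B(t)²)` is a non-constant
rational function: for no constant `c ∈ ℚ` does `−6912·A(t)³ = c·(4A(t)³ + 27B(t)²)`
hold identically. -/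
def jNonconstant (A B : Polynomial ℤ) : Prop :=
  ∀ c : ℚ, (-6912 : Polynomial ℚ) * (A.map (Int.castRingHom ℚ)) ^ 3 ≠
    Polynomial.C c *
      (4 * (A.map (Int.castRingHom ℚ)) ^ 3 + 27 * (B.map (Int.castRingHom ℚ)) ^ 2)

open Classical in
/-- The number of primes `p ≤ x` of good reduction for `E(τ)` with
`a_p(τ) ≡ a (mod ℓ)`. -/
noncomputable def PiTraceMod (A B : Polynomial ℤ) (τ : ℚ) (a : ℤ) (ℓ : ℕ) (x : ℝ) : ℕ :=
  ((Finset.range (⌊x⌋₊ + 1)).filter fun p =>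
    p.Prime ∧ goodRed A B τ p ∧ (ℓ : ℤ) ∣ (apFrob A B τ p - a)).card

/-- Expansion of a power of a homogenized cubic over a field. -/
lemma homogenized_cubic_pow_field {K F : Type*} [Field K] [Field F] [Algebra K F] (a b : K) (m : ℕ)
    (u z : F) (hz : z ≠ 0) :
    (u ^ 3 + algebraMap K F a * z ^ 2 * u + algebraMap K F b * z ^ 3) ^ m =
      ∑ i ∈ Finset.range (3 * m + 1), algebraMap K F
          (((Polynomial.X ^ 3 + Polynomial.C a * Polynomial.X + Polynomial.C b) ^ m).coeff i) *
          u ^ i * z ^ (3 * m - i) := by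
  set P : Polynomial K := Polynomial.X ^ 3 + Polynomial.C a * Polynomial.X + Polynomial.C b with hP
  have hdeg : (P ^ m).natDegree < 3 * m + 1 := by
    have : P.natDegree ≤ 3 := by rw [hP]; compute_degree
    calc (P ^ m).natDegree ≤ m * P.natDegree := Polynomial.natDegree_pow_le
      _ ≤ m * 3 := Nat.mul_le_mul_left _ this
      _ < 3 * m + 1 := by omega
  have h1 : (u ^ 3 + algebraMap K F a * z ^ 2 * u + algebraMap K F b * z ^ 3) =
      z ^ 3 * Polynomial.aeval (u / z) P := by
    simp only [hP, map_add, map_mul, map_pow, Polynomial.aeval_X, Polynomial.aeval_C]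
    field_simp
  rw [h1, mul_pow, ← map_pow, Polynomial.aeval_eq_sum_range' hdeg, Finset.mul_sum]
  refine Finset.sum_congr rfl fun i hi => ?_
  have hi' : i ≤ 3 * m := by have := Finset.mem_range.1 hi; omega
  rw [Algebra.smul_def, ← pow_mul, div_pow]
  nth_rw 1 [show 3 * m = (3 * m - i) + i by omega]
  rw [pow_add]
  field_simp

open PowerSeries in
/-- Expansion of a power of a homogenized cubic over a ring of power series. -/
lemma homogenized_cubic_pow {K : Type*} [Field K] (a b : K) (m : ℕ) (u z : K⟦X⟧) (hz : z ≠ 0) :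
    (u ^ 3 + C a * z ^ 2 * u + C b * z ^ 3) ^ m =
      ∑ i ∈ Finset.range (3 * m + 1),
        C (((Polynomial.X ^ 3 + Polynomial.C a * Polynomial.X + Polynomial.C b) ^ m).coeff i) *
          u ^ i * z ^ (3 * m - i) := by
  have hinj := IsFractionRing.injective K⟦X⟧ (FractionRing K⟦X⟧)
  apply hinj
  have h := homogenized_cubic_pow_field (F := FractionRing K⟦X⟧) a b m (algebraMap _ _ u)
    (algebraMap _ _ z) (by simpa using (map_ne_zero_iff _ hinj).2 hz)
  have e : ∀ c : K, algebraMap K (FractionRing K⟦X⟧) c = algebraMap K⟦X⟧ (FractionRing K⟦X⟧) (C c) := by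
    intro c
    rw [IsScalarTower.algebraMap_apply K K⟦X⟧ (FractionRing K⟦X⟧)]; rfl
  simp only [e] at h
  simp only [map_pow, map_add, map_mul, map_sum, h]

open PowerSeries in
/-- A formal residue identity: if `u = z²℘(z)` and `v = -(z³℘'(z))/(2u)`, the coefficient of `z^(2m)`
in `v^(2m+1)` is the coefficient of `x^(2m)` in the `m`-th power of the cubic. -/
lemma coeff_pow_eq_hasse {K : Type*} [Field K] [CharZero K] (a b : K) (m : ℕ) (u v : K⟦X⟧)
    (hu0 : constantCoeff u = 1)
    (hW : (X * d⁄dX K u - 2 * u) ^ 2 = 4 * (u ^ 3 + C a * (X ^ 2) ^ 2 * u + C b * (X ^ 2) ^ 3))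
    (hv : 2 * u * v = 2 * u - X * d⁄dX K u) :
    coeff (2 * m) (v ^ (2 * m + 1)) =
      ((Polynomial.X ^ 3 + Polynomial.C a * Polynomial.X + Polynomial.C b) ^ m).coeff (2 * m) := by
  have hu : u ≠ 0 := by rintro rfl; simp at hu0
  have huw : u * u⁻¹ = 1 := PowerSeries.mul_inv_cancel u (by rw [hu0]; exact one_ne_zero)
  set w := u⁻¹ with hw
  have hw0 : constantCoeff w = 1 := by
    have := congrArg constantCoeff huw
    simpa [hu0] using this
  have hv0 : constantCoeff v = 1 := by
    have := congrArg constantCoeff hv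
    simp only [map_mul, map_sub, map_ofNat, hu0, constantCoeff_X, zero_mul, sub_zero] at this
    have h2 : (2 : K) ≠ 0 := two_ne_zero
    exact mul_left_cancel₀ h2 (by simpa using this)
  have h4 : (4 : K⟦X⟧) ≠ 0 := by
    rw [← map_ofNat (C (R := K)) 4]
    exact (map_ne_zero_iff _ C_injective).2 (show (4 : K) ≠ 0 by norm_num)
  have hv2 : v ^ 2 = w ^ 2 * (u ^ 3 + C a * (X ^ 2) ^ 2 * u + C b * (X ^ 2) ^ 3) := by
    have : 4 * (u ^ 2 * v ^ 2) = 4 * (u ^ 3 + C a * (X ^ 2) ^ 2 * u + C b * (X ^ 2) ^ 3) := by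
      rw [← hW, show (X * d⁄dX K u - 2 * u) = -(2 * u * v) by rw [hv]; ring]; ring
    have := mul_left_cancel₀ h4 this
    rw [← this]
    linear_combination (-(v^2) * (u*w + 1)) * huw
  have hun : ∀ n : ℕ, 1 ≤ n → coeff (2 * n) (u ^ n * v) = 0 := by
    intro n hn
    have e : C (2 * n : K) * (u ^ n * v) = C (2 * n : K) * u ^ n - X * d⁄dX K (u ^ n) := by
      have : d⁄dX K (u ^ n) = n * u ^ (n - 1) * d⁄dX K u := by
        rw [Derivation.leibniz_pow]; simp [mul_assoc]
      rw [this]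
      obtain ⟨k, rfl⟩ : ∃ k, n = k + 1 := ⟨n - 1, by omega⟩
      simp only [map_mul, map_natCast, map_ofNat, add_tsub_cancel_right]
      linear_combination ((k + 1 : ℕ) : K⟦X⟧) * u ^ k * hv
    have e2 := congrArg (coeff (2 * n)) e
    rw [map_sub, coeff_C_mul, coeff_C_mul] at e2
    obtain ⟨k, hk⟩ : ∃ k, 2 * n = k + 1 := ⟨2 * n - 1, by omega⟩
    rw [hk, coeff_succ_X_mul, coeff_derivative, ← hk] at e2
    have hk' : (2 * n : K) = k + 1 := by exact_mod_cast congrArg (Nat.cast : ℕ → K) hk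
    rw [hk'] at e2
    have hne : (k + 1 : K) ≠ 0 := by exact_mod_cast Nat.succ_ne_zero k
    have : (k + 1 : K) * coeff (2 * n) (u ^ n * v) = 0 := by rw [e2, hk]; ring
    exact (mul_eq_zero.1 this).resolve_left hne
  rw [pow_succ, pow_mul, hv2, mul_pow, homogenized_cubic_pow a b m u (X ^ 2) (pow_ne_zero _ X_ne_zero)]
  set h := fun i => ((Polynomial.X ^ 3 + Polynomial.C a * Polynomial.X + Polynomial.C b) ^ m).coeff i with hh
  have key : ∀ i ∈ Finset.range (3 * m + 1), coeff (2 * m)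
      (((w ^ 2) ^ m * (C (h i) * u ^ i * (X ^ 2) ^ (3 * m - i))) * v) =
        if i = 2 * m then h i else 0 := by
    intro i hi
    have hi' : i ≤ 3 * m := by have := Finset.mem_range.1 hi; omega
    have r : ((w ^ 2) ^ m * (C (h i) * u ^ i * (X ^ 2) ^ (3 * m - i))) * v =
        C (h i) * ((w ^ (2 * m) * u ^ i * v) * X ^ (2 * (3 * m - i))) := by
      rw [← pow_mul, ← pow_mul]; ring
    rw [r, coeff_C_mul, coeff_mul_X_pow']
    split_ifs with h1 h2 h2
    · subst h2
      rw [show 2 * m - 2 * (3 * m - 2 * m) = 0 by omega, ← mul_pow, mul_comm w u, huw]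
      simp [hv0]
    · have : w ^ (2 * m) * u ^ i * v = u ^ (i - 2 * m) * v := by
        conv_lhs => rw [show i = 2 * m + (i - 2 * m) by omega]
        rw [pow_add, ← mul_assoc, ← mul_pow, mul_comm w u, huw]; ring
      rw [this, show 2 * m - 2 * (3 * m - i) = 2 * (i - 2 * m) by omega, hun _ (by omega), mul_zero]
    · omega
    · simp
  rw [Finset.mul_sum, Finset.sum_mul, map_sum, Finset.sum_congr rfl key, Finset.sum_ite_eq']
  rw [if_pos (Finset.mem_range.2 (by omega))]

section ValuationPrelims

variable (V : ValuationSubring ℂ)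

lemma val_intCast_le_one (n : ℤ) : V.valuation (n : ℂ) ≤ 1 :=
  (V.valuation_le_one_iff _).2 (intCast_mem V n)

/-- Integers prime to the residue characteristic are units. -/
lemma val_intCast_eq_one {p : ℕ} (hp : p.Prime) (hV : V.valuation (p : ℂ) < 1) {n : ℤ}
    (hn : ¬ (p : ℤ) ∣ n) : V.valuation (n : ℂ) = 1 := by
  refine le_antisymm (val_intCast_le_one V n) ?_
  by_contra! h
  have hc : IsCoprime (p : ℤ) n := (Nat.prime_iff_prime_int.1 hp).coprime_iff_not_dvd.2 hn
  obtain ⟨r, s, hrs⟩ := hc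
  have h1 : (1 : ℂ) = r * p + s * n := by exact_mod_cast hrs.symm
  have : V.valuation (1 : ℂ) < 1 := by
    rw [h1]
    refine Valuation.map_add_lt _ ?_ ?_
    · rw [map_mul]
      exact mul_lt_one_of_nonneg_of_lt_one_right (val_intCast_le_one V r) zero_le hV
    · rw [map_mul]
      exact mul_lt_one_of_nonneg_of_lt_one_right (val_intCast_le_one V s) zero_le h
  simp at this

lemma val_intCast_lt_one_iff {p : ℕ} (hp : p.Prime) (hV : V.valuation (p : ℂ) < 1) {n : ℤ} :
    V.valuation (n : ℂ) < 1 ↔ (p : ℤ) ∣ n := by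
  constructor
  · intro h
    by_contra hn
    rw [val_intCast_eq_one V hp hV hn] at h
    exact lt_irrefl _ h
  · rintro ⟨m, rfl⟩
    push_cast
    rw [map_mul]
    exact mul_lt_one_of_nonneg_of_lt_one_left zero_le hV (val_intCast_le_one V m)

lemma residue_eq_zero_iff_val (x : V) :
    IsLocalRing.residue V x = 0 ↔ V.valuation (x : ℂ) < 1 := by
  rw [IsLocalRing.residue_eq_zero_iff, V.valuation_lt_one_iff]

lemma residueField_charP {p : ℕ} (hp : p.Prime) (hV : V.valuation (p : ℂ) < 1) :
    CharP (IsLocalRing.ResidueField V) p := by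
  rw [CharP.charP_iff_prime_eq_zero hp]
  have := (residue_eq_zero_iff_val V (p : V)).2 (by simpa using hV)
  simpa using this

end ValuationPrelims

open PowerSeries in
/-- In characteristic `p`, the `p`-th power of a power series involves only powers `X ^ (p * n)`. -/
lemma coeff_pow_char_of_not_dvd {R : Type*} [CommRing R] (p : ℕ) [hp : Fact p.Prime] [CharP R p]
    (f : R⟦X⟧) {n : ℕ} (hn : ¬ p ∣ n) : coeff n (f ^ p) = 0 := by
  have : f ^ p = map (frobenius R p) (expand p hp.out.ne_zero f) :=
    (MvPowerSeries.map_frobenius_expand p hp.out.ne_zero (f := f)).symm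
  rw [this, coeff_map, coeff_expand_of_not_dvd _ _ _ hn, map_zero]

open PowerSeries in
/-- Integrality of the formal Hasse invariant: if all but the last relevant coefficients of `u` are
integral, the coefficient of `z ^ (p - 1)` in `v ^ p` is controlled by the last coefficient. -/
lemma val_coeff_pow_sub_lt_one (V : ValuationSubring ℂ) (p : ℕ) (hp : p.Prime) (hp2 : p ≠ 2)
    (hV : V.valuation (p : ℂ) < 1) (u v : ℂ⟦X⟧) (hu0 : constantCoeff u = 1)
    (hu : ∀ i < p - 1, coeff i u ∈ V) (hc : (p : ℂ) * coeff (p - 1) u ∈ V)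
    (hv : 2 * u * v = 2 * u - X * d⁄dX ℂ u) :
    V.valuation (2 * coeff (p - 1) (v ^ p) - p * coeff (p - 1) u) < 1 := by
  have := Fact.mk hp
  have hp3 : 3 ≤ p := by have := hp.two_le; omega
  have : CharP (IsLocalRing.ResidueField V) p := residueField_charP V hp hV
  set c := coeff (p - 1) u with hcdef
  -- the integral truncation of `u`
  let U : V⟦X⟧ := PowerSeries.mk fun i => if h : i < p - 1 then ⟨coeff i u, hu i h⟩ else 0
  let ι : V⟦X⟧ →+* ℂ⟦X⟧ := PowerSeries.map V.subtype
  have hιU : ∀ i < p - 1, coeff i (ι U) = coeff i u := by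
    intro i hi
    simp [ι, U, coeff_map, hi]
  have hιU' : coeff (p - 1) (ι U) = 0 := by
    simp [ι, U, coeff_map]
  have hU0 : constantCoeff U = 1 := by
    have h0 : (0 : ℕ) < p - 1 := by omega
    have : coeff 0 U = 1 := by
      simp only [U, coeff_mk, h0, dif_pos]
      ext
      simpa using hu0
    simpa using this
  have h2V : V.valuation (2 : ℂ) = 1 := by
    have := val_intCast_eq_one V hp hV (n := 2) (by
      intro h
      have := Int.le_of_dvd (by norm_num) h
      omega)
    simpa using this
  have h2 : (2⁻¹ : ℂ) ∈ V := by
    rw [← V.valuation_le_one_iff, map_inv₀, h2V, inv_one]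
  let W : V⟦X⟧ := invOfUnit U 1
  have hUW : U * W = 1 := mul_invOfUnit U 1 (by simpa using hU0)
  let Vl : V⟦X⟧ := 1 - C ⟨2⁻¹, h2⟩ * (X * d⁄dX V U * W)
  have hιd : ι (d⁄dX V U) = d⁄dX ℂ (ι U) := by
    ext n
    simp [ι, coeff_map, coeff_derivative]
  have hιX : ι X = X := by simp [ι]
  have hC2 : (2 : ℂ⟦X⟧) * C 2⁻¹ = 1 := by
    rw [← map_ofNat (C (R := ℂ)) 2, ← map_mul, mul_inv_cancel₀ two_ne_zero, map_one]
  have hVl : 2 * ι U * ι Vl = 2 * ι U - X * d⁄dX ℂ (ι U) := by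
    have h1 : ι U * ι W = 1 := by rw [← map_mul, hUW, map_one]
    have h2' : ι Vl = 1 - C 2⁻¹ * (X * d⁄dX ℂ (ι U) * ι W) := by
      simp only [Vl, map_sub, map_one, map_mul, hιX, hιd]
      congr 2
      simp [ι]
    rw [h2']
    linear_combination (-(X * d⁄dX ℂ (ι U))) * (2 * C 2⁻¹) * h1 - (X * d⁄dX ℂ (ι U)) * hC2
  set d : ℂ := -((p : ℂ) - 1) / 2 * c with hd
  have hUdiff : ∃ r : ℂ⟦X⟧, u = ι U + C c * X ^ (p - 1) + X ^ p * r := by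
    have : X ^ p ∣ u - (ι U + C c * X ^ (p - 1)) := by
      rw [X_pow_dvd_iff]
      intro m hm
      rw [map_sub, map_add, coeff_C_mul_X_pow]
      by_cases h : m = p - 1
      · subst h; rw [hιU', if_pos rfl]; simp [hcdef]
      · rw [hιU m (by omega), if_neg h]; simp
    obtain ⟨r, hr⟩ := this
    exact ⟨r, by rw [← hr]; ring⟩
  obtain ⟨r, hr⟩ := hUdiff
  have hpne : (p - 1 + 1) = p := by omega
  have hud0 : constantCoeff (2 * u) ≠ 0 := by
    rw [map_mul, hu0, map_ofNat]; simp
  have hdvd : ∀ f : ℂ⟦X⟧, X ^ p ∣ 2 * u * f → X ^ p ∣ f := by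
    intro f hf
    have hunit : IsUnit (2 * u) := by
      rw [isUnit_iff_constantCoeff]; exact isUnit_iff_ne_zero.2 hud0
    exact (hunit.dvd_mul_left).1 hf
  have hVdiff : X ^ p ∣ v - (ι Vl + C d * X ^ (p - 1)) := by
    apply hdvd
    have hX : ∀ f : ℂ⟦X⟧, X * d⁄dX ℂ (X ^ p * f) = X ^ p * ((p : ℂ⟦X⟧) * f + X * d⁄dX ℂ f) := by
      intro f
      rw [Derivation.leibniz, Derivation.leibniz_pow]
      simp only [smul_eq_mul, nsmul_eq_mul, derivative_X]
      nth_rw 3 [← hpne]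
      rw [← hpne]
      simp only [pow_succ, add_tsub_cancel_right]
      ring
    have hX1 : X * d⁄dX ℂ (C c * X ^ (p - 1)) = ((p - 1 : ℕ) : ℂ⟦X⟧) * (C c * X ^ (p - 1)) := by
      obtain ⟨k, hk⟩ : ∃ k, p - 1 = k + 1 := ⟨p - 2, by omega⟩
      rw [Derivation.leibniz, Derivation.leibniz_pow, hk]
      simp only [smul_eq_mul, nsmul_eq_mul, derivative_X, derivative_C, pow_succ, add_tsub_cancel_right]
      ring
    have hU1 : ∃ U1 : ℂ⟦X⟧, ι U = 1 + X * U1 := by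
      have : X ∣ ι U - 1 := by
        rw [X_dvd_iff, map_sub, map_one, ← coeff_zero_eq_constantCoeff_apply, coeff_map,
          coeff_zero_eq_constantCoeff_apply, hU0]
        simp
      obtain ⟨U1, h⟩ := this
      exact ⟨U1, by rw [← h]; ring⟩
    obtain ⟨U1, hU1⟩ := hU1
    have hV1 : ∃ V1 : ℂ⟦X⟧, ι Vl = 1 + X * V1 := by
      refine ⟨- (C 2⁻¹ * (d⁄dX ℂ (ι U) * ι W)), ?_⟩
      have h2' : ι Vl = 1 - C 2⁻¹ * (X * d⁄dX ℂ (ι U) * ι W) := by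
        simp only [Vl, map_sub, map_one, map_mul, hιX, hιd]
        congr 2
        simp [ι]
      rw [h2']; ring
    obtain ⟨V1, hV1⟩ := hV1
    have hd2 : 2 * C d = -((p - 1 : ℕ) : ℂ⟦X⟧) * C c := by
      rw [← map_ofNat (C (R := ℂ)) 2, ← map_natCast (C (R := ℂ)) (p - 1), ← map_mul, ← map_neg, ← map_mul, hd,
        Nat.cast_sub hp.one_le]
      congr 1
      push_cast
      ring
    have hmain : 2 * u * (v - (ι Vl + C d * X ^ (p - 1))) =
        X ^ p * (2 * r - ((p : ℂ⟦X⟧) * r + X * d⁄dX ℂ r)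
          - 2 * C c * V1 - 2 * U1 * C d - 2 * C c * C d * X ^ (p - 2)
          - 2 * r * (ι Vl + C d * X ^ (p - 1))) := by
      have e1 : X * d⁄dX ℂ u = X * d⁄dX ℂ (ι U) + ((p - 1 : ℕ) : ℂ⟦X⟧) * (C c * X ^ (p - 1)) +
          X ^ p * ((p : ℂ⟦X⟧) * r + X * d⁄dX ℂ r) := by
        rw [← hX, ← hX1]
        nth_rw 1 [hr]
        rw [map_add, map_add]; ring
      have e2 : (X : ℂ⟦X⟧) ^ p = X ^ (p - 1) * X := by rw [← pow_succ, hpne]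
      have e3 : (X : ℂ⟦X⟧) ^ (p - 1) * X ^ (p - 1) = X ^ p * X ^ (p - 2) := by
        rw [← pow_add, ← pow_add]; congr 1; omega
      calc 2 * u * (v - (ι Vl + C d * X ^ (p - 1))) =
          2 * u * v - 2 * u * (ι Vl + C d * X ^ (p - 1)) := by ring
        _ = 2 * u - X * d⁄dX ℂ u - 2 * u * (ι Vl + C d * X ^ (p - 1)) := by rw [hv]
        _ = _ := by
          rw [e1]
          nth_rw 1 2 [hr]
          linear_combination (-1 : ℂ⟦X⟧) * hVl - 2 * C c * X ^ (p-1) * hV1 -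
            2 * C d * X ^ (p-1) * hU1 - 2 * C c * C d * e3 - X ^ (p-1) * hd2
            + (2 * C c * V1 + 2 * U1 * C d) * e2
    rw [hmain]
    exact dvd_mul_right _ _
  have hpow : X ^ p ∣ v ^ p - ((ι Vl) ^ p + (p : ℂ⟦X⟧) * (ι Vl) ^ (p - 1) * (C d * X ^ (p - 1))) := by
    have h1 : X ^ p ∣ v ^ p - (ι Vl + C d * X ^ (p - 1)) ^ p := hVdiff.trans (sub_dvd_pow_sub_pow _ _ _)
    have h2' : X ^ p ∣ (ι Vl + C d * X ^ (p - 1)) ^ p -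
        ((ι Vl) ^ p + (p : ℂ⟦X⟧) * (ι Vl) ^ (p - 1) * (C d * X ^ (p - 1))) := by
      obtain ⟨k, hk⟩ := Polynomial.powAddExpansion (ι Vl) (C d * X ^ (p - 1)) p
      rw [hk]
      have : X ^ p ∣ (C d * X ^ (p - 1)) ^ 2 := by
        rw [mul_pow, ← pow_mul]
        exact Dvd.dvd.mul_left (pow_dvd_pow _ (by omega)) _
      have e : (ι Vl) ^ p + (p : ℂ⟦X⟧) * (ι Vl) ^ (p - 1) * (C d * X ^ (p - 1)) +
          k * (C d * X ^ (p - 1)) ^ 2 -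
          ((ι Vl) ^ p + (p : ℂ⟦X⟧) * (ι Vl) ^ (p - 1) * (C d * X ^ (p - 1))) =
          k * (C d * X ^ (p - 1)) ^ 2 := by ring
      rw [e]
      exact Dvd.dvd.mul_left this _
    have := dvd_add h1 h2'
    convert this using 1
    ring
  have hcoef : coeff (p - 1) (v ^ p) = coeff (p - 1) ((ι Vl) ^ p) + p * d := by
    have := X_pow_dvd_iff.1 hpow (p - 1) (by omega)
    rw [map_sub, sub_eq_zero] at this
    rw [this, map_add]
    congr 1
    rw [show (p : ℂ⟦X⟧) * (ι Vl) ^ (p - 1) * (C d * X ^ (p - 1)) =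
      (C (p : ℂ) * C d * (ι Vl) ^ (p - 1)) * X ^ (p - 1) by rw [map_natCast]; ring,
      coeff_mul_X_pow', if_pos le_rfl, Nat.sub_self, coeff_zero_eq_constantCoeff, map_mul, map_mul, map_pow]
    have : constantCoeff (ι Vl) = 1 := by
      simp [ι, Vl]
    rw [this]
    simp
  have hres : V.valuation (coeff (p - 1) ((ι Vl) ^ p)) < 1 := by
    have : coeff (p - 1) ((ι Vl) ^ p) = ((coeff (p - 1) (Vl ^ p) : V) : ℂ) := by
      rw [← map_pow]; simp only [ι, coeff_map]; rfl
    rw [this, ← residue_eq_zero_iff_val, ← coeff_map, map_pow]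
    refine coeff_pow_char_of_not_dvd p _ ?_
    intro h
    have := Nat.le_of_dvd (by omega) h
    omega
  rw [hcoef]
  have : 2 * (coeff (p - 1) ((ι Vl) ^ p) + p * d) - p * c =
      2 * coeff (p - 1) ((ι Vl) ^ p) + (-p) * (p * c) := by rw [hd]; ring
  rw [this]
  refine Valuation.map_add_lt _ ?_ ?_
  · rw [map_mul, h2V, one_mul]; exact hres
  · rw [map_mul, Valuation.map_neg]
    exact mul_lt_one_of_nonneg_of_lt_one_left zero_le hV ((V.valuation_le_one_iff _).2 hc)

section PointCounts

open Polynomial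

/-- The cubic `x³ + ax + b`. -/
noncomputable def cubicPoly {R : Type*} [CommRing R] (a b : R) : R[X] := X ^ 3 + C a * X + C b

/-- The Hasse invariant: the coefficient of `x^(p-1)` in `(x³ + ax + b)^((p-1)/2)`. -/
noncomputable def hassePoly {R : Type*} [CommRing R] (p : ℕ) (a b : R) : R :=
  (cubicPoly a b ^ ((p - 1) / 2)).coeff (p - 1)

lemma cubicPoly_map {R S : Type*} [CommRing R] [CommRing S] (f : R →+* S) (a b : R) :
    (cubicPoly a b).map f = cubicPoly (f a) (f b) := by
  simp [cubicPoly]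

lemma hassePoly_map {R S : Type*} [CommRing R] [CommRing S] (f : R →+* S) (p : ℕ) (a b : R) :
    f (hassePoly p a b) = hassePoly p (f a) (f b) := by
  rw [hassePoly, hassePoly, ← cubicPoly_map, ← Polynomial.map_pow, coeff_map]

lemma hassePoly_scale {K : Type*} [Field K] {p : ℕ} (hp : Odd p) (a b s : K) (hs : s ≠ 0) :
    hassePoly p (s ^ 2 * a) (s ^ 3 * b) = s ^ ((p - 1) / 2) * hassePoly p a b := by
  obtain ⟨m, rfl⟩ := hp
  have h1 : (cubicPoly (s ^ 2 * a) (s ^ 3 * b)).comp (C s * X) = C (s ^ 3) * cubicPoly a b := by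
    simp only [cubicPoly, add_comp, pow_comp, mul_comp, X_comp, C_comp, map_mul, map_pow]
    ring
  have h2 := congrArg (fun P : K[X] => (P ^ m).coeff (2 * m)) h1
  simp only [← pow_comp] at h2
  rw [mul_pow, ← map_pow, coeff_C_mul, comp_C_mul_X_coeff] at h2
  simp only [hassePoly, add_tsub_cancel_right, Nat.mul_div_cancel_left m two_pos]
  have h3 : s ^ (2 * m) ≠ 0 := pow_ne_zero _ hs
  apply mul_right_cancel₀ h3
  rw [h2]
  ring

variable {p : ℕ} [hp : Fact p.Prime]

lemma affinePoints_eq_sum (a b : ZMod p) :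
    affinePoints p a b =
      ∑ x : ZMod p, (Finset.univ.filter fun y : ZMod p => y ^ 2 = x ^ 3 + a * x + b).card := by
  have hne : NeZero p := ⟨hp.out.ne_zero⟩
  have : affinePoints p a b = (Finset.univ.filter fun xy : ZMod p × ZMod p =>
      xy.2 ^ 2 = xy.1 ^ 3 + a * xy.1 + b).card := by
    unfold affinePoints
    refine Finset.card_bij' (fun xy _ => ((xy.1 : ZMod p), (xy.2 : ZMod p)))
      (fun xy _ => (xy.1.val, xy.2.val)) ?_ ?_ ?_ ?_
    · intro xy h
      simpa using (Finset.mem_filter.1 h).2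
    · intro xy h
      simp only [Finset.mem_filter, Finset.mem_product, Finset.mem_range, ZMod.val_lt, and_self,
        true_and, ZMod.natCast_val, ZMod.cast_id', id_eq]
      simpa using h
    · rintro ⟨x, y⟩ h
      simp only [Finset.mem_filter, Finset.mem_product, Finset.mem_range] at h
      simp [ZMod.val_natCast, Nat.mod_eq_of_lt h.1.1, Nat.mod_eq_of_lt h.1.2]
    · rintro ⟨x, y⟩ h
      simp
  rw [this, Finset.card_filter, Fintype.sum_prod_type]
  simp only [Finset.card_filter]

lemma card_sqrts_cast (hp2 : p ≠ 2) (c : ZMod p) :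
    (((Finset.univ.filter fun y : ZMod p => y ^ 2 = c).card : ℤ) : ZMod p) =
      c ^ ((p - 1) / 2) + 1 := by
  have hc : ringChar (ZMod p) ≠ 2 := by rwa [ZMod.ringChar_zmod_n]
  have h := quadraticChar_card_sqrts hc c
  have e : {x : ZMod p | x ^ 2 = c}.toFinset = Finset.univ.filter fun y : ZMod p => y ^ 2 = c := by
    ext; simp
  rw [e] at h
  rw [h]
  push_cast
  rw [quadraticChar_eq_pow_of_char_ne_two' hc, ZMod.card]
  congr 2
  have := hp.out.odd_of_ne_two hp2
  obtain ⟨m, rfl⟩ := this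
  omega

/-- The Frobenius trace is congruent to the Hasse invariant. -/
lemma affinePoints_cast (hp2 : p ≠ 2) (a b : ZMod p) :
    (affinePoints p a b : ZMod p) = -hassePoly p a b := by
  obtain ⟨m, hm⟩ := hp.out.odd_of_ne_two hp2
  have hm1 : 1 ≤ m := by have := hp.out.two_le; omega
  rw [affinePoints_eq_sum]
  push_cast
  have h1 : ∀ x : ZMod p, ((Finset.univ.filter fun y : ZMod p => y ^ 2 = x ^ 3 + a * x + b).card : ZMod p)
      = (x ^ 3 + a * x + b) ^ m + 1 := by
    intro x
    have := card_sqrts_cast hp2 (x ^ 3 + a * x + b)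
    rw [show (p - 1) / 2 = m by omega] at this
    rw [← this]; simp
  simp only [h1]
  rw [Finset.sum_add_distrib, Finset.sum_const, Finset.card_univ, ZMod.card]
  simp only [nsmul_eq_mul, CharP.cast_eq_zero, zero_mul, add_zero]
  have hev : ∀ x : ZMod p, (x ^ 3 + a * x + b) ^ m =
      ∑ i ∈ Finset.range (3 * m + 1), (cubicPoly a b ^ m).coeff i * x ^ i := by
    intro x
    have hdeg : (cubicPoly a b ^ m).natDegree < 3 * m + 1 := by
      have : (cubicPoly a b).natDegree ≤ 3 := by rw [cubicPoly]; compute_degree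
      calc (cubicPoly a b ^ m).natDegree ≤ m * (cubicPoly a b).natDegree := natDegree_pow_le
        _ ≤ m * 3 := Nat.mul_le_mul_left _ this
        _ < 3 * m + 1 := by omega
    rw [← eval_eq_sum_range' hdeg]
    simp [cubicPoly]
  simp only [hev]
  rw [Finset.sum_comm]
  have hs : ∀ i ∈ Finset.range (3 * m + 1),
      ∑ x : ZMod p, (cubicPoly a b ^ m).coeff i * x ^ i =
        if i = 2 * m then -(cubicPoly a b ^ m).coeff i else 0 := by
    intro i hi
    have hi' := Finset.mem_range.1 hi
    rw [← Finset.mul_sum]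
    have hcard : Fintype.card (ZMod p) = p := ZMod.card p
    split_ifs with h
    · subst h
      have h0 : ∑ x : ZMod p, x ^ (2 * m) = ∑ x : ZMod p, (1 - if x = 0 then 1 else 0) := by
        refine Finset.sum_congr rfl fun x _ => ?_
        split_ifs with hx
        · subst hx; rw [zero_pow (by omega)]; simp
        · rw [show 2 * m = p - 1 by omega, ZMod.pow_card_sub_one_eq_one hx, sub_zero]
      rw [h0, Finset.sum_sub_distrib, Finset.sum_ite_eq']
      simp
    · by_cases hlt : i < 2 * m
      · rw [FiniteField.sum_pow_lt_card_sub_one, mul_zero]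
        rw [hcard]; omega
      · have h0 : ∑ x : ZMod p, x ^ i = ∑ x : ZMod p, x ^ (i - 2 * m) := by
          refine Finset.sum_congr rfl fun x _ => ?_
          by_cases hx : x = 0
          · subst hx; rw [zero_pow (by omega), zero_pow (by omega)]
          · conv_lhs => rw [show i = (p - 1) + (i - 2 * m) by omega]
            rw [pow_add, ZMod.pow_card_sub_one_eq_one hx, one_mul]
        rw [h0, FiniteField.sum_pow_lt_card_sub_one, mul_zero]
        rw [hcard]; omega
  rw [Finset.sum_congr rfl hs, Finset.sum_ite_eq', if_pos (Finset.mem_range.2 (by omega)), hassePoly]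
  rw [show (p - 1) / 2 = m by omega, show p - 1 = 2 * m by omega]

/-- Trivial bound for the number of affine points. -/
lemma affinePoints_le (a b : ZMod p) : affinePoints p a b ≤ 2 * p := by
  rw [affinePoints_eq_sum]
  calc _ ≤ ∑ _x : ZMod p, 2 := by
        refine Finset.sum_le_sum fun x _ => ?_
        have h : (Finset.univ.filter fun y : ZMod p => y ^ 2 = x ^ 3 + a * x + b) ⊆
            (nthRootsFinset 2 (x ^ 3 + a * x + b)) := by
          intro y hy
          rw [mem_nthRootsFinset two_pos]
          simpa using hy
        refine (Finset.card_le_card h).trans ?_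
        rw [nthRootsFinset_def]
        exact (Multiset.toFinset_card_le _).trans (card_nthRoots _ _)
    _ = 2 * p := by simp [ZMod.card, mul_comm]

end PointCounts

section

open UpperHalfPlane ModularForm MatrixGroups Filter Topology Manifold SlashInvariantForm
  ModularFormClass

/-- `f` is given on the upper half plane by the convergent `q`-expansion `W` of width `h`. -/
def HasQ (h : ℝ) (f : ℍ → ℂ) (W : PowerSeries ℂ) : Prop :=
  ∀ τ : ℍ, HasSum (fun n : ℕ ↦ W.coeff n * Function.Periodic.qParam h τ ^ n) (f τ)

namespace HasQ

variable {h : ℝ} {f g : ℍ → ℂ} {W U : PowerSeries ℂ}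

lemma add (hf : HasQ h f W) (hg : HasQ h g U) : HasQ h (f + g) (W + U) := fun τ ↦ by
  simpa [add_mul] using! (hf τ).add (hg τ)

lemma sub (hf : HasQ h f W) (hg : HasQ h g U) : HasQ h (f - g) (W - U) := fun τ ↦ by
  simpa [sub_mul] using! (hf τ).sub (hg τ)

lemma smul (c : ℂ) (hf : HasQ h f W) : HasQ h (c • f) (c • W) := fun τ ↦ by
  simpa [mul_assoc] using! (hf τ).mul_left c

lemma const (c : ℂ) : HasQ h (fun _ ↦ c) (PowerSeries.C c) := fun τ ↦ by
  have := hasSum_single (f := fun n : ℕ ↦ (PowerSeries.C c).coeff n *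
    Function.Periodic.qParam h τ ^ n) 0 (fun n hn ↦ by simp [PowerSeries.coeff_C, hn])
  simpa using this

lemma mul (hf : HasQ h f W) (hg : HasQ h g U) : HasQ h (f * g) (W * U) := fun τ ↦ by
  have h1 := (hf τ).summable.norm
  have h2 := (hg τ).summable.norm
  have h3 := summable_norm_sum_mul_antidiagonal_of_summable_norm h1 h2
  have h4 := tsum_mul_tsum_eq_tsum_sum_antidiagonal_of_summable_norm h1 h2
  rw [(hf τ).tsum_eq, (hg τ).tsum_eq] at h4
  rw [Pi.mul_apply, h4]
  refine h3.of_norm.hasSum.congr_fun fun n ↦ ?_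
  rw [PowerSeries.coeff_mul, Finset.sum_mul]
  refine Finset.sum_congr rfl fun x hx ↦ ?_
  rw [← Finset.HasAntidiagonal.mem_antidiagonal.mp hx]
  ring

lemma one : HasQ h 1 1 := const 1

lemma prod {ι : Type*} (s : Finset ι) {F : ι → ℍ → ℂ} {V : ι → PowerSeries ℂ}
    (H : ∀ i ∈ s, HasQ h (F i) (V i)) : HasQ h (∏ i ∈ s, F i) (∏ i ∈ s, V i) := by
  classical
  induction s using Finset.induction_on with
  | empty => simpa using one
  | insert i s hi ih =>
    rw [Finset.prod_insert hi, Finset.prod_insert hi]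
    exact (H i (Finset.mem_insert_self _ _)).mul
      (ih fun j hj ↦ H j (Finset.mem_insert_of_mem hj))

lemma hasSum_cusp (hh : 0 < h) (hf : HasQ h f W) {q : ℂ} (hq : ‖q‖ < 1) (hq0 : q ≠ 0) :
    HasSum (fun n : ℕ ↦ W.coeff n * q ^ n)
      (f ⟨Function.Periodic.invQParam h q,
        Function.Periodic.im_invQParam_pos_of_norm_lt_one hh hq hq0⟩) := by
  have := hf ⟨Function.Periodic.invQParam h q,
        Function.Periodic.im_invQParam_pos_of_norm_lt_one hh hq hq0⟩
  rwa [Function.Periodic.qParam_right_inv hh.ne' hq0] at this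

lemma hasFPowerSeriesOnBall (hh : 0 < h) (hf : HasQ h f W) :
    HasFPowerSeriesOnBall (fun q : ℂ ↦ ∑' n : ℕ, W.coeff n * q ^ n)
      (.ofScalars ℂ fun n ↦ W.coeff n) 0 1 := by
  have hs : ∀ q : ℂ, ‖q‖ < 1 → Summable (fun n : ℕ ↦ W.coeff n * q ^ n) := by
    intro q hq
    rcases eq_or_ne q 0 with rfl | hq0
    · exact summable_of_ne_finset_zero (s := {0}) (fun n hn ↦ by simp at hn; simp [hn])
    · exact (hf.hasSum_cusp hh hq hq0).summable
  constructor
  · refine le_of_forall_lt_imp_le_of_dense fun r hr ↦ ?_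
    lift r to NNReal using hr.ne_top
    apply FormalMultilinearSeries.le_radius_of_summable
    simpa [smul_eq_mul, norm_mul, mul_comm, mul_left_comm, mul_assoc] using
      (hs r (by simpa using hr)).norm
  · simp
  · intro y hy
    have hy' : ‖y‖ < 1 := by simpa [Metric.mem_eball, edist_zero_right, enorm_eq_nnnorm] using! hy
    simpa [mul_comm] using! (hs y hy').hasSum

lemma unique (hh : 0 < h) (hf : HasQ h f W) (hf' : HasQ h f U) : W = U := by
  have h0 : HasQ h 0 (W - U) := by simpa using hf.sub hf'
  have hp := (h0.hasFPowerSeriesOnBall hh).hasFPowerSeriesAt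
  have hz : ∀ᶠ q in 𝓝[≠] (0:ℂ), (∑' n : ℕ, (W - U).coeff n * q ^ n) = 0 := by
    have : ∀ᶠ q in 𝓝[≠] (0:ℂ), q ∈ Metric.ball (0:ℂ) 1 :=
      mem_nhdsWithin_of_mem_nhds (Metric.ball_mem_nhds _ one_pos)
    filter_upwards [this, self_mem_nhdsWithin] with q hq hq0
    exact (h0.hasSum_cusp hh (by simpa using hq) hq0).tsum_eq
  have hz' := (hp.analyticAt.frequently_zero_iff_eventually_zero).mp hz.frequently
  have h3 : HasFPowerSeriesAt (0 : ℂ → ℂ) (.ofScalars ℂ fun n ↦ (W - U).coeff n) 0 :=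
    hp.congr hz'
  have h4 := h3.eq_zero
  rw [← sub_eq_zero]
  ext n
  have := congrArg (fun F ↦ FormalMultilinearSeries.coeff F n) h4
  have h5 : FormalMultilinearSeries.coeff (0 : FormalMultilinearSeries ℂ ℂ ℂ) n = 0 := rfl
  simpa [FormalMultilinearSeries.coeff_ofScalars, h5] using this

lemma eq_tsum (hf : HasQ h f W) (τ : ℍ) :
    f τ = ∑' n : ℕ, W.coeff n * Function.Periodic.qParam h τ ^ n := (hf τ).tsum_eq.symm

lemma mdifferentiable (hh : 0 < h) (hf : HasQ h f W) : MDiff f := by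
  rw [UpperHalfPlane.mdifferentiable_iff]
  have hp := (hf.hasFPowerSeriesOnBall hh).differentiableOn
  have : DifferentiableOn ℂ (fun z : ℂ ↦ ∑' n : ℕ, W.coeff n * Function.Periodic.qParam h z ^ n)
      upperHalfPlaneSet := by
    refine hp.comp (g := fun q : ℂ ↦ ∑' n : ℕ, W.coeff n * q ^ n) ?_ ?_
    · exact (Function.Periodic.differentiable_qParam).differentiableOn
    · intro z hz
      have := Function.Periodic.norm_qParam_lt_one hh (z := z) hz
      rw [← ENNReal.coe_one, Metric.eball_coe, NNReal.coe_one, mem_ball_zero_iff]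
      exact this
  refine this.congr fun z hz ↦ ?_
  rw [Function.comp_apply, hf.eq_tsum, ofComplex_apply_of_im_pos hz]

lemma isBoundedAtImInfty (hh : 0 < h) (hf : HasQ h f W) : IsBoundedAtImInfty f :=
  isBoundedAtImInfty_of_hasSum_qExpansion hh (c := fun n ↦ W.coeff n) hf

end HasQ

lemma slash_eqn_SL {F : Type*} [FunLike F ℍ ℂ] {k : ℤ} [SlashInvariantFormClass F 𝒮ℒ k] (f : F)
    (γ : SL(2, ℤ)) (z : ℍ) : f (γ • z) = denom γ z ^ k * f z :=
  SlashInvariantForm.slash_action_eqn' f (Γ := 𝒮ℒ) ⟨γ, rfl⟩ z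

/-- `f` is a modular form of weight `k` and level one with `q`-expansion `W`. -/
structure MF (k : ℤ) (f : ℍ → ℂ) (W : PowerSeries ℂ) : Prop where
  hasQ : HasQ 1 f W
  inv : ∀ τ : ℍ, f (ModularGroup.S • τ) = (τ : ℂ) ^ k * f τ

lemma HasQ.zero {h : ℝ} : HasQ h 0 0 := fun τ ↦ by simp [hasSum_zero]

namespace MF

variable {k l : ℤ} {f g : ℍ → ℂ} {W U : PowerSeries ℂ}

lemma add (hf : MF k f W) (hg : MF k g U) : MF k (f + g) (W + U) :=
  ⟨hf.1.add hg.1, fun τ ↦ by rw [Pi.add_apply, Pi.add_apply, hf.2, hg.2, mul_add]⟩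

lemma sub (hf : MF k f W) (hg : MF k g U) : MF k (f - g) (W - U) :=
  ⟨hf.1.sub hg.1, fun τ ↦ by rw [Pi.sub_apply, Pi.sub_apply, hf.2, hg.2, mul_sub]⟩

lemma smul (c : ℂ) (hf : MF k f W) : MF k (c • f) (c • W) :=
  ⟨hf.1.smul c, fun τ ↦ by rw [Pi.smul_apply, Pi.smul_apply, hf.2, smul_eq_mul, smul_eq_mul]; ring⟩

lemma mul (hf : MF k f W) (hg : MF l g U) : MF (k + l) (f * g) (W * U) :=
  ⟨hf.1.mul hg.1, fun τ ↦ by rw [Pi.mul_apply, Pi.mul_apply, hf.2, hg.2, zpow_add₀ τ.ne_zero]; ring⟩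

lemma one : MF 0 1 1 := ⟨HasQ.one, fun τ ↦ by simp⟩

lemma cast (h : k = l) (hf : MF k f W) : MF l f W := h ▸ hf

lemma pow (hf : MF k f W) (n : ℕ) : MF (n * k) (f ^ n) (W ^ n) := by
  induction n with
  | zero => simpa using one
  | succ n ih => simpa [pow_succ, add_mul] using ih.mul hf

lemma unique (hf : MF k f W) (hf' : MF k f U) : W = U := hf.1.unique one_pos hf'.1

lemma eq_of_eq_zero (hf : MF k f 0) : f = 0 := by
  ext τ
  have := hf.1 τ
  simpa using this.unique (by simp [hasSum_zero])

lemma of_modularForm (F : ModularForm 𝒮ℒ k) : MF k F (qExpansion 1 F) := by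
  refine ⟨fun τ ↦ ModularForm.hasSum_qExpansion (f := F) one_pos one_mem_strictPeriods_SL τ, fun τ ↦ ?_⟩
  have := slash_eqn_SL F ModularGroup.S τ
  rw [this, ModularGroup.denom_S]

lemma of_hasQ_T (hf : HasQ 1 f W) (τ : ℍ) : f (ModularGroup.T • τ) = f τ := by
  refine (hf _).unique ((hf τ).congr_fun fun n ↦ ?_)
  congr 2
  rw [modular_T_smul, coe_vadd]
  simp only [Function.Periodic.qParam, Complex.ofReal_one, mul_add, div_one, mul_one,
    Complex.exp_add, Complex.exp_two_pi_mul_I, one_mul]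

lemma exists_modularForm (hf : MF k f W) : ∃ F : ModularForm 𝒮ℒ k, ⇑F = f := by
  have hS : f ∣[k] ModularGroup.S = f := by
    ext τ
    rw [SL_slash_apply, hf.2, ModularGroup.denom_S, mul_right_comm, ← zpow_add₀ τ.ne_zero]
    simp
  have hT : f ∣[k] ModularGroup.T = f := by
    ext τ
    rw [SL_slash_apply, of_hasQ_T hf.1, ModularGroup.denom_apply]
    simp [ModularGroup.T]
  have hall := slash_action_generators_SL2Z hS hT
  refine ⟨{ toFun := f, slash_action_eq' := ?_, holo' := hf.1.mdifferentiable one_pos,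
            bdd_at_cusps' := ?_ }, rfl⟩
  · rintro A ⟨A, rfl⟩
    exact hall A
  · intro c hc
    rw [Subgroup.IsArithmetic.isCusp_iff_isCusp_SL2Z] at hc
    rw [OnePoint.isBoundedAt_iff_forall_SL2Z hc]
    intro γ _
    rw [hall]
    exact hf.1.isBoundedAtImInfty one_pos

lemma smul_eq (hf : MF k f W) (γ : SL(2, ℤ)) (τ : ℍ) :
    f (γ • τ) = denom γ τ ^ k * f τ := by
  obtain ⟨F, rfl⟩ := hf.exists_modularForm
  exact slash_eqn_SL F γ τ

lemma eq_zero_of_neg (hk : k < 0) (hf : MF k f W) : W = 0 := by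
  obtain ⟨F, rfl⟩ := hf.exists_modularForm
  have := levelOne_neg_weight_eq_zero hk F
  rw [this] at hf
  exact hf.1.unique one_pos HasQ.zero

lemma eq_C_of_weight_zero (hf : MF 0 f W) : W = PowerSeries.C (W.coeff 0) := by
  obtain ⟨F, rfl⟩ := hf.exists_modularForm
  obtain ⟨c, hc⟩ := levelOne_weight_zero_const F
  rw [hc] at hf
  have := hf.1.unique one_pos (HasQ.const c)
  rw [this]; simp

lemma eq_zero_of_weight_two (hf : MF 2 f W) : W = 0 := by
  obtain ⟨F, rfl⟩ := hf.exists_modularForm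
  have h1 := levelOne_weight_two_rank_zero
  have := rank_zero_iff_forall_zero.mp h1 F
  rw [this] at hf
  exact hf.1.unique one_pos HasQ.zero

lemma eq_zero_of_odd (hk : Odd k) (hf : MF k f W) : W = 0 := by
  obtain ⟨F, rfl⟩ := hf.exists_modularForm
  rw [levelOne_odd_weight_eq_zero hk F] at hf
  exact hf.1.unique one_pos HasQ.zero

end MF

/-- The `q`-expansion of the modular discriminant. -/
noncomputable def qDelta : PowerSeries ℂ := qExpansion 1 ModularForm.discriminant

/-- The `q`-expansion of the normalised Eisenstein series of weight `k`. -/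
noncomputable def qEis {k : ℕ} (hk : 3 ≤ k) : PowerSeries ℂ := qExpansion 1 (ModularForm.E hk)

lemma MF.discriminant : MF 12 ModularForm.discriminant qDelta := by
  refine ⟨fun τ ↦ ?_, fun τ ↦ ?_⟩
  · exact ModularForm.hasSum_qExpansion (f := CuspForm.discriminant) one_pos one_mem_strictPeriods_SL τ
  · have := slash_eqn_SL CuspForm.discriminant ModularGroup.S τ
    rw [CuspForm.coe_discriminant] at this
    rw [this, ModularGroup.denom_S]

lemma MF.eisenstein {k : ℕ} (hk : 3 ≤ k) : MF k (ModularForm.E hk) (qEis hk) := .of_modularForm _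

lemma qDelta_coeff_one : qDelta.coeff 1 = 1 := discriminant_qExpansion_coeff_one

lemma qDelta_coeff_zero : qDelta.coeff 0 = 0 := by
  have h := discriminant_qExpansion_order
  exact PowerSeries.coeff_of_lt_order 0 (by unfold qDelta; rw [h]; simp)

lemma MF.exists_div {k : ℤ} {f : ℍ → ℂ} {W : PowerSeries ℂ} (hf : MF k f W) (h0 : W.coeff 0 = 0) :
    ∃ g U, MF (k - 12) g U ∧ f = ModularForm.discriminant * g ∧ W = qDelta * U := by
  obtain ⟨F, rfl⟩ := hf.exists_modularForm
  have hW : W = qExpansion 1 F := hf.unique (.of_modularForm F)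
  rw [hW] at h0
  refine ⟨_, _, .of_modularForm (CuspForm.discriminantEquiv (toCuspForm F h0)), ?_, ?_⟩
  · ext τ
    rw [Pi.mul_apply, discriminant_mul_discriminantEquiv_apply]
    rfl
  · rw [hW]; exact qExpansion_eq_qExpansion_discriminant_mul F h0

/-- The integral `q`-expansion of the Eisenstein series of weight four. -/
def intE4 : PowerSeries ℤ :=
  PowerSeries.mk fun m ↦ if m = 0 then 1 else 240 * (ArithmeticFunction.sigma 3 m : ℤ)

/-- The integral `q`-expansion of the Eisenstein series of weight six. -/
def intE6 : PowerSeries ℤ :=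
  PowerSeries.mk fun m ↦ if m = 0 then 1 else -504 * (ArithmeticFunction.sigma 5 m : ℤ)

lemma qEis_four : qEis (k := 4) (by norm_num) = intE4.map (Int.castRingHom ℂ) := by
  ext m : 1
  rw [qEis, EisensteinSeries.E_qExpansion_coeff _ ⟨2, rfl⟩, PowerSeries.coeff_map, intE4,
    PowerSeries.coeff_mk]
  split_ifs
  · simp
  · have : bernoulli 4 = -1/30 := by
      rw [bernoulli_eq_bernoulli'_of_ne_one (by norm_num), bernoulli'_four]
    rw [this]; push_cast; norm_num

lemma qEis_six : qEis (k := 6) (by norm_num) = intE6.map (Int.castRingHom ℂ) := by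
  ext m : 1
  rw [qEis, EisensteinSeries.E_qExpansion_coeff _ ⟨3, rfl⟩, PowerSeries.coeff_map, intE6,
    PowerSeries.coeff_mk]
  split_ifs
  · simp
  · have : bernoulli 6 = 1/42 := by
      have h5 : bernoulli' 5 = 0 := bernoulli'_eq_zero_of_odd (by decide) (by norm_num)
      rw [bernoulli_eq_bernoulli'_of_ne_one (by norm_num), bernoulli'_def]
      norm_num [Finset.sum_range_succ, h5, bernoulli'_four, Nat.choose]
    rw [this]; push_cast; norm_num

lemma MF.E4 : MF 4 E₄ (intE4.map (Int.castRingHom ℂ)) := by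
  rw [← qEis_four]
  exact MF.eisenstein (k := 4) (by norm_num)

lemma MF.E6 : MF 6 E₆ (intE6.map (Int.castRingHom ℂ)) := by
  rw [← qEis_six]
  exact MF.eisenstein (k := 6) (by norm_num)

lemma qDelta_eq : qDelta = (1728 : ℂ)⁻¹ •
    ((intE4.map (Int.castRingHom ℂ)) ^ 3 - (intE6.map (Int.castRingHom ℂ)) ^ 2) := by
  have h := (((MF.E4.pow 3).cast (l := 12) (by norm_num)).sub
    ((MF.E6.pow 2).cast (l := 12) (by norm_num))).smul (1728 : ℂ)⁻¹
  refine MF.discriminant.unique ?_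
  convert h using 1
  ext τ
  rw [discriminant_eq_E₄_cube_sub_E₆_sq]
  simp [div_eq_inv_mul]

lemma MF.exists_four_six (k : ℕ) (hk : Even k) (hk0 : k ≠ 0) (hk2 : k ≠ 2) :
    ∃ i j : ℕ, 4 * i + 6 * j = k := by
  obtain ⟨m, rfl⟩ := hk
  rcases Nat.even_or_odd m with ⟨n, rfl⟩ | ⟨n, rfl⟩
  · exact ⟨n, 0, by omega⟩
  · exact ⟨n - 1, 1, by omega⟩

lemma MF.E46 (i j : ℕ) : MF ((4 * i + 6 * j : ℕ) : ℤ) (E₄ ^ i * E₆ ^ j)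
    ((intE4.map (Int.castRingHom ℂ)) ^ i * (intE6.map (Int.castRingHom ℂ)) ^ j) :=
  ((MF.E4.pow i).mul (MF.E6.pow j)).cast (by push_cast; ring)

lemma coeff_zero_E46 (i j : ℕ) : ((intE4.map (Int.castRingHom ℂ)) ^ i *
    (intE6.map (Int.castRingHom ℂ)) ^ j).coeff 0 = 1 := by
  have h4 : intE4.constantCoeff = 1 := by
    rw [← PowerSeries.coeff_zero_eq_constantCoeff_apply, intE4, PowerSeries.coeff_mk, if_pos rfl]
  have h6 : intE6.constantCoeff = 1 := by
    rw [← PowerSeries.coeff_zero_eq_constantCoeff_apply, intE6, PowerSeries.coeff_mk, if_pos rfl]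
  rw [PowerSeries.coeff_zero_eq_constantCoeff_apply, map_mul, map_pow, map_pow,
    ← PowerSeries.coeff_zero_eq_constantCoeff_apply, ← PowerSeries.coeff_zero_eq_constantCoeff_apply,
    PowerSeries.coeff_map, PowerSeries.coeff_map, PowerSeries.coeff_zero_eq_constantCoeff_apply,
    PowerSeries.coeff_zero_eq_constantCoeff_apply, h4, h6]
  simp

lemma coeff_mem_of_mul {V : Subring ℂ} {I : AddSubgroup ℂ} (hI : ∀ v ∈ V, ∀ y ∈ I, v * y ∈ I)
    {D U : PowerSeries ℂ} (hD0 : D.coeff 0 = 0) (hD1 : D.coeff 1 = 1) (hD : ∀ n, D.coeff n ∈ V)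
    (hW : ∀ n, (D * U).coeff n ∈ I) (n : ℕ) : U.coeff n ∈ I := by
  induction n using Nat.strong_induction_on with
  | _ n ih =>
    have h := hW (n + 1)
    rw [PowerSeries.coeff_mul, Finset.Nat.sum_antidiagonal_eq_sum_range_succ_mk,
      Finset.sum_range_succ', Finset.sum_range_succ'] at h
    simp only [hD0, zero_mul, add_zero, zero_add, hD1, one_mul, Nat.add_sub_cancel] at h
    refine (AddSubgroup.add_mem_cancel_left I (sum_mem fun i hi ↦ ?_)).mp h
    refine hI _ (hD _) _ (ih _ ?_)
    have := Finset.mem_range.mp hi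
    omega

lemma coeff_intCast_mem (V : Subring ℂ) (W : PowerSeries ℤ) (n : ℕ) :
    (W.map (Int.castRingHom ℂ)).coeff n ∈ V := by
  simp

/-- The subring of power series with coefficients in a subring. -/
noncomputable def coeffSubring (V : Subring ℂ) : Subring (PowerSeries ℂ) := (PowerSeries.map V.subtype).range

lemma mem_coeffSubring {V : Subring ℂ} {W : PowerSeries ℂ} :
    W ∈ coeffSubring V ↔ ∀ n, W.coeff n ∈ V := by
  constructor
  · rintro ⟨U, rfl⟩ n
    simp
  · intro h
    exact ⟨PowerSeries.mk fun n ↦ ⟨_, h n⟩, by ext; simp⟩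

lemma qDelta_coeff_mem {V : Subring ℂ} (hV : (1728 : ℂ)⁻¹ ∈ V) (n : ℕ) : qDelta.coeff n ∈ V := by
  rw [qDelta_eq, PowerSeries.coeff_smul]
  refine V.mul_mem hV ?_
  have h : ∀ W : PowerSeries ℤ, W.map (Int.castRingHom ℂ) ∈ coeffSubring V := fun W ↦
    mem_coeffSubring.mpr (coeff_intCast_mem V W)
  exact mem_coeffSubring.mp (sub_mem (pow_mem (h _) 3) (pow_mem (h _) 2)) n

lemma MF.coeff_induction {V : Subring ℂ} (hV : (1728 : ℂ)⁻¹ ∈ V) {I : AddSubgroup ℂ}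
    (hI : ∀ v ∈ V, ∀ y ∈ I, v * y ∈ I) {Q : ℕ → (ℍ → ℂ) → Prop} (hzero : ∀ k, Q k 0)
    (hadd : ∀ k f g, Q k f → Q k g → Q k (f + g))
    (hE : ∀ i j, ∀ c ∈ I, Q (4 * i + 6 * j) (c • (E₄ ^ i * E₆ ^ j)))
    (hD : ∀ k g, Q k g → Q (k + 12) (ModularForm.discriminant * g)) (k : ℕ) :
    ∀ f W, MF k f W → (∀ n, W.coeff n ∈ I) → Q k f := by
  induction k using Nat.strong_induction_on with
  | _ k ih =>
    intro f W hf hW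
    rcases Nat.even_or_odd k with hk | hk
    swap
    · have h0 := hf.eq_zero_of_odd (by exact_mod_cast hk)
      subst h0
      rw [hf.eq_of_eq_zero]; exact hzero k
    rcases eq_or_ne k 2 with rfl | hk2
    · have h0 := hf.eq_zero_of_weight_two
      subst h0
      rw [hf.eq_of_eq_zero]; exact hzero _
    obtain ⟨i, j, rfl⟩ : ∃ i j : ℕ, 4 * i + 6 * j = k := by
      rcases eq_or_ne k 0 with rfl | hk0
      · exact ⟨0, 0, rfl⟩
      · exact MF.exists_four_six k hk hk0 hk2
    have h1 := hf.sub ((MF.E46 i j).smul (W.coeff 0))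
    obtain ⟨g, U, hg, hfg, hWU⟩ := h1.exists_div (by
      rw [map_sub, PowerSeries.coeff_smul, coeff_zero_E46]; simp)
    have hf' : f = ModularForm.discriminant * g + W.coeff 0 • (E₄ ^ i * E₆ ^ j : ℍ → ℂ) := by
      rw [← hfg]; simp
    have hU : ∀ n, U.coeff n ∈ I := by
      refine coeff_mem_of_mul hI qDelta_coeff_zero qDelta_coeff_one (qDelta_coeff_mem hV) ?_
      intro n
      rw [← hWU, map_sub, PowerSeries.coeff_smul, smul_eq_mul, mul_comm]
      refine sub_mem (hW n) (hI _ ?_ _ (hW 0))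
      exact mem_coeffSubring.mp (mul_mem (pow_mem (mem_coeffSubring.mpr (coeff_intCast_mem V _)) _)
        (pow_mem (mem_coeffSubring.mpr (coeff_intCast_mem V _)) _)) n
    rw [hf']
    refine hadd _ _ _ ?_ (hE i j _ (hW 0))
    rcases lt_or_ge (4 * i + 6 * j) 12 with hlt | hge
    · have h0 := hg.eq_zero_of_neg (by omega)
      subst h0
      rw [hg.eq_of_eq_zero, mul_zero]; exact hzero _
    · obtain ⟨m, hm⟩ := Nat.exists_eq_add_of_le' hge
      rw [hm]
      refine hD _ _ (ih m (by omega) g U (hg.cast ?_) hU)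
      rw [hm]; push_cast; ring

lemma MF.value_mem {V : Subring ℂ} (hV : (1728 : ℂ)⁻¹ ∈ V) {I : AddSubgroup ℂ}
    (hI : ∀ v ∈ V, ∀ y ∈ I, v * y ∈ I) {τ : ℍ} {w : ℂ} (h4 : E₄ τ * w ^ 4 ∈ V)
    (h6 : E₆ τ * w ^ 6 ∈ V) {k : ℕ} {f : ℍ → ℂ} {W : PowerSeries ℂ} (hf : MF k f W)
    (hW : ∀ n, W.coeff n ∈ I) : f τ * w ^ k ∈ I := by
  refine MF.coeff_induction hV hI (Q := fun k f ↦ f τ * w ^ k ∈ I) ?_ ?_ ?_ ?_ k f W hf hW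
  · intro k; simp
  · intro k f g hf hg
    rw [Pi.add_apply, add_mul]; exact add_mem hf hg
  · intro i j c hc
    have : (c • (E₄ ^ i * E₆ ^ j : ℍ → ℂ)) τ * w ^ (4 * i + 6 * j) =
      ((E₄ τ * w ^ 4) ^ i * (E₆ τ * w ^ 6) ^ j) * c := by
      simp only [Pi.smul_apply, Pi.mul_apply, Pi.pow_apply, smul_eq_mul]; ring
    rw [this]
    exact hI _ (mul_mem (pow_mem h4 _) (pow_mem h6 _)) _ hc
  · intro k g hg
    have : (ModularForm.discriminant * g) τ * w ^ (k + 12) =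
      ((1728 : ℂ)⁻¹ * ((E₄ τ * w ^ 4) ^ 3 - (E₆ τ * w ^ 6) ^ 2)) * (g τ * w ^ k) := by
      rw [Pi.mul_apply, discriminant_eq_E₄_cube_sub_E₆_sq]; ring
    rw [this]
    exact hI _ (mul_mem hV (sub_mem (pow_mem h4 _) (pow_mem h6 _))) _ hg

lemma MF.value_eq {τ σ : ℍ} {w v : ℂ} (h4 : E₄ τ * w ^ 4 = E₄ σ * v ^ 4)
    (h6 : E₆ τ * w ^ 6 = E₆ σ * v ^ 6) {k : ℕ} {f : ℍ → ℂ} {W : PowerSeries ℂ} (hf : MF k f W) :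
    f τ * w ^ k = f σ * v ^ k := by
  refine MF.coeff_induction (V := ⊤) (Subring.mem_top _) (I := ⊤) (fun _ _ _ _ ↦ trivial)
    (Q := fun k f ↦ f τ * w ^ k = f σ * v ^ k) ?_ ?_ ?_ ?_ k f W hf (fun _ ↦ trivial)
  · intro k; simp
  · intro k f g hf hg
    rw [Pi.add_apply, Pi.add_apply, add_mul, add_mul, hf, hg]
  · intro i j c hc
    have : ∀ (τ : ℍ) (w : ℂ), (c • (E₄ ^ i * E₆ ^ j : ℍ → ℂ)) τ * w ^ (4 * i + 6 * j) =
      ((E₄ τ * w ^ 4) ^ i * (E₆ τ * w ^ 6) ^ j) * c := by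
      intro τ w
      simp only [Pi.smul_apply, Pi.mul_apply, Pi.pow_apply, smul_eq_mul]; ring
    rw [this, this, h4, h6]
  · intro k g hg
    have : ∀ (τ : ℍ) (w : ℂ), (ModularForm.discriminant * g) τ * w ^ (k + 12) =
      ((1728 : ℂ)⁻¹ * ((E₄ τ * w ^ 4) ^ 3 - (E₆ τ * w ^ 6) ^ 2)) * (g τ * w ^ k) := by
      intro τ w
      rw [Pi.mul_apply, discriminant_eq_E₄_cube_sub_E₆_sq]; ring
    rw [this, this, h4, h6, hg]

/-- The modular invariant, normalised so that `j = E₄³ / Δ`. -/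
noncomputable def modJ (τ : ℍ) : ℂ := E₄ τ ^ 3 / ModularForm.discriminant τ

lemma MF.exists_polynomial {V : Subring ℂ} (hV : (1728 : ℂ)⁻¹ ∈ V) {I : AddSubgroup ℂ}
    (hI : ∀ v ∈ V, ∀ y ∈ I, v * y ∈ I) (n : ℕ) : ∀ {f : ℍ → ℂ} {W : PowerSeries ℂ},
    MF (12 * n) f W → (∀ n, W.coeff n ∈ I) →
    ∃ P : Polynomial ℂ, (∀ m, P.coeff m ∈ I) ∧ P.natDegree ≤ n ∧
      ∀ τ, f τ = ModularForm.discriminant τ ^ n * P.eval (modJ τ) := by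
  induction n with
  | zero =>
    intro f W hf hW
    have hf : MF 0 f W := by simpa using hf
    have h0 := hf.eq_C_of_weight_zero
    refine ⟨Polynomial.C (W.coeff 0), fun m ↦ ?_, by simp, fun τ ↦ ?_⟩
    · rw [Polynomial.coeff_C]; split_ifs
      exacts [hW 0, zero_mem _]
    · have h1 := hf.1 τ
      rw [h0] at h1
      simpa using h1.unique (HasQ.const (W.coeff 0) τ)
  | succ n ih =>
    intro f W hf hW
    have hE := ((MF.E46 (3 * (n + 1)) 0).cast (l := 12 * ((n + 1 : ℕ) : ℤ))
      (by push_cast; ring))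
    have h1 := hf.sub (hE.smul (W.coeff 0))
    obtain ⟨g, U, hg, hfg, hWU⟩ := h1.exists_div (by
      rw [map_sub, PowerSeries.coeff_smul, coeff_zero_E46]; simp)
    have hU : ∀ n, U.coeff n ∈ I := by
      refine coeff_mem_of_mul hI qDelta_coeff_zero qDelta_coeff_one (qDelta_coeff_mem hV) ?_
      intro n
      rw [← hWU, map_sub, PowerSeries.coeff_smul, smul_eq_mul, mul_comm]
      refine sub_mem (hW n) (hI _ ?_ _ (hW 0))
      exact mem_coeffSubring.mp (mul_mem (pow_mem (mem_coeffSubring.mpr (coeff_intCast_mem V _)) _)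
        (pow_mem (mem_coeffSubring.mpr (coeff_intCast_mem V _)) _)) n
    obtain ⟨P, hP, hdeg, hPv⟩ := ih (hg.cast (by push_cast; ring)) hU
    refine ⟨P + Polynomial.C (W.coeff 0) * Polynomial.X ^ (n + 1), fun m ↦ ?_, ?_, fun τ ↦ ?_⟩
    · rw [Polynomial.coeff_add, Polynomial.coeff_C_mul_X_pow]
      refine add_mem (hP m) ?_
      split_ifs
      exacts [hW 0, zero_mem _]
    · refine Polynomial.natDegree_add_le_of_degree_le (hdeg.trans (Nat.le_succ _)) ?_
      exact Polynomial.natDegree_C_mul_X_pow_le _ _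
    · have h2 := congrFun hfg τ
      have hne := discriminant_ne_zero τ
      simp only [Pi.sub_apply, Pi.smul_apply, Pi.mul_apply, Pi.pow_apply, pow_zero, mul_one,
        smul_eq_mul, hPv τ] at h2
      rw [sub_eq_iff_eq_add] at h2
      rw [h2]
      simp only [Polynomial.eval_add, Polynomial.eval_mul, Polynomial.eval_C, Polynomial.eval_pow,
        Polynomial.eval_X, modJ, div_pow, pow_mul]
      field_simp
      ring

lemma hasSum_expand {p : ℕ} (hp : p ≠ 0) {W : PowerSeries ℂ} {q q' s : ℂ} (hq : q' ^ p = q)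
    (h : HasSum (fun n ↦ W.coeff n * q ^ n) s) :
    HasSum (fun n ↦ (W.expand p hp).coeff n * q' ^ n) s := by
  have hinj : Function.Injective (fun n : ℕ ↦ p * n) := fun a b h ↦ Nat.eq_of_mul_eq_mul_left
    (Nat.pos_of_ne_zero hp) h
  refine (hinj.hasSum_iff ?_).mp ?_
  · intro n hn
    rw [PowerSeries.coeff_expand_of_not_dvd, zero_mul]
    rintro ⟨m, rfl⟩
    exact hn ⟨m, rfl⟩
  · refine h.congr_fun fun n ↦ ?_
    simp only [Function.comp_apply]
    rw [PowerSeries.coeff_expand_mul, pow_mul, hq]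

/-- The point `(τ + i) / p` of the upper half plane. -/
noncomputable def divPt (p : ℕ) [NeZero p] (i : ℤ) (τ : ℍ) : ℍ :=
  ⟨((τ : ℂ) + i) / p, by
    have hp : (0 : ℝ) < p := Nat.cast_pos.mpr (NeZero.pos p)
    rw [Complex.div_natCast_im]
    simpa using div_pos τ.im_pos hp⟩

/-- The point `p * τ` of the upper half plane. -/
noncomputable def mulPt (p : ℕ) [NeZero p] (τ : ℍ) : ℍ :=
  ⟨p * (τ : ℂ), by
    have hp : (0 : ℝ) < p := Nat.cast_pos.mpr (NeZero.pos p)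
    simpa using mul_pos hp τ.im_pos⟩

section

variable {p : ℕ} [NeZero p]

lemma coe_divPt (i : ℤ) (τ : ℍ) : (divPt p i τ : ℂ) = ((τ : ℂ) + i) / p := rfl

lemma coe_mulPt (τ : ℍ) : (mulPt p τ : ℂ) = p * (τ : ℂ) := rfl

lemma HasQ.width_mul {f : ℍ → ℂ} {W : PowerSeries ℂ} (hf : HasQ 1 f W) :
    HasQ p f (W.expand p (NeZero.ne p)) := fun τ ↦ by
  refine hasSum_expand _ ?_ (hf τ)
  have hp : (p : ℂ) ≠ 0 := NeZero.ne _
  rw [Function.Periodic.qParam, Function.Periodic.qParam, ← Complex.exp_nat_mul]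
  congr 1
  push_cast
  field_simp

lemma HasQ.comp_mulPt {f : ℍ → ℂ} {W : PowerSeries ℂ} (hf : HasQ 1 f W) :
    HasQ 1 (fun τ ↦ f (mulPt p τ)) (W.expand p (NeZero.ne p)) := fun τ ↦ by
  refine hasSum_expand _ ?_ (hf _)
  rw [Function.Periodic.qParam, Function.Periodic.qParam, ← Complex.exp_nat_mul, coe_mulPt]
  congr 1
  push_cast
  field_simp

lemma HasQ.comp_divPt {f : ℍ → ℂ} {W : PowerSeries ℂ} (hf : HasQ 1 f W) (i : ℤ) :
    HasQ p (fun τ ↦ f (divPt p i τ))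
      (PowerSeries.rescale (Complex.exp (2 * Real.pi * Complex.I / p) ^ i) W) := fun τ ↦ by
  refine (hf _).congr_fun fun n ↦ ?_
  have hp : (p : ℂ) ≠ 0 := NeZero.ne _
  rw [PowerSeries.coeff_rescale, mul_comm (_ ^ n), mul_assoc, ← mul_pow]
  congr 2
  rw [Function.Periodic.qParam, Function.Periodic.qParam, ← Complex.exp_int_mul, ← Complex.exp_add,
    coe_divPt]
  congr 1
  push_cast
  field_simp
  ring

lemma HasQ.of_periodic (hp : p.Prime) {f : ℍ → ℂ} {W : PowerSeries ℂ} (hf : HasQ p f W)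
    (hT : ∀ τ : ℍ, f (ModularGroup.T • τ) = f τ) :
    ∃ U, W = PowerSeries.expand p (NeZero.ne p) U ∧ HasQ 1 f U := by
  have hp0 : (p : ℂ) ≠ 0 := NeZero.ne _
  have h2 : HasQ p f (PowerSeries.rescale (Complex.exp (2 * Real.pi * Complex.I / p)) W) := by
    intro τ
    rw [← hT τ]
    refine (hf _).congr_fun fun n ↦ ?_
    rw [PowerSeries.coeff_rescale, mul_comm (_ ^ n), mul_assoc, ← mul_pow]
    congr 2
    rw [modular_T_smul, coe_vadd, Function.Periodic.qParam, Function.Periodic.qParam,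
      ← Complex.exp_add]
    congr 1
    push_cast
    field_simp
  have h3 := hf.unique (Nat.cast_pos.mpr hp.pos) h2
  have h4 : ∀ n, ¬ p ∣ n → W.coeff n = 0 := by
    intro n hn
    have h5 := congrArg (PowerSeries.coeff n) h3
    rw [PowerSeries.coeff_rescale] at h5
    by_contra h0
    have h6 : Complex.exp (2 * Real.pi * Complex.I / p) ^ n = 1 := by
      have : (Complex.exp (2 * Real.pi * Complex.I / p) ^ n - 1) * W.coeff n = 0 := by
        rw [sub_mul, ← h5]; ring
      rcases mul_eq_zero.mp this with h | h
      · exact sub_eq_zero.mp h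
      · exact absurd h h0
    exact hn ((Complex.isPrimitiveRoot_exp p (NeZero.ne p)).dvd_of_pow_eq_one n h6)
  have h7 : W = PowerSeries.expand p (NeZero.ne p) (PowerSeries.mk fun n ↦ W.coeff (p * n)) := by
    ext n
    by_cases hn : p ∣ n
    · obtain ⟨m, rfl⟩ := hn
      rw [PowerSeries.coeff_expand_mul, PowerSeries.coeff_mk]
    · rw [h4 n hn, PowerSeries.coeff_expand_of_not_dvd _ _ _ hn]
  refine ⟨_, h7, fun τ ↦ ?_⟩
  have h8 := hf τ
  have hinj : Function.Injective (fun n : ℕ ↦ p * n) := fun a b h ↦ Nat.eq_of_mul_eq_mul_left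
    hp.pos h
  refine ((hinj.hasSum_iff ?_).mpr h8).congr_fun ?_
  · intro n hn
    rw [h4 n, zero_mul]
    rintro ⟨m, rfl⟩
    exact hn ⟨m, rfl⟩
  · intro n
    simp only [Function.comp_apply]
    rw [PowerSeries.coeff_mk, pow_mul]
    congr 2
    rw [Function.Periodic.qParam, Function.Periodic.qParam, ← Complex.exp_nat_mul]
    congr 1
    push_cast
    field_simp


end

lemma coe_S_smul (τ : ℍ) : ((ModularGroup.S • τ : ℍ) : ℂ) = -(τ : ℂ)⁻¹ := by
  rw [modular_S_smul]; simp [inv_neg]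

lemma coe_T_smul (τ : ℍ) : ((ModularGroup.T • τ : ℍ) : ℂ) = τ + 1 := by
  rw [modular_T_smul, coe_vadd]; simp [add_comm]

namespace MF

variable {k : ℤ} {f : ℍ → ℂ} {W : PowerSeries ℂ}

lemma eq_of_coe (hf : MF k f W) {a b c d : ℤ} (h : a * d - b * c = 1) {σ σ' : ℍ}
    (hσ : (σ' : ℂ) * (c * σ + d) = a * σ + b) : f σ' = (c * σ + d) ^ k * f σ := by
  let γ : SL(2, ℤ) := ⟨!![a, b; c, d], by rw [Matrix.det_fin_two_of]; exact h⟩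
  have hden : denom γ σ = c * σ + d := by
    rw [ModularGroup.denom_apply]; rfl
  have hne : (c * σ + d : ℂ) ≠ 0 := hden ▸ denom_ne_zero γ σ
  have h1 : σ' = γ • σ := by
    apply UpperHalfPlane.ext
    rw [UpperHalfPlane.coe_specialLinearGroup_apply, eq_div_iff]
    · simpa [γ] using hσ
    · simpa [γ] using hne
  rw [h1, hf.smul_eq, hden]

variable {p : ℕ} [NeZero p]

lemma divPt_S (hf : MF k f W) {i j : ℤ} (h : (p : ℤ) ∣ i * j + 1) (τ : ℍ) :
    f (divPt p i (ModularGroup.S • τ)) = (τ : ℂ) ^ k * f (divPt p j τ) := by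
  obtain ⟨m, hm⟩ := h
  have hp : (p : ℂ) ≠ 0 := NeZero.ne _
  have hτ := τ.ne_zero
  have hm' : (i * j + 1 : ℂ) = p * m := by exact_mod_cast hm
  rw [hf.eq_of_coe (a := i) (b := -m) (c := p) (d := -j) (σ := divPt p j τ) (by linarith)]
  · congr 2
    rw [coe_divPt]; push_cast; field_simp; ring
  · rw [coe_divPt, coe_divPt, coe_S_smul]
    push_cast
    field_simp
    linear_combination -(τ:ℂ) * hm'

lemma divPt_zero_S (hf : MF k f W) (τ : ℍ) :
    f (divPt p 0 (ModularGroup.S • τ)) = (p * τ : ℂ) ^ k * f (mulPt p τ) := by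
  have hp : (p : ℂ) ≠ 0 := NeZero.ne _
  have hτ := τ.ne_zero
  rw [hf.eq_of_coe (a := 0) (b := -1) (c := 1) (d := 0) (σ := mulPt p τ) (by norm_num)]
  · congr 2
    rw [coe_mulPt]; push_cast; ring
  · rw [coe_divPt, coe_mulPt, coe_S_smul]
    push_cast
    field_simp
    ring

lemma mulPt_S (hf : MF k f W) (τ : ℍ) :
    f (mulPt p (ModularGroup.S • τ)) = (τ / p : ℂ) ^ k * f (divPt p 0 τ) := by
  have hp : (p : ℂ) ≠ 0 := NeZero.ne _
  have hτ := τ.ne_zero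
  rw [hf.eq_of_coe (a := 0) (b := -1) (c := 1) (d := 0) (σ := divPt p 0 τ) (by norm_num)]
  · congr 2
    rw [coe_divPt]; push_cast; ring
  · rw [coe_divPt, coe_mulPt, coe_S_smul]
    push_cast
    field_simp
    ring

lemma divPt_congr (hf : MF k f W) {i j : ℤ} (h : (p : ℤ) ∣ i - j) (τ : ℍ) :
    f (divPt p i τ) = f (divPt p j τ) := by
  obtain ⟨m, hm⟩ := h
  have hp : (p : ℂ) ≠ 0 := NeZero.ne _
  have hm' : (i - j : ℂ) = p * m := by exact_mod_cast hm
  rw [hf.eq_of_coe (a := 1) (b := m) (c := 0) (d := 1) (σ := divPt p j τ) (by norm_num)]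
  · simp
  · rw [coe_divPt, coe_divPt]
    push_cast
    field_simp
    linear_combination (p:ℂ) * hm'

lemma divPt_T (i : ℤ) (τ : ℍ) : divPt p i (ModularGroup.T • τ) = divPt p (i + 1) τ := by
  apply UpperHalfPlane.ext
  rw [coe_divPt, coe_divPt, coe_T_smul]
  push_cast; ring

lemma mulPt_T (hf : MF k f W) (τ : ℍ) : f (mulPt p (ModularGroup.T • τ)) = f (mulPt p τ) := by
  rw [hf.eq_of_coe (a := 1) (b := p) (c := 0) (d := 1) (σ := mulPt p τ) (by norm_num)]
  · simp
  · rw [coe_mulPt, coe_mulPt, coe_T_smul]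
    push_cast; ring

end MF

/-- The multiplicative Hecke transform attached to `g₁ ⊗ f₁ + g₂ ⊗ f₂`. -/
noncomputable def heckeProd (p : ℕ) [NeZero p] (e₁ e₂ : ℕ) (g₁ f₁ g₂ f₂ : ℍ → ℂ) (τ : ℍ) : ℂ :=
  (g₁ τ * (p ^ e₁ * f₁ (mulPt p τ)) + g₂ τ * (p ^ e₂ * f₂ (mulPt p τ))) *
    ∏ i : ZMod p, (g₁ τ * f₁ (divPt p (i.val : ℤ) τ) + g₂ τ * f₂ (divPt p (i.val : ℤ) τ))

section

variable {p : ℕ} [Fact p.Prime] {g₁ f₁ g₂ f₂ : ℍ → ℂ} {G₁ F₁ G₂ F₂ : PowerSeries ℂ}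
  {a₁ a₂ K : ℤ} {c e₁ e₂ : ℕ}

lemma heckeProd_T (hg₁ : MF a₁ g₁ G₁) (hg₂ : MF a₂ g₂ G₂) (hf₁ : MF (c + e₁ : ℕ) f₁ F₁)
    (hf₂ : MF (c + e₂ : ℕ) f₂ F₂) (τ : ℍ) :
    heckeProd p e₁ e₂ g₁ f₁ g₂ f₂ (ModularGroup.T • τ) = heckeProd p e₁ e₂ g₁ f₁ g₂ f₂ τ := by
  rw [heckeProd, heckeProd, hf₁.mulPt_T, hf₂.mulPt_T, MF.of_hasQ_T hg₁.1, MF.of_hasQ_T hg₂.1]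
  congr 1
  refine Fintype.prod_equiv (Equiv.addRight 1) _ _ fun i ↦ ?_
  rw [MF.divPt_T]
  have h : (p : ℤ) ∣ ((i.val : ℤ) + 1) - ((Equiv.addRight 1 i : ZMod p).val : ℤ) := by
    rw [← ZMod.intCast_zmod_eq_zero_iff_dvd]
    simp
  rw [hf₁.divPt_congr h, hf₂.divPt_congr h]

lemma heckeProd_S (hg₁ : MF a₁ g₁ G₁) (hg₂ : MF a₂ g₂ G₂) (hf₁ : MF (c + e₁ : ℕ) f₁ F₁)
    (hf₂ : MF (c + e₂ : ℕ) f₂ F₂) (h₁ : a₁ + (c + e₁ : ℕ) = K) (h₂ : a₂ + (c + e₂ : ℕ) = K)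
    (τ : ℍ) : heckeProd p e₁ e₂ g₁ f₁ g₂ f₂ (ModularGroup.S • τ) =
      (τ : ℂ) ^ (K * (p + 1)) * heckeProd p e₁ e₂ g₁ f₁ g₂ f₂ τ := by
  have hp : (p : ℂ) ≠ 0 := NeZero.ne _
  have hτ := τ.ne_zero
  have key1 : ∀ i j : ZMod p, i * j = -1 →
      (g₁ (ModularGroup.S • τ) * f₁ (divPt p (i.val : ℤ) (ModularGroup.S • τ)) +
        g₂ (ModularGroup.S • τ) * f₂ (divPt p (i.val : ℤ) (ModularGroup.S • τ))) =
      (τ : ℂ) ^ K *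
        (g₁ τ * f₁ (divPt p (j.val : ℤ) τ) + g₂ τ * f₂ (divPt p (j.val : ℤ) τ)) := by
    intro i j hij
    have h : (p : ℤ) ∣ (i.val : ℤ) * (j.val : ℤ) + 1 := by
      rw [← ZMod.intCast_zmod_eq_zero_iff_dvd]
      simp [hij]
    rw [hf₁.divPt_S h, hf₂.divPt_S h, hg₁.2, hg₂.2, mul_add]
    nth_rw 1 [← h₁]
    nth_rw 1 [← h₂]
    rw [zpow_add₀ hτ, zpow_add₀ hτ]
    ring
  have key2 : (g₁ (ModularGroup.S • τ) * f₁ (divPt p 0 (ModularGroup.S • τ)) +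
        g₂ (ModularGroup.S • τ) * f₂ (divPt p 0 (ModularGroup.S • τ))) =
      (p : ℂ) ^ c * (τ : ℂ) ^ K *
        (g₁ τ * (p ^ e₁ * f₁ (mulPt p τ)) + g₂ τ * (p ^ e₂ * f₂ (mulPt p τ))) := by
    rw [hf₁.divPt_zero_S, hf₂.divPt_zero_S, hg₁.2, hg₂.2, mul_add]
    nth_rw 1 [← h₁]
    nth_rw 1 [← h₂]
    rw [zpow_add₀ hτ, zpow_add₀ hτ, mul_zpow, mul_zpow, zpow_natCast, zpow_natCast, zpow_natCast,
      zpow_natCast, pow_add, pow_add]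
    ring
  have key3 : g₁ (ModularGroup.S • τ) * (p ^ e₁ * f₁ (mulPt p (ModularGroup.S • τ))) +
        g₂ (ModularGroup.S • τ) * (p ^ e₂ * f₂ (mulPt p (ModularGroup.S • τ))) =
      ((p : ℂ) ^ c)⁻¹ * (τ : ℂ) ^ K *
        (g₁ τ * f₁ (divPt p 0 τ) + g₂ τ * f₂ (divPt p 0 τ)) := by
    rw [hf₁.mulPt_S, hf₂.mulPt_S, hg₁.2, hg₂.2, mul_add]
    nth_rw 1 [← h₁]
    nth_rw 1 [← h₂]
    rw [zpow_add₀ hτ, zpow_add₀ hτ, div_zpow, div_zpow, zpow_natCast, zpow_natCast, zpow_natCast,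
      zpow_natCast, pow_add (p : ℂ), pow_add (p : ℂ)]
    field_simp
  rw [heckeProd, heckeProd, key3, ← Finset.mul_prod_erase Finset.univ _ (Finset.mem_univ (0 : ZMod p)),
    ← Finset.mul_prod_erase Finset.univ (fun i : ZMod p ↦
      (g₁ τ * f₁ (divPt p (i.val : ℤ) τ) + g₂ τ * f₂ (divPt p (i.val : ℤ) τ)))
      (Finset.mem_univ (0 : ZMod p))]
  simp only [ZMod.val_zero, Nat.cast_zero]
  rw [key2]
  have key4 : ∏ i ∈ Finset.univ.erase (0 : ZMod p),
      (g₁ (ModularGroup.S • τ) * f₁ (divPt p (i.val : ℤ) (ModularGroup.S • τ)) +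
        g₂ (ModularGroup.S • τ) * f₂ (divPt p (i.val : ℤ) (ModularGroup.S • τ))) =
      ((τ : ℂ) ^ K) ^ (p - 1) * ∏ i ∈ Finset.univ.erase (0 : ZMod p),
        (g₁ τ * f₁ (divPt p (i.val : ℤ) τ) + g₂ τ * f₂ (divPt p (i.val : ℤ) τ)) := by
    have hcard : (Finset.univ.erase (0 : ZMod p)).card = p - 1 := by
      rw [Finset.card_erase_of_mem (Finset.mem_univ _), Finset.card_univ, ZMod.card]
    rw [← hcard, ← Finset.prod_const, ← Finset.prod_mul_distrib]
    refine Finset.prod_nbij' (fun i ↦ -i⁻¹) (fun i ↦ -i⁻¹) ?_ ?_ ?_ ?_ ?_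
    · intro i hi; simpa using hi
    · intro i hi; simpa using hi
    · intro i hi; simp
    · intro i hi; simp
    · intro i hi
      refine key1 _ _ ?_
      have : i ≠ 0 := by simpa using hi
      field_simp
  rw [key4]
  have hpow : (τ : ℂ) ^ (K * (p + 1)) = (τ : ℂ) ^ K * (τ : ℂ) ^ K * ((τ : ℂ) ^ K) ^ (p - 1) := by
    have h1 := (Fact.out : p.Prime).one_le
    obtain ⟨m, rfl⟩ := Nat.exists_eq_add_of_le h1
    rw [← zpow_natCast, ← zpow_mul, ← zpow_add₀ hτ, ← zpow_add₀ hτ]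
    congr 1
    rw [Nat.add_sub_cancel_left]; push_cast; ring
  rw [hpow]
  field_simp

end

lemma PowerSeries.expand_injective {R : Type*} [CommRing R] {p : ℕ} (hp : p ≠ 0) :
    Function.Injective (PowerSeries.expand (R := R) p hp) := by
  intro f g h
  ext n
  rw [← PowerSeries.coeff_expand_mul p hp f, h, PowerSeries.coeff_expand_mul]

/-- The coefficients of the power series are fixed by Frobenius. -/
def FrobFixed {R : Type*} [CommRing R] (p : ℕ) [NeZero p] (W : PowerSeries R) : Prop :=
  W ^ p = W.expand p (NeZero.ne p)

namespace FrobFixed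

variable {R : Type*} [CommRing R] {p : ℕ} [Fact p.Prime] {W U : PowerSeries R}

lemma mul (h : FrobFixed p W) (h' : FrobFixed p U) : FrobFixed p (W * U) := by
  rw [FrobFixed] at *
  rw [mul_pow, h, h', map_mul]

lemma pow (h : FrobFixed p W) (n : ℕ) : FrobFixed p (W ^ n) := by
  rw [FrobFixed] at *
  rw [pow_right_comm, h, map_pow]

variable [CharP R p]

lemma of_coeff (h : ∀ n, W.coeff n ^ p = W.coeff n) : FrobFixed p W := by
  have h1 : (W.expand p (NeZero.ne p)).map (frobenius R p) = W ^ p :=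
    MvPowerSeries.map_frobenius_expand p (NeZero.ne p) (f := W)
  rw [FrobFixed, ← h1]
  ext n
  rw [PowerSeries.coeff_map, PowerSeries.coeff_expand, frobenius_def]
  split_ifs
  · exact h _
  · exact zero_pow (NeZero.ne p)

lemma map_int (W : PowerSeries ℤ) : FrobFixed p (W.map (Int.castRingHom R)) := by
  refine of_coeff fun n ↦ ?_
  rw [PowerSeries.coeff_map, ← frobenius_def, eq_intCast, map_intCast]

lemma sub (h : FrobFixed p W) (h' : FrobFixed p U) : FrobFixed p (W - U) := by
  have : CharP (PowerSeries R) p := charP_of_injective_ringHom PowerSeries.C_injective p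
  rw [FrobFixed] at *
  rw [sub_pow_char, h, h', map_sub]

end FrobFixed

section

variable {p : ℕ} [Fact p.Prime] {g₁ f₁ g₂ f₂ : ℍ → ℂ} {a₁ a₂ K : ℤ} {c e₁ e₂ : ℕ}
  {V : ValuationSubring ℂ} {G₁ F₁ G₂ F₂ : PowerSeries V}

open IsLocalRing in
lemma exists_heckeProd_expansion (hV : V.valuation (p : ℂ) < 1)
    (hg₁ : MF a₁ g₁ (G₁.map V.subtype)) (hg₂ : MF a₂ g₂ (G₂.map V.subtype))
    (hf₁ : MF (c + e₁ : ℕ) f₁ (F₁.map V.subtype)) (hf₂ : MF (c + e₂ : ℕ) f₂ (F₂.map V.subtype))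
    (h₁ : a₁ + (c + e₁ : ℕ) = K) (h₂ : a₂ + (c + e₂ : ℕ) = K)
    (hF₁ : FrobFixed p (F₁.map (residue V))) (hF₂ : FrobFixed p (F₂.map (residue V))) :
    ∃ U : PowerSeries V, MF (K * (p + 1)) (heckeProd p e₁ e₂ g₁ f₁ g₂ f₂) (U.map V.subtype) ∧
      U.map (residue V) =
        ((G₁.map (residue V)) * ((p : PowerSeries (ResidueField V)) ^ e₁ *
            (F₁.map (residue V)).expand p (NeZero.ne p)) +
          (G₂.map (residue V)) * ((p : PowerSeries (ResidueField V)) ^ e₂ *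
            (F₂.map (residue V)).expand p (NeZero.ne p))) *
        ((G₁.map (residue V)) ^ p * F₁.map (residue V) +
          (G₂.map (residue V)) ^ p * F₂.map (residue V)) := by
  have hp : p.Prime := Fact.out
  have : CharP (ResidueField V) p := residueField_charP V hp hV
  have : CharP (PowerSeries (ResidueField V)) p :=
    charP_of_injective_ringHom PowerSeries.C_injective p
  set z : ℂ := Complex.exp (2 * Real.pi * Complex.I / p) with hz
  have hzp : z ^ p = 1 := (Complex.isPrimitiveRoot_exp p (NeZero.ne p)).pow_eq_one
  have hzV : z ∈ V := by
    rw [← V.valuation_le_one_iff]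
    have h1 : V.valuation z ^ p = 1 := by rw [← map_pow, hzp, map_one]
    exact ((pow_eq_one_iff_of_nonneg zero_le (NeZero.ne p)).mp h1).le
  let ζ : V := ⟨z, hzV⟩
  have hζ : residue V ζ = 1 := by
    have h1 : ζ ^ p = 1 := Subtype.ext hzp
    apply frobenius_inj (ResidueField V) p
    rw [frobenius_def, ← map_pow, h1, map_one, map_one]
  let Uinf : PowerSeries V := G₁ * ((p : PowerSeries V) ^ e₁ * F₁.expand p (NeZero.ne p)) +
    G₂ * ((p : PowerSeries V) ^ e₂ * F₂.expand p (NeZero.ne p))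
  let Ui : ZMod p → PowerSeries V := fun i ↦
    G₁.expand p (NeZero.ne p) * PowerSeries.rescale (ζ ^ i.val) F₁ +
      G₂.expand p (NeZero.ne p) * PowerSeries.rescale (ζ ^ i.val) F₂
  have hconst : ∀ (e : ℕ) (h : ℝ), HasQ h (fun _ ↦ (p : ℂ) ^ e) ((p : PowerSeries ℂ) ^ e) := by
    intro e h
    have h1 := HasQ.const (h := h) ((p : ℂ) ^ e)
    simpa using h1
  have hinf : HasQ 1 (fun τ ↦ g₁ τ * (p ^ e₁ * f₁ (mulPt p τ)) + g₂ τ * (p ^ e₂ * f₂ (mulPt p τ)))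
      (Uinf.map V.subtype) := by
    have h1 := (hg₁.1.mul ((hconst e₁ 1).mul (hf₁.1.comp_mulPt (p := p)))).add
      (hg₂.1.mul ((hconst e₂ 1).mul (hf₂.1.comp_mulPt (p := p))))
    simp only [Uinf, map_add, map_mul, map_pow, map_natCast, PowerSeries.map_expand]
    exact h1
  have hi : ∀ i : ZMod p, HasQ p (fun τ ↦ g₁ τ * f₁ (divPt p (i.val : ℤ) τ) +
      g₂ τ * f₂ (divPt p (i.val : ℤ) τ)) ((Ui i).map V.subtype) := by
    intro i
    have h1 := (hg₁.1.width_mul (p := p).mul (hf₁.1.comp_divPt (p := p) (i.val : ℤ))).add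
      (hg₂.1.width_mul (p := p).mul (hf₂.1.comp_divPt (p := p) (i.val : ℤ)))
    have h2 : V.subtype (ζ ^ i.val) =
      Complex.exp (2 * Real.pi * Complex.I / p) ^ (i.val : ℤ) := by
      rw [map_pow, zpow_natCast]; rfl
    simp only [Ui, map_add, map_mul, ← PowerSeries.rescale_map, h2, PowerSeries.map_expand]
    exact h1
  have htot : HasQ p (heckeProd p e₁ e₂ g₁ f₁ g₂ f₂)
      ((Uinf.expand p (NeZero.ne p) * ∏ i, Ui i).map V.subtype) := by
    have h1 := (hinf.width_mul (p := p)).mul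
      (HasQ.prod Finset.univ (fun i _ ↦ hi i))
    rw [map_mul, map_prod, PowerSeries.map_expand]
    convert h1 using 1
    ext τ
    simp [heckeProd, Finset.prod_apply]
  obtain ⟨U', hU', hQ⟩ := htot.of_periodic hp (heckeProd_T hg₁ hg₂ hf₁ hf₂)
  set Wt := Uinf.expand p (NeZero.ne p) * ∏ i, Ui i with hWt
  let U : PowerSeries V := PowerSeries.mk fun n ↦ Wt.coeff (p * n)
  have hUU : U.map V.subtype = U' := by
    ext n
    rw [PowerSeries.coeff_map, PowerSeries.coeff_mk, ← PowerSeries.coeff_map, hU',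
      PowerSeries.coeff_expand_mul]
  have hWU : Wt = U.expand p (NeZero.ne p) := by
    have hinj : Function.Injective (PowerSeries.map V.subtype) :=
      PowerSeries.map_injective _ V.subtype_injective
    apply hinj
    rw [PowerSeries.map_expand, hUU, hU']
  refine ⟨U, ⟨hUU ▸ hQ, heckeProd_S hg₁ hg₂ hf₁ hf₂ h₁ h₂⟩, ?_⟩
  apply PowerSeries.expand_injective (NeZero.ne p)
  rw [← PowerSeries.map_expand, ← hWU, hWt]
  have h5 : ∀ i, (Ui i).map (residue V) =
      (G₁.map (residue V)).expand p (NeZero.ne p) * F₁.map (residue V) +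
        (G₂.map (residue V)).expand p (NeZero.ne p) * F₂.map (residue V) := by
    intro i
    simp only [Ui, map_add, map_mul, ← PowerSeries.rescale_map, map_pow, hζ, one_pow,
      PowerSeries.rescale_one, PowerSeries.map_expand, RingHom.id_apply]
  rw [map_mul, map_prod, Finset.prod_congr rfl fun i _ ↦ h5 i, Finset.prod_const, Finset.card_univ,
    ZMod.card, add_pow_char, mul_pow, mul_pow, hF₁, hF₂]
  simp only [Uinf, map_add, map_mul, map_pow, map_natCast, PowerSeries.map_expand]

end

lemma HasQ.tendsto_atImInfty {h : ℝ} (hh : 0 < h) {f : ℍ → ℂ} {W : PowerSeries ℂ}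
    (hf : HasQ h f W) : Tendsto f atImInfty (𝓝 (W.coeff 0)) := by
  have h1 := (hf.hasFPowerSeriesOnBall hh).hasFPowerSeriesAt.continuousAt.tendsto
  have h2 : ∑' n : ℕ, W.coeff n * (0 : ℂ) ^ n = W.coeff 0 := by
    rw [tsum_eq_single 0]
    · simp
    · intro n hn; simp [hn]
  rw [h2] at h1
  exact (h1.comp (qParam_tendsto_atImInfty hh)).congr fun τ ↦ (hf.eq_tsum τ).symm

lemma MF.exists_zero {f : ℍ → ℂ} {W : PowerSeries ℂ} (hf : MF 12 f W)
    (h0 : W.coeff 0 ≠ 0) : ∃ τ, f τ = 0 := by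
  by_contra! hne
  have hS : (ModularForm.discriminant / f) ∣[(0 : ℤ)] ModularGroup.S =
      ModularForm.discriminant / f := by
    ext τ
    rw [SL_slash_apply, Pi.div_apply, hf.2, MF.discriminant.2, ModularGroup.denom_S,
      mul_div_mul_left _ _ (zpow_ne_zero 12 τ.ne_zero)]
    simp
  have hT : (ModularForm.discriminant / f) ∣[(0 : ℤ)] ModularGroup.T =
      ModularForm.discriminant / f := by
    ext τ
    rw [SL_slash_apply, Pi.div_apply, of_hasQ_T hf.1, of_hasQ_T MF.discriminant.1]
    simp
  have hall := slash_action_generators_SL2Z hS hT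
  obtain ⟨F, hF⟩ : ∃ F : ModularForm 𝒮ℒ 0, ⇑F = ModularForm.discriminant / f := by
    refine ⟨{ toFun := ModularForm.discriminant / f, slash_action_eq' := ?_, holo' := ?_,
              bdd_at_cusps' := ?_ }, rfl⟩
    · rintro A ⟨A, rfl⟩
      exact hall A
    · have h1 := hf.1.mdifferentiable one_pos
      have h2 := MF.discriminant.1.mdifferentiable one_pos
      rw [UpperHalfPlane.mdifferentiable_iff] at h1 h2 ⊢
      exact h2.div h1 fun z _ ↦ hne _
    · intro c hc
      rw [Subgroup.IsArithmetic.isCusp_iff_isCusp_SL2Z] at hc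
      rw [OnePoint.isBoundedAt_iff_forall_SL2Z hc]
      intro γ _
      rw [hall]
      have h1 := (MF.discriminant.1.tendsto_atImInfty one_pos).div
        (hf.1.tendsto_atImInfty one_pos) h0
      exact h1.isBigO_one ℝ
  obtain ⟨c, hc⟩ := levelOne_weight_zero_const F
  have h1 : ModularForm.discriminant = c • f := by
    ext τ
    have h2 := congrFun (hF.symm.trans hc) τ
    rw [Pi.div_apply, div_eq_iff (hne τ)] at h2
    simpa using h2
  have h2 : qDelta = c • W := MF.discriminant.unique (h1 ▸ hf.smul c)
  have h3 := congrArg (PowerSeries.coeff 0) h2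
  have h4 := congrArg (PowerSeries.coeff 1) h2
  rw [qDelta_coeff_zero, PowerSeries.coeff_smul, smul_eq_mul] at h3
  rw [qDelta_coeff_one, PowerSeries.coeff_smul, smul_eq_mul] at h4
  have h5 : c = 0 := by
    rcases mul_eq_zero.mp h3.symm with h | h
    · exact h
    · exact absurd h h0
  rw [h5, zero_mul] at h4
  exact one_ne_zero h4

lemma modJ_surjective (c : ℂ) : ∃ τ, modJ τ = c := by
  have h1 := ((MF.E46 3 0).cast (l := 12) (by norm_num)).sub (MF.discriminant.smul c)
  obtain ⟨τ, hτ⟩ := h1.exists_zero (by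
    rw [map_sub, coeff_zero_E46, PowerSeries.coeff_smul, qDelta_coeff_zero]; simp)
  refine ⟨τ, ?_⟩
  have hne := discriminant_ne_zero τ
  rw [modJ, div_eq_iff hne]
  simp only [pow_zero, mul_one, Pi.sub_apply, Pi.pow_apply, Pi.smul_apply, smul_eq_mul] at hτ
  exact sub_eq_zero.mp hτ

lemma modJ_smul (γ : SL(2, ℤ)) (τ : ℍ) : modJ (γ • τ) = modJ τ := by
  have hne := denom_ne_zero γ τ
  rw [modJ, modJ, MF.E4.smul_eq, MF.discriminant.smul_eq, mul_pow, ← zpow_natCast, ← zpow_mul]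
  exact mul_div_mul_left _ _ (zpow_ne_zero _ hne)

lemma exists_fd_modJ (c : ℂ) : ∃ τ ∈ ModularGroup.fd, modJ τ = c := by
  obtain ⟨σ, hσ⟩ := modJ_surjective c
  obtain ⟨γ, hγ⟩ := ModularGroup.exists_smul_mem_fd σ
  exact ⟨γ • σ, hγ, by rw [modJ_smul, hσ]⟩

section

variable (V : ValuationSubring ℂ)

/-- If all roots of a polynomial have valuation at least one, its coefficients are dominated by
the constant one. -/
lemma val_coeff_le_of_roots (n : ℕ) : ∀ R : Polynomial ℂ, R.natDegree = n →
    (∀ x, R.IsRoot x → 1 ≤ V.valuation x) → ∀ m, V.valuation (R.coeff m) ≤ V.valuation (R.coeff 0) := by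
  induction n with
  | zero =>
    intro R hR _ m
    rw [Polynomial.eq_C_of_natDegree_eq_zero hR, Polynomial.coeff_C]
    split_ifs
    · simp
    · simp
  | succ n ih =>
    intro R hR hroot m
    obtain ⟨x, hx⟩ := IsAlgClosed.exists_root R (by
      rw [Polynomial.degree_eq_natDegree (by rintro rfl; simp at hR), hR]; norm_cast)
    obtain ⟨S, rfl⟩ := Polynomial.dvd_iff_isRoot.mpr hx
    have hS0 : S ≠ 0 := by rintro rfl; simp at hR
    have hS : S.natDegree = n := by
      rw [Polynomial.natDegree_mul (Polynomial.X_sub_C_ne_zero x) hS0,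
        Polynomial.natDegree_X_sub_C] at hR
      omega
    have h1 := ih S hS fun y hy ↦ hroot y (by
      rw [Polynomial.IsRoot, Polynomial.eval_mul, hy.eq_zero, mul_zero])
    have hx1 := hroot x hx
    have h0 : V.valuation (((Polynomial.X - Polynomial.C x) * S).coeff 0) =
        V.valuation x * V.valuation (S.coeff 0) := by
      rw [Polynomial.mul_coeff_zero]; simp
    rw [h0]
    have h2 : V.valuation (S.coeff 0) ≤ V.valuation x * V.valuation (S.coeff 0) :=
      le_mul_of_one_le_left zero_le hx1
    cases m with
    | zero => rw [h0]
    | succ m =>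
      rw [sub_mul, Polynomial.coeff_sub, Polynomial.coeff_X_mul, Polynomial.coeff_C_mul]
      refine (V.valuation.map_sub _ _).trans (max_le ((h1 m).trans h2) ?_)
      rw [map_mul]
      exact mul_le_mul_right (h1 _) _

end

/-- The maximal ideal of a valuation subring of `ℂ`, as an additive subgroup of `ℂ`. -/
noncomputable def maxGroup (V : ValuationSubring ℂ) : AddSubgroup ℂ := V.valuation.ltAddSubgroup 1

section

variable {V : ValuationSubring ℂ}

lemma mem_maxGroup {x : ℂ} : x ∈ maxGroup V ↔ V.valuation x < 1 := Iff.rfl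

lemma mul_mem_maxGroup : ∀ v ∈ V.toSubring, ∀ y ∈ maxGroup V, v * y ∈ maxGroup V := by
  intro v hv y hy
  rw [mem_maxGroup, map_mul]
  exact mul_lt_one_of_nonneg_of_lt_one_right ((V.valuation_le_one_iff v).mpr hv) zero_le hy

open IsLocalRing in
lemma coeff_mem_maxGroup {W : PowerSeries V} (h : W.map (residue V) = 0) (n : ℕ) :
    (W.map V.subtype).coeff n ∈ maxGroup V := by
  rw [PowerSeries.coeff_map, mem_maxGroup]
  refine (residue_eq_zero_iff_val V _).mp ?_
  rw [← PowerSeries.coeff_map, h, map_zero]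

lemma map_intSeries (W : PowerSeries ℤ) :
    (W.map (Int.castRingHom V)).map V.subtype = W.map (Int.castRingHom ℂ) := by
  ext n; simp

open IsLocalRing in
lemma map_residue_intSeries (W : PowerSeries ℤ) :
    (W.map (Int.castRingHom V)).map (residue V) = W.map (Int.castRingHom (ResidueField V)) := by
  ext n; simp

variable {p : ℕ} [hp : Fact p.Prime]

lemma inv_1728_mem (hp5 : 5 ≤ p) (hV : V.valuation (p : ℂ) < 1) : (1728 : ℂ)⁻¹ ∈ V := by
  have h : ¬ (p : ℤ) ∣ 1728 := by
    intro h
    have h1 : p ∣ 2 ^ 6 * 3 ^ 3 := by norm_num; exact_mod_cast h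
    rcases (Nat.Prime.dvd_mul hp.out).mp h1 with h2 | h2
    · have := Nat.le_of_dvd (by norm_num) (hp.out.dvd_of_dvd_pow h2); omega
    · have := Nat.le_of_dvd (by norm_num) (hp.out.dvd_of_dvd_pow h2); omega
  have := val_intCast_eq_one V hp.out hV h
  rw [← V.valuation_le_one_iff, map_inv₀]
  rw [Int.cast_ofNat] at this
  rw [this, inv_one]

open IsLocalRing in
lemma exists_discriminant_series (hp5 : 5 ≤ p) (hV : V.valuation (p : ℂ) < 1) :
    ∃ D : PowerSeries V, D.map V.subtype = qDelta ∧ FrobFixed p (D.map (residue V)) := by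
  have : CharP (ResidueField V) p := residueField_charP V hp.out hV
  let c : V := ⟨(1728 : ℂ)⁻¹, inv_1728_mem hp5 hV⟩
  have hc : c * 1728 = 1 := by
    have h1 : ((1728 : V) : ℂ) = 1728 := map_ofNat V.subtype 1728
    ext
    change (1728 : ℂ)⁻¹ * ((1728 : V) : ℂ) = 1
    rw [h1]
    norm_num
  have hc' : residue V c * 1728 = 1 := by
    have := congrArg (residue V) hc
    rwa [map_mul, map_ofNat, map_one] at this
  refine ⟨PowerSeries.C c * ((intE4.map (Int.castRingHom V)) ^ 3 -
    (intE6.map (Int.castRingHom V)) ^ 2), ?_, ?_⟩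
  · rw [map_mul, map_sub, map_pow, map_pow, map_intSeries, map_intSeries, PowerSeries.map_C,
      qDelta_eq, PowerSeries.smul_eq_C_mul]
    rfl
  · rw [map_mul, map_sub, map_pow, map_pow, map_residue_intSeries, map_residue_intSeries,
      PowerSeries.map_C]
    refine FrobFixed.mul ?_ (((FrobFixed.map_int _).pow 3).sub ((FrobFixed.map_int _).pow 2))
    refine FrobFixed.of_coeff fun n ↦ ?_
    rw [PowerSeries.coeff_C]
    split_ifs
    · have h1 : (1728 : ResidueField V) ^ p = 1728 := by
        have := map_ofNat (frobenius (ResidueField V) p) 1728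
        rwa [frobenius_def] at this
      have h2 := congrArg (· ^ p) hc'
      simp only [mul_pow, h1, one_pow] at h2
      have h3 : (1728 : ResidueField V) ≠ 0 := right_ne_zero_of_mul_eq_one hc'
      exact mul_right_cancel₀ h3 (h2.trans hc'.symm)
    · exact zero_pow (NeZero.ne p)

open IsLocalRing in
/-- Kronecker's congruence. -/
lemma exists_kronecker_polynomial (hp5 : 5 ≤ p) (hV : V.valuation (p : ℂ) < 1) :
    ∃ Q : Polynomial ℂ, (∀ m, V.valuation (Q.coeff m) < 1) ∧
      ∀ τ, heckeProd p 0 0 (E₄ ^ 3) ModularForm.discriminant (-ModularForm.discriminant) (E₄ ^ 3) τ =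
        ModularForm.discriminant τ ^ (2 * (p + 1)) *
          (Q - (Polynomial.X ^ p - Polynomial.X) ^ 2).eval (modJ τ) := by
  obtain ⟨D, hD, hDF⟩ := exists_discriminant_series hp5 hV
  set A : PowerSeries V := (intE4.map (Int.castRingHom V)) ^ 3 with hA
  have hE : MF 12 (E₄ ^ 3) (A.map V.subtype) := by
    rw [hA, map_pow, map_intSeries]
    exact (MF.E4.pow 3).cast (by norm_num)
  have hAF : FrobFixed p (A.map (residue V)) := by
    have : CharP (ResidueField V) p := residueField_charP V hp.out hV
    rw [hA, map_pow, map_residue_intSeries]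
    exact (FrobFixed.map_int _).pow 3
  have hDel : MF 12 ModularForm.discriminant (D.map V.subtype) := hD ▸ MF.discriminant
  have hDelneg : MF 12 (-ModularForm.discriminant) ((-D).map V.subtype) := by
    have := hDel.smul (-1)
    rw [map_neg]
    simpa using this
  obtain ⟨U, hU, hUr⟩ := exists_heckeProd_expansion (K := 24) (c := 12) (e₁ := 0) (e₂ := 0) hV hE
    hDelneg hDel hE (by norm_num) (by norm_num) hDF hAF
  have hR : MF (24 * (p + 1)) ((E₄ ^ 3 * ModularForm.discriminant ^ p -
      ModularForm.discriminant * (E₄ ^ 3) ^ p) ^ 2) (((A * D ^ p - D * A ^ p) ^ 2).map V.subtype) := by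
    have h1 := ((hE.mul (hDel.pow p)).cast (l := 12 * (p + 1)) (by ring)).sub
      ((hDel.mul (hE.pow p)).cast (l := 12 * (p + 1)) (by ring))
    have h2 := (h1.pow 2).cast (l := 24 * (p + 1)) (by push_cast; ring)
    simpa only [map_pow, map_sub, map_mul] using h2
  have hsum := (hU.add hR).cast (l := 12 * ((2 * (p + 1) : ℕ) : ℤ)) (by push_cast; ring)
  rw [← map_add] at hsum
  have h0 : (U + (A * D ^ p - D * A ^ p) ^ 2).map (residue V) = 0 := by
    rw [FrobFixed] at hDF hAF
    rw [map_add, hUr, ← hDF, ← hAF]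
    simp only [map_pow, map_sub, map_mul, map_neg, pow_zero, one_mul]
    have hodd : Odd p := hp.out.odd_of_ne_two (by omega)
    rw [hodd.neg_pow]
    ring
  obtain ⟨Q, hQ, -, hQv⟩ := MF.exists_polynomial (V := V.toSubring) (inv_1728_mem hp5 hV)
    mul_mem_maxGroup (2 * (p + 1)) hsum (coeff_mem_maxGroup h0)
  refine ⟨Q, hQ, fun τ ↦ ?_⟩
  have h3 := hQv τ
  have hne := discriminant_ne_zero τ
  rw [Polynomial.eval_sub, mul_sub, ← h3]
  simp only [Pi.add_apply, Pi.pow_apply, Pi.sub_apply, Pi.mul_apply, Polynomial.eval_pow,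
    Polynomial.eval_sub, Polynomial.eval_X]
  have h4 : E₄ τ ^ 3 = modJ τ * ModularForm.discriminant τ := by
    rw [modJ, div_mul_cancel₀ _ hne]
  rw [h4]
  ring

open Polynomial in
lemma eval_intCast_mem_maxGroup {Q : ℂ[X]} (hQ : ∀ m, V.valuation (Q.coeff m) < 1) (c : ℤ) :
    Q.eval (c : ℂ) ∈ maxGroup V := by
  rw [eval_eq_sum_range]
  refine sum_mem fun m _ ↦ ?_
  rw [mul_comm]
  exact mul_mem_maxGroup _ (pow_mem (intCast_mem V.toSubring c) m) _ (hQ m)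

open Polynomial in
lemma coeff_comp_mem_maxGroup {Q : ℂ[X]} (hQ : ∀ m, V.valuation (Q.coeff m) < 1) (c : ℤ) (n : ℕ) :
    (Q.comp (X + C (c : ℂ))).coeff n ∈ maxGroup V := by
  rw [← taylor_apply, taylor_coeff]
  refine eval_intCast_mem_maxGroup (fun m ↦ ?_) c
  rw [hasseDeriv_coeff]
  exact mul_mem_maxGroup _ (natCast_mem V.toSubring _) _ (hQ _)

open Polynomial in
lemma artinSchreier_sq_comp_coeff (hp5 : 5 ≤ p) (c : ℤ) :
    (p : ℤ) ∣ ((((X : ℤ[X]) ^ p - X) ^ 2).comp (X + C c)).coeff 0 ∧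
    ¬ (p : ℤ) ∣ ((((X : ℤ[X]) ^ p - X) ^ 2).comp (X + C c)).coeff 2 := by
  have h : ((((X : ℤ[X]) ^ p - X) ^ 2).comp (X + C c)).map (Int.castRingHom (ZMod p)) =
      X ^ (2 * p) - C 2 * X ^ (p + 1) + X ^ 2 := by
    have h1 : ((c : ZMod p)) ^ p = c := ZMod.pow_card _
    simp only [Polynomial.pow_comp, Polynomial.sub_comp, Polynomial.X_comp, Polynomial.map_pow,
      Polynomial.map_sub, Polynomial.map_add, map_X, map_C, eq_intCast (Int.castRingHom _)]
    rw [add_pow_char, ← C_pow, h1]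
    simp only [map_ofNat]
    ring
  have key : ∀ n, (p : ℤ) ∣ ((((X : ℤ[X]) ^ p - X) ^ 2).comp (X + C c)).coeff n ↔
      (X ^ (2 * p) - C 2 * X ^ (p + 1) + X ^ 2 : (ZMod p)[X]).coeff n = 0 := by
    intro n
    rw [← h, coeff_map, eq_intCast (Int.castRingHom _), ZMod.intCast_zmod_eq_zero_iff_dvd]
  rw [key, key]
  have : Fact (1 < p) := ⟨by omega⟩
  constructor
  · simp only [coeff_add, coeff_sub, coeff_C_mul, coeff_X_pow]
    rw [if_neg (by omega), if_neg (by omega), if_neg (by omega)]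
    simp
  · simp only [coeff_add, coeff_sub, coeff_C_mul, coeff_X_pow]
    rw [if_neg (by omega), if_neg (by omega)]
    simp

/-- Every residue class of integers contains a singular value of a cyclic `p`-isogeny. -/
lemma exists_modJ_isogeny (hp5 : 5 ≤ p) (hV : V.valuation (p : ℂ) < 1) (c : ℤ) :
    ∃ τ ∈ ModularGroup.fd, V.valuation (modJ τ - c) < 1 ∧
      (modJ τ = modJ (mulPt p τ) ∨ ∃ i : ℤ, modJ τ = modJ (divPt p i τ)) := by
  obtain ⟨Q, hQ, hQv⟩ := exists_kronecker_polynomial hp5 hV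
  set P := Q - (Polynomial.X ^ p - Polynomial.X) ^ 2 with hP
  suffices h : ∃ x, P.eval x = 0 ∧ V.valuation (x - c) < 1 by
    obtain ⟨x, hx, hxc⟩ := h
    obtain ⟨τ, hτ, rfl⟩ := exists_fd_modJ x
    refine ⟨τ, hτ, hxc, ?_⟩
    have h1 := hQv τ
    rw [hx, mul_zero, heckeProd] at h1
    have hcross : ∀ σ : ℍ, E₄ τ ^ 3 * ModularForm.discriminant σ +
        -ModularForm.discriminant τ * E₄ σ ^ 3 = 0 → modJ τ = modJ σ := by
      intro σ hσ
      rw [modJ, modJ, div_eq_div_iff (discriminant_ne_zero τ) (discriminant_ne_zero σ)]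
      linear_combination hσ
    rcases mul_eq_zero.mp h1 with h2 | h2
    · left
      refine hcross _ ?_
      simp only [pow_zero, one_mul] at h2
      exact h2
    · right
      obtain ⟨i, -, hi⟩ := Finset.prod_eq_zero_iff.mp h2
      exact ⟨_, hcross _ hi⟩
  by_contra! hcon
  set R := P.comp (Polynomial.X + Polynomial.C (c : ℂ)) with hR
  have hroot : ∀ x, R.IsRoot x → 1 ≤ V.valuation x := by
    intro x hx
    rw [Polynomial.IsRoot, hR, Polynomial.eval_comp] at hx
    have := hcon _ hx
    simpa using this
  have hle := val_coeff_le_of_roots V _ R rfl hroot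
  obtain ⟨h0, h2⟩ := artinSchreier_sq_comp_coeff hp5 c
  have hRc : ∀ n, R.coeff n = (Q.comp (Polynomial.X + Polynomial.C (c : ℂ))).coeff n -
      (((((Polynomial.X : Polynomial ℤ) ^ p - Polynomial.X) ^ 2).comp
        (Polynomial.X + Polynomial.C c)).coeff n : ℤ) := by
    intro n
    rw [hR, hP, Polynomial.sub_comp, Polynomial.coeff_sub]
    congr 1
    have := Polynomial.coeff_map (p := (((Polynomial.X : Polynomial ℤ) ^ p - Polynomial.X) ^ 2).comp
        (Polynomial.X + Polynomial.C c)) (Int.castRingHom ℂ) n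
    rw [eq_intCast (Int.castRingHom _)] at this
    rw [← this, Polynomial.map_comp]
    simp
  have h3 : V.valuation (R.coeff 0) < 1 := by
    rw [hRc]
    exact V.valuation.map_sub_lt (coeff_comp_mem_maxGroup hQ c 0)
      ((val_intCast_lt_one_iff V hp.out hV).mpr h0)
  have h4 := (hle 2).trans_lt h3
  rw [hRc] at h4
  have h5 := V.valuation.map_sub_lt (coeff_comp_mem_maxGroup hQ c 2) h4
  rw [sub_sub_cancel] at h5
  exact h2 ((val_intCast_lt_one_iff V hp.out hV).mp h5)

end

section

open PeriodPair

lemma PeriodPair.eventuallyEq_of_G {L M : PeriodPair} (h : ∀ k, 3 ≤ k → L.G k = M.G k) :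
    L.weierstrassPExcept 0 =ᶠ[𝓝 0] M.weierstrassPExcept 0 := by
  have hL := L.hasFPowerSeriesAt_weierstrassPExcept 0
  have hM := M.hasFPowerSeriesAt_weierstrassPExcept 0
  have h0 : ∀ L : PeriodPair, L.weierstrassPExcept 0 0 = 0 := by
    intro L
    simp only [weierstrassPExcept]
    simp
  have key : (fun i : ℕ ↦ if i = 0 then L.weierstrassPExcept 0 0 else
      ((i : ℂ) + 1) * L.sumInvPow 0 (i + 2)) = fun i : ℕ ↦ if i = 0 then M.weierstrassPExcept 0 0
      else ((i : ℂ) + 1) * M.sumInvPow 0 (i + 2) := by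
    funext i
    split_ifs with hi
    · rw [h0, h0]
    · rw [sumInvPow_zero, sumInvPow_zero, h _ (by omega)]
  rw [key] at hL
  filter_upwards [hL.eventually_hasSum_sub, hM.eventually_hasSum_sub] with z h1 h2
  exact h1.unique h2

lemma PeriodPair.countable_lattice (L : PeriodPair) : (L.lattice : Set ℂ).Countable :=
  (Set.countable_coe_iff (s := (L.lattice : Set ℂ))).mp
    (L.latticeEquivProd.toEquiv.injective.countable)

lemma PeriodPair.weierstrassP_eq_of_G {L M : PeriodPair} (h : ∀ k, 3 ≤ k → L.G k = M.G k) :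
    Set.EqOn (L.weierstrassPExcept 0) (M.weierstrassPExcept 0)
      ((L.lattice \ {0}) ∪ (M.lattice \ {0}) : Set ℂ)ᶜ := by
  set U : Set ℂ := ((L.lattice \ {0}) ∪ (M.lattice \ {0}) : Set ℂ)ᶜ
  have hU : IsPreconnected U := by
    have hc : ((L.lattice \ {0}) ∪ (M.lattice \ {0}) : Set ℂ).Countable :=
      (L.countable_lattice.mono Set.sdiff_subset).union (M.countable_lattice.mono Set.sdiff_subset)
    have hrank : 1 < Module.rank ℝ ℂ := by rw [Complex.rank_real_complex]; norm_num
    exact (Set.Countable.isPathConnected_compl_of_one_lt_rank hrank hc).isConnected.isPreconnected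
  have h1 : AnalyticOnNhd ℂ (L.weierstrassPExcept 0) U :=
    (L.analyticOnNhd_weierstrassPExcept 0).mono
      (Set.compl_subset_compl.mpr Set.subset_union_left)
  have h2 : AnalyticOnNhd ℂ (M.weierstrassPExcept 0) U :=
    (M.analyticOnNhd_weierstrassPExcept 0).mono
      (Set.compl_subset_compl.mpr Set.subset_union_right)
  exact h1.eqOn_of_preconnected_of_eventuallyEq h2 hU (z₀ := 0) (by simp [U])
    (eventuallyEq_of_G h)

lemma PeriodPair.lattice_le_of_G {L M : PeriodPair} (h : ∀ k, 3 ≤ k → L.G k = M.G k) :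
    L.lattice ≤ M.lattice := by
  intro l hl
  by_contra hM
  have hl0 : l ≠ 0 := by rintro rfl; exact hM (zero_mem _)
  have hgl : AnalyticAt ℂ (fun z ↦ M.weierstrassPExcept 0 z + 1 / z ^ 2) l := by
    refine (M.analyticOnNhd_weierstrassPExcept 0 l (by simp [hM])).add ?_
    exact analyticAt_const.div (analyticAt_id.pow 2) (pow_ne_zero 2 hl0)
  have hev : (fun z ↦ M.weierstrassPExcept 0 z + 1 / z ^ 2) =ᶠ[𝓝[≠] l] L.weierstrassP := by
    filter_upwards [self_mem_nhdsWithin,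
      mem_nhdsWithin_of_mem_nhds (L.compl_lattice_sdiff_singleton_mem_nhds l),
      mem_nhdsWithin_of_mem_nhds (M.compl_lattice_sdiff_singleton_mem_nhds l)] with z h1 h2 h3
    have hz : z ∉ L.lattice := fun hz ↦ h2 ⟨hz, h1⟩
    have hz' : z ∉ M.lattice := fun hz ↦ h3 ⟨hz, h1⟩
    rw [← L.weierstrassPExcept_add 0, ZeroMemClass.coe_zero,
      weierstrassP_eq_of_G h (by simp [hz, hz'])]
    simp
  have h1 := meromorphicOrderAt_congr hev
  rw [L.order_weierstrassP l hl] at h1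
  have h2 := hgl.meromorphicOrderAt_nonneg
  rw [h1] at h2
  exact absurd h2 (by decide)

lemma PeriodPair.lattice_eq_of_G {L M : PeriodPair} (h : ∀ k, 3 ≤ k → L.G k = M.G k) :
    L.lattice = M.lattice :=
  le_antisymm (lattice_le_of_G h) (lattice_le_of_G fun k hk ↦ (h k hk).symm)

/-- The lattice `μ (ℤ τ + ℤ)`. -/
noncomputable def scaledPair (τ : ℍ) (μ : ℂ) (hμ : μ ≠ 0) : PeriodPair where
  ω₁ := μ * τ
  ω₂ := μ
  indep := by
    rw [LinearIndependent.pair_iff]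
    intro s t hst
    have h1 : (s : ℂ) * τ + t = 0 := by
      have : μ * ((s : ℂ) * τ + t) = 0 := by
        simp only [Complex.real_smul] at hst
        linear_combination hst
      exact (mul_eq_zero.mp this).resolve_left hμ
    have h2 : s = 0 := by
      have := congrArg Complex.im h1
      simpa [τ.im_ne_zero] using this
    subst h2
    simpa using h1

lemma scaledPair_G (τ : ℍ) {μ : ℂ} (hμ : μ ≠ 0) {k : ℕ} (hk : 3 ≤ k) :
    (scaledPair τ μ hμ).G k = (μ ^ k)⁻¹ * (2 * riemannZeta k * E hk τ) := by
  have h1 : (E hk τ : ℂ) = 1 / 2 * eisensteinSeries (N := 1) 0 k τ := rfl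
  have h2 := tsum_eisSummand_eq_riemannZeta_mul_eisensteinSeries hk τ
  have h3 : (scaledPair τ μ hμ).G k = ∑' v : Fin 2 → ℤ,
      (μ ^ k)⁻¹ * EisensteinSeries.eisSummand k v τ := by
    rw [PeriodPair.G, ← (scaledPair τ μ hμ).latticeEquivProd.symm.toEquiv.tsum_eq,
      ← (finTwoArrowEquiv ℤ).tsum_eq]
    refine tsum_congr fun v ↦ ?_
    have := (scaledPair τ μ hμ).latticeEquiv_symm_apply (finTwoArrowEquiv ℤ v)
    simp only [LinearEquiv.coe_toEquiv]
    rw [this, EisensteinSeries.eisSummand]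
    simp only [scaledPair, finTwoArrowEquiv_apply, zpow_neg, zpow_natCast]
    rw [← mul_inv, ← mul_pow]
    congr 2
    change (v 0 : ℂ) * (μ * τ) + (v 1 : ℂ) * μ = _
    ring
  rw [h3, tsum_mul_left, h2, h1]
  ring

end

section

lemma PeriodPair.exists_matrix {L M : PeriodPair} (h : L.lattice = M.lattice) :
    ∃ x y z w : ℤ, L.ω₁ = x * M.ω₁ + y * M.ω₂ ∧ L.ω₂ = z * M.ω₁ + w * M.ω₂ ∧
      (x * w - y * z = 1 ∨ x * w - y * z = -1) := by
  obtain ⟨x, y, h1⟩ := mem_lattice.mp (h ▸ L.ω₁_mem_lattice)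
  obtain ⟨z, w, h2⟩ := mem_lattice.mp (h ▸ L.ω₂_mem_lattice)
  obtain ⟨x', y', h3⟩ := mem_lattice.mp (h.symm ▸ M.ω₁_mem_lattice)
  obtain ⟨z', w', h4⟩ := mem_lattice.mp (h.symm ▸ M.ω₂_mem_lattice)
  refine ⟨x, y, z, w, h1.symm, h2.symm, ?_⟩
  have key : ∀ s t s' t' : ℤ, (s : ℂ) * M.ω₁ + t * M.ω₂ = s' * M.ω₁ + t' * M.ω₂ →
      s = s' ∧ t = t' := by
    intro s t s' t' hst
    have := LinearIndependent.pair_iff.mp M.indep (s - s') (t - t') (by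
      simp only [Complex.real_smul]
      push_cast
      linear_combination hst)
    constructor
    · exact_mod_cast sub_eq_zero.mp this.1
    · exact_mod_cast sub_eq_zero.mp this.2
  obtain ⟨e1, e2⟩ := key (x' * x + y' * z) (x' * y + y' * w) 1 0 (by
    rw [← h1, ← h2] at h3
    push_cast
    linear_combination h3)
  obtain ⟨e3, e4⟩ := key (z' * x + w' * z) (z' * y + w' * w) 0 1 (by
    rw [← h1, ← h2] at h4
    push_cast
    linear_combination h4)
  refine Int.isUnit_iff.mp (IsUnit.of_mul_eq_one (x' * w' - y' * z') ?_)
  linear_combination (z' * y + w' * w) * e1 + e4 - (x' * y + y' * w) * e3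

lemma exists_scale_of_modJ_eq {τ σ : ℍ} (h : modJ τ = modJ σ) (h4 : E₄ τ ≠ 0) (h6 : E₆ τ ≠ 0) :
    ∃ v : ℂ, v ≠ 0 ∧ E₄ τ = E₄ σ * v ^ 4 ∧ E₆ τ = E₆ σ * v ^ 6 := by
  have hc : E₄ τ ^ 3 * E₆ σ ^ 2 = E₄ σ ^ 3 * E₆ τ ^ 2 := by
    rw [modJ, modJ, div_eq_div_iff (discriminant_ne_zero τ) (discriminant_ne_zero σ),
      discriminant_eq_E₄_cube_sub_E₆_sq, discriminant_eq_E₄_cube_sub_E₆_sq] at h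
    linear_combination -1728 * h
  have h4' : E₄ σ ≠ 0 := by
    intro h0
    rw [modJ, modJ, h0, zero_pow three_ne_zero, zero_div] at h
    exact h4 (pow_eq_zero_iff three_ne_zero |>.mp
      ((div_eq_zero_iff.mp h).resolve_right (discriminant_ne_zero τ)))
  have h6' : E₆ σ ≠ 0 := by
    intro h0
    rw [h0] at hc
    exact mul_ne_zero (pow_ne_zero 3 h4') (pow_ne_zero 2 h6) (by rw [← hc]; ring)
  obtain ⟨v, hv⟩ := IsAlgClosed.exists_pow_nat_eq (E₆ τ * E₄ σ / (E₆ σ * E₄ τ)) zero_lt_two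
  refine ⟨v, ?_, ?_, ?_⟩
  · rintro rfl
    rw [zero_pow two_ne_zero] at hv
    exact div_ne_zero (mul_ne_zero h6 h4') (mul_ne_zero h6' h4) hv.symm
  · rw [show v ^ 4 = (v ^ 2) ^ 2 by ring, hv]
    field_simp
    linear_combination hc
  · rw [show v ^ 6 = (v ^ 2) ^ 3 by ring, hv]
    field_simp
    linear_combination hc

lemma exists_lattice_eq_of_modJ_eq {τ σ : ℍ} (h : modJ τ = modJ σ) (h4 : E₄ τ ≠ 0)
    (h6 : E₆ τ ≠ 0) :
    ∃ (v : ℂ) (hv : v ≠ 0),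
      (scaledPair τ v hv).lattice = (scaledPair σ 1 one_ne_zero).lattice := by
  obtain ⟨v, hv, hv4, hv6⟩ := exists_scale_of_modJ_eq h h4 h6
  refine ⟨v, hv, PeriodPair.lattice_eq_of_G fun k hk ↦ ?_⟩
  rcases Nat.even_or_odd k with hke | hko
  · have h1 := MF.value_eq (τ := τ) (σ := σ) (w := 1) (v := v) (by rw [one_pow, mul_one, hv4])
      (by rw [one_pow, mul_one, hv6]) (MF.eisenstein hk)
    rw [one_pow, mul_one] at h1
    rw [scaledPair_G _ _ hk, scaledPair_G _ _ hk, h1]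
    field_simp
    ring
  · rw [PeriodPair.G_eq_zero_of_odd _ _ hko, PeriodPair.G_eq_zero_of_odd _ _ hko]

variable {p : ℕ} [NeZero p]

/-- A singular value of a cyclic `p`-isogeny has complex multiplication of norm `p`. -/
lemma exists_matrix_of_isogeny {τ : ℍ} (h4 : E₄ τ ≠ 0) (h6 : E₆ τ ≠ 0)
    (h : modJ τ = modJ (mulPt p τ) ∨ ∃ i : ℤ, modJ τ = modJ (divPt p i τ)) :
    ∃ (x y z w : ℤ) (c : ℂ), x * w - y * z = p ∧ c * τ = x * τ + y ∧ c = z * τ + w := by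
  have hp : (p : ℂ) ≠ 0 := NeZero.ne _
  have hp' : 0 < (p : ℤ) := by exact_mod_cast NeZero.pos p
  suffices h : ∃ (x y z w : ℤ) (c : ℂ), (x * w - y * z = p ∨ x * w - y * z = -p) ∧
      c * τ = x * τ + y ∧ c = z * τ + w by
    obtain ⟨x, y, z, w, c, hd, h1, h2⟩ := h
    refine ⟨x, y, z, w, c, hd.resolve_right fun hd ↦ ?_, h1, h2⟩
    have e : (z * (τ : ℂ) + w) * τ = x * τ + y := h2 ▸ h1
    have hre := congrArg Complex.re e
    have him := congrArg Complex.im e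
    have hτ := τ.im_pos
    simp only [Complex.add_re, Complex.mul_re, Complex.intCast_re, Complex.intCast_im,
      Complex.add_im, Complex.mul_im, UpperHalfPlane.coe_re, UpperHalfPlane.coe_im] at hre him
    have hx : (2 * z * τ.re + w - x : ℝ) = 0 := by
      apply mul_right_cancel₀ hτ.ne'
      linear_combination him
    have : ((x * w - y * z : ℤ) : ℝ) = (z * τ.re + w) ^ 2 + z ^ 2 * τ.im ^ 2 := by
      push_cast
      linear_combination z * hre + (-w - z * τ.re) * hx
    rw [hd] at this
    push_cast at this
    have : (0 : ℝ) < p := by exact_mod_cast hp'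
    nlinarith [sq_nonneg ((z : ℝ) * τ.im), sq_nonneg (z * τ.re + w)]
  rcases h with h | ⟨i, h⟩
  · obtain ⟨v, hv, hl⟩ := exists_lattice_eq_of_modJ_eq h h4 h6
    obtain ⟨x, y, z, w, h1, h2, hd⟩ := PeriodPair.exists_matrix hl
    simp only [scaledPair, coe_mulPt] at h1 h2
    refine ⟨p * x, y, p * z, w, v, ?_, ?_, ?_⟩
    · rcases hd with hd | hd
      · left; linear_combination (p : ℤ) * hd
      · right; linear_combination (p : ℤ) * hd
    · push_cast; linear_combination h1
    · push_cast; linear_combination h2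
  · obtain ⟨v, hv, hl⟩ := exists_lattice_eq_of_modJ_eq h h4 h6
    obtain ⟨x, y, z, w, h1, h2, hd⟩ := PeriodPair.exists_matrix hl
    simp only [scaledPair, coe_divPt] at h1 h2
    refine ⟨x, x * i + p * y, z, z * i + p * w, p * v, ?_, ?_, ?_⟩
    · rcases hd with hd | hd
      · left; linear_combination (p : ℤ) * hd
      · right; linear_combination (p : ℤ) * hd
    · push_cast; field_simp at h1; linear_combination h1
    · push_cast; field_simp at h2; linear_combination h2

end

section

variable {p : ℕ} {k : ℕ} {f : ℍ → ℂ} {W : PowerSeries ℂ} {τ : ℍ}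
  {x y z w : ℤ} {c : ℂ}

lemma isogeny_mul_conj (hd : x * w - y * z = p) (h1 : c * τ = x * τ + y) (h2 : c = z * τ + w) :
    c * (x + w - c) = p := by
  have hd' : (x * w - y * z : ℂ) = p := by exact_mod_cast congrArg (Int.cast (R := ℂ)) hd
  rw [← hd']
  linear_combination (-z : ℂ) * h1 + (x - c : ℂ) * h2

/-- One of the two conjugate multipliers is congruent to the trace. -/
lemma exists_multiplier {V : ValuationSubring ℂ} (hV : V.valuation (p : ℂ) < 1)
    (hd : x * w - y * z = p) (h1 : c * τ = x * τ + y) (h2 : c = z * τ + w) :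
    ∃ u : ℂ, (u = c ∨ u = x + w - c) ∧ V.valuation u ≤ 1 ∧
      V.valuation (u - (x + w : ℤ)) < 1 := by
  have hcc := isogeny_mul_conj hd h1 h2
  have ht := val_intCast_le_one V (x + w)
  have hor : V.valuation c < 1 ∨ V.valuation (x + w - c) < 1 := by
    by_contra! hcon
    have : V.valuation (c * (x + w - c)) < 1 := hcc ▸ hV
    rw [map_mul] at this
    exact absurd this (not_lt.mpr (one_le_mul hcon.1 hcon.2))
  push_cast at ht ⊢
  rcases hor with h | h
  · refine ⟨_, Or.inr rfl, ?_, ?_⟩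
    · exact (V.valuation.map_sub _ _).trans (max_le ht h.le)
    · rw [show (x + w - c : ℂ) - (x + w) = -c by ring, Valuation.map_neg]; exact h
  · refine ⟨c, Or.inl rfl, ?_, ?_⟩
    · rw [show c = (x + w : ℂ) - (x + w - c) by ring]
      exact (V.valuation.map_sub _ _).trans (max_le ht h.le)
    · rw [show c - (x + w : ℂ) = -(x + w - c) by ring, Valuation.map_neg]; exact h

variable [hp : Fact p.Prime]

/-- A weight `k` form takes, at a fixed point of a correspondence of prime degree `p`, a value
that is proportional to its value at some `p`-isogenous point. -/
lemma MF.hecke_value (hf : MF k f W) (hd : x * w - y * z = p) (h1 : c * τ = x * τ + y)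
    (h2 : c = z * τ + w) :
    (x + w - c) ^ k * f τ = p ^ k * f (mulPt p τ) ∨
      ∃ i : ℤ, (x + w - c) ^ k * f τ = f (divPt p i τ) := by
  have hcc := isogeny_mul_conj hd h1 h2
  have hp0 : (p : ℂ) ≠ 0 := Nat.cast_ne_zero.mpr hp.out.ne_zero
  have hd' : (x * w - y * z : ℂ) = p := by exact_mod_cast congrArg (Int.cast (R := ℂ)) hd
  by_cases hco : IsCoprime x z
  · right
    obtain ⟨s, r, hsr⟩ := hco
    have hsr' : (s * x + r * z : ℂ) = 1 := by exact_mod_cast congrArg (Int.cast (R := ℂ)) hsr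
    refine ⟨s * y + r * w, ?_⟩
    have key : (p : ℂ) * (z * (divPt p (s * y + r * w) τ : ℂ) + s) = c := by
      rw [coe_divPt]
      field_simp
      push_cast
      rw [← hd']
      linear_combination (w : ℂ) * hsr' - h2
    rw [hf.eq_of_coe (a := x) (b := -r) (c := z) (d := s) (σ := divPt p (s * y + r * w) τ)
      (σ' := τ) (by linear_combination hsr)]
    · have : (x + w - c) * (z * (divPt p (s * y + r * w) τ : ℂ) + s) = 1 := by
        apply mul_left_cancel₀ hp0
        linear_combination (x + w - c) * key + hcc
      rw [zpow_natCast, ← mul_assoc, ← mul_pow, this, one_pow, one_mul]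
    · apply mul_left_cancel₀ hp0
      rw [show (p : ℂ) * (τ * (z * (divPt p (s * y + r * w) τ : ℂ) + s)) = τ * c by
        linear_combination (τ : ℂ) * key, mul_comm, h1, coe_divPt]
      field_simp
      push_cast
      rw [← hd']
      linear_combination -(y : ℂ) * hsr'
  · left
    have hpx : (p : ℤ) ∣ x ∧ (p : ℤ) ∣ z := by
      have hg : (Int.gcd x z : ℤ) ∣ p := by
        rw [← hd]
        exact dvd_sub (Dvd.dvd.mul_right (Int.gcd_dvd_left ..) _)
          (Dvd.dvd.mul_left (Int.gcd_dvd_right ..) _)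
      rcases (Nat.dvd_prime hp.out).mp (Int.natCast_dvd_natCast.mp hg) with h | h
      · exact absurd (Int.isCoprime_iff_gcd_eq_one.mpr h) hco
      · rw [← h]
        exact ⟨Int.gcd_dvd_left .., Int.gcd_dvd_right ..⟩
    obtain ⟨⟨x', rfl⟩, ⟨z', rfl⟩⟩ := hpx
    have hone : x' * w - y * z' = 1 := by
      have : (p : ℤ) ≠ 0 := by exact_mod_cast hp.out.ne_zero
      apply mul_left_cancel₀ this
      linear_combination hd
    push_cast at h1 h2 hcc ⊢
    have key : (z' * (mulPt p τ : ℂ) + w) = c := by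
      rw [coe_mulPt]; linear_combination -h2
    rw [hf.eq_of_coe (a := x') (b := y) (c := z') (d := w) (σ := mulPt p τ) (σ' := τ) hone, key]
    · rw [zpow_natCast, ← mul_assoc, ← mul_pow, mul_comm (_ - c), hcc]
    · rw [key, coe_mulPt]; linear_combination h1

lemma MF.hecke_value' (hf : MF k f W) (hd : x * w - y * z = p) (h1 : c * τ = x * τ + y)
    (h2 : c = z * τ + w) :
    c ^ k * f τ = p ^ k * f (mulPt p τ) ∨ ∃ i : ℤ, c ^ k * f τ = f (divPt p i τ) := by
  have := hf.hecke_value (x := w) (y := -y) (z := -z) (w := x) (c := x + w - c) (τ := τ)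
    (p := p) (by linear_combination hd) (by push_cast; linear_combination -h1)
    (by push_cast; linear_combination -h2)
  simpa [add_comm] using this

end

section

variable {p : ℕ} [hp : Fact p.Prime] {V : ValuationSubring ℂ}

lemma val_inv_natCast_eq_one (hV : V.valuation (p : ℂ) < 1) {q : ℕ} (hq : ¬ p ∣ q) :
    V.valuation ((q : ℂ)⁻¹) = 1 := by
  have := val_intCast_eq_one V hp.out hV (n := q) (by exact_mod_cast hq)
  rw [map_inv₀]
  simpa using this

lemma val_sum_inv_le_one (hV : V.valuation (p : ℂ) < 1) (s : Finset ℕ)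
    (hs : ∀ q ∈ s, ¬ p ∣ q) : V.valuation (∑ q ∈ s, (1 : ℂ) / q) ≤ 1 := by
  refine Valuation.map_sum_le _ fun q hq ↦ ?_
  rw [one_div]
  exact (val_inv_natCast_eq_one hV (hs q hq)).le

/-- Bernoulli numbers below `p - 1` are `p`-integral. -/
lemma val_bernoulli_le_one (hV : V.valuation (p : ℂ) < 1) {m : ℕ} (hm : 2 * m + 1 < p) :
    V.valuation ((bernoulli (2 * m) : ℚ) : ℂ) ≤ 1 := by
  obtain ⟨N, hN⟩ := Bernoulli.vonStaudt_clausen m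
  have h : ((bernoulli (2 * m) : ℚ) : ℂ) = (N : ℂ) - ∑ q ∈ (Finset.range (2 * m + 2)).filter
      (fun q ↦ q.Prime ∧ (q - 1) ∣ 2 * m), (1 : ℂ) / q := by
    have := congrArg (Rat.cast (K := ℂ)) hN
    push_cast at this
    rw [this]; ring
  rw [h]
  refine (V.valuation.map_sub _ _).trans (max_le (val_intCast_le_one V N) ?_)
  refine val_sum_inv_le_one hV _ fun q hq ↦ ?_
  rw [Finset.mem_filter, Finset.mem_range] at hq
  exact Nat.not_dvd_of_pos_of_lt hq.2.1.pos (by omega)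

/-- `p B_{p-1} ≡ -1` modulo `p`. -/
lemma val_mul_bernoulli_add_one (hp2 : p ≠ 2) (hV : V.valuation (p : ℂ) < 1) :
    V.valuation (p * ((bernoulli (p - 1) : ℚ) : ℂ) + 1) < 1 := by
  obtain ⟨m, hm⟩ := hp.out.odd_of_ne_two hp2
  have hp0 : (p : ℂ) ≠ 0 := Nat.cast_ne_zero.mpr hp.out.ne_zero
  obtain ⟨N, hN⟩ := Bernoulli.vonStaudt_clausen m
  set s := (Finset.range (2 * m + 2)).filter (fun q ↦ q.Prime ∧ (q - 1) ∣ 2 * m) with hs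
  have hps : p ∈ s := by
    rw [hs, Finset.mem_filter, Finset.mem_range]
    exact ⟨by omega, hp.out, by rw [hm]; simp⟩
  have h : (p * ((bernoulli (p - 1) : ℚ) : ℂ) + 1) =
      p * ((N : ℂ) - ∑ q ∈ s.erase p, (1 : ℂ) / q) := by
    have := congrArg (Rat.cast (K := ℂ)) hN
    rw [← Finset.add_sum_erase _ _ hps] at this
    push_cast at this
    rw [show p - 1 = 2 * m by omega, this]
    field_simp
    ring
  rw [h, map_mul]
  refine (mul_le_of_le_one_right' ?_).trans_lt hV
  refine (V.valuation.map_sub _ _).trans (max_le (val_intCast_le_one V N) ?_)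
  refine val_sum_inv_le_one hV _ fun q hq ↦ ?_
  rw [hs, Finset.mem_erase, Finset.mem_filter, Finset.mem_range] at hq
  exact Nat.not_dvd_of_pos_of_lt hq.2.2.1.pos (by omega)

lemma val_mul_bernoulli (hp2 : p ≠ 2) (hV : V.valuation (p : ℂ) < 1) :
    V.valuation (p * ((bernoulli (p - 1) : ℚ) : ℂ)) = 1 := by
  have h := val_mul_bernoulli_add_one hp2 hV
  have h1 : V.valuation (p * ((bernoulli (p - 1) : ℚ) : ℂ)) =
      V.valuation (p * ((bernoulli (p - 1) : ℚ) : ℂ) + 1 - 1) := by congr 1; ring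
  rw [h1, V.valuation.map_sub_eq_of_lt_right (by simpa using h), map_one]

/-- The Eisenstein series of weight `p - 1` has expansion congruent to `1` modulo `p`. -/
lemma exists_hasse_series (hp5 : 5 ≤ p) (hV : V.valuation (p : ℂ) < 1) (hk : 3 ≤ p - 1) :
    ∃ H : PowerSeries V, MF (p - 1 : ℕ) (E hk) (H.map V.subtype) ∧
      H.map (IsLocalRing.residue V) = 1 := by
  have hp2 : p ≠ 2 := by omega
  obtain ⟨m, hm⟩ := hp.out.odd_of_ne_two hp2
  have hk2 : Even (p - 1) := ⟨m, by omega⟩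
  have hcoe : ∀ n, (qEis hk).coeff n = if n = 0 then 1 else
      -(2 * ((p - 1 : ℕ) : ℂ) / ((bernoulli (p - 1) : ℚ) : ℂ)) *
        (ArithmeticFunction.sigma (p - 1 - 1) n : ℕ) := by
    intro n
    exact_mod_cast EisensteinSeries.E_qExpansion_coeff hk hk2 n
  have hval : ∀ n ≠ 0, V.valuation ((qEis hk).coeff n) < 1 := by
    intro n hn
    have hp0 : (p : ℂ) ≠ 0 := Nat.cast_ne_zero.mpr hp.out.ne_zero
    have hb := val_mul_bernoulli hp2 hV
    have h : (qEis hk).coeff n = p * ((-(2 * ((p - 1 : ℕ) : ℤ)) *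
        (ArithmeticFunction.sigma (p - 1 - 1) n : ℕ) : ℤ) : ℂ) *
          (p * ((bernoulli (p - 1) : ℚ) : ℂ))⁻¹ := by
      rw [hcoe, if_neg hn]
      push_cast
      field_simp
    rw [h, map_mul, map_inv₀, hb, inv_one, mul_one, map_mul]
    exact (mul_le_of_le_one_right' (val_intCast_le_one V _)).trans_lt hV
  have hmem : ∀ n, (qEis hk).coeff n ∈ V := by
    intro n
    by_cases hn : n = 0
    · rw [hcoe, if_pos hn]; exact V.one_mem
    · exact V.valuation_le_one_iff _ |>.mp (hval n hn).le
  refine ⟨PowerSeries.mk fun n ↦ ⟨_, hmem n⟩, ?_, ?_⟩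
  · have : (PowerSeries.mk fun n ↦ (⟨_, hmem n⟩ : V)).map V.subtype = qEis hk := by
      ext n; simp
    rw [this]
    exact MF.eisenstein hk
  · ext n
    rw [PowerSeries.coeff_map, PowerSeries.coeff_mk, PowerSeries.coeff_one]
    split_ifs with hn
    · have : (⟨_, hmem n⟩ : V) = 1 := Subtype.ext (by
        change (qEis hk).coeff n = 1
        rw [hcoe, if_pos hn])
      rw [this, map_one]
    · exact (residue_eq_zero_iff_val V _).mpr (hval n hn)

end

end

section

open UpperHalfPlane ModularForm MatrixGroups Filter Topology Manifold SlashInvariantForm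
  ModularFormClass IsLocalRing

section

variable {p : ℕ} [hp : Fact p.Prime] {V : ValuationSubring ℂ} {k : ℕ} {f : ℍ → ℂ}
  {F : PowerSeries ℤ} {τ : ℍ} {l : ℂ}

lemma heckeProd_eq_zero (hf : MF k f (F.map (Int.castRingHom ℂ)))
    (h : l * f τ = p ^ k * f (mulPt p τ) ∨ ∃ i : ℤ, l * f τ = f (divPt p i τ)) :
    heckeProd p 0 k (l • f) 1 (-1) f τ = 0 := by
  rw [heckeProd]
  rcases h with h | ⟨i, h⟩
  · apply mul_eq_zero_of_left
    simp only [Pi.smul_apply, smul_eq_mul, Pi.one_apply, Pi.neg_apply]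
    linear_combination h
  · apply mul_eq_zero_of_right
    refine Finset.prod_eq_zero (Finset.mem_univ (i : ZMod p)) ?_
    have hi : (p : ℤ) ∣ i - ((i : ZMod p).val : ℤ) := by
      rw [← ZMod.intCast_zmod_eq_zero_iff_dvd]
      simp
    simp only [Pi.smul_apply, smul_eq_mul, Pi.one_apply, Pi.neg_apply]
    rw [← hf.divPt_congr hi τ]
    linear_combination h

/-- If the multiplier `l` solves the `p`-isogeny equation of `f`, it satisfies a congruence
involving the value of the Eisenstein series of weight `p - 1`. -/
lemma val_multiplier_relation (hp5 : 5 ≤ p) (hV : V.valuation (p : ℂ) < 1) (hk3 : 3 ≤ p - 1)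
    (hk : k ≠ 0) (hf : MF k f (F.map (Int.castRingHom ℂ))) (hl : l ∈ V)
    (h : l * f τ = p ^ k * f (mulPt p τ) ∨ ∃ i : ℤ, l * f τ = f (divPt p i τ))
    {v : ℂ} (h4 : E₄ τ * v ^ 4 ∈ V) (h6 : E₆ τ * v ^ 6 ∈ V) :
    V.valuation (l ^ (p + 1) * (f τ * v ^ k) ^ (p + 1) -
      l * (f τ * v ^ k) ^ 2 * (E hk3 τ * v ^ (p - 1)) ^ k) < 1 := by
  have hchar : CharP (ResidueField V) p := residueField_charP V hp.out hV
  have : CharP (PowerSeries (ResidueField V)) p :=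
    charP_of_injective_ringHom PowerSeries.C_injective p
  obtain ⟨H, hH, hH1⟩ := exists_hasse_series hp5 hV hk3
  set FV : PowerSeries V := F.map (Int.castRingHom V) with hFV
  have hfV : MF k f (FV.map V.subtype) := by rw [hFV, map_intSeries]; exact hf
  set lV : V := ⟨l, hl⟩ with hlV
  obtain ⟨U, hU, hUr⟩ := exists_heckeProd_expansion (p := p) (V := V) (K := k) (c := 0) (e₁ := 0)
    (e₂ := k) (a₁ := k) (a₂ := 0) (g₁ := l • f) (f₁ := 1) (g₂ := -1) (f₂ := f)
    (G₁ := PowerSeries.C lV * FV) (F₁ := 1) (G₂ := -1) (F₂ := FV) hV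
    (by
      rw [map_mul, PowerSeries.map_C, ← PowerSeries.smul_eq_C_mul]
      exact hfV.smul l)
    (by
      rw [map_neg, map_one]
      simpa using MF.one.smul (-1))
    (by rw [map_one]; exact MF.one)
    (by rw [zero_add]; exact hfV) (by simp) (by simp)
    (by simp [FrobFixed]) (by
      rw [hFV, map_residue_intSeries]
      exact FrobFixed.map_int _)
  set R := ResidueField V
  have hUr' : U.map (residue V) =
      (PowerSeries.C lV * FV).map (residue V) * (((PowerSeries.C lV * FV) ^ p).map (residue V)
        - FV.map (residue V)) := by
    rw [hUr]
    have h0 : (p : PowerSeries R) ^ k = 0 := by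
      rw [CharP.cast_eq_zero, zero_pow hk]
    have hodd : Odd p := hp.out.odd_of_ne_two (by omega)
    rw [h0]
    simp only [map_one, map_neg, map_pow, pow_zero, hodd.neg_one_pow]
    ring
  have hp1 : 1 ≤ p := hp.out.one_le
  have hΨ : MF ((k * (p + 1) : ℕ) : ℤ)
      (heckeProd p 0 k (l • f) 1 (-1) f - ((l ^ (p + 1)) • f ^ (p + 1) - l • (f ^ 2 * (E hk3) ^ k)))
      ((U - (PowerSeries.C (lV ^ (p + 1)) * FV ^ (p + 1) -
        PowerSeries.C lV * (FV ^ 2 * H ^ k))).map V.subtype) := by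
    have hlm : V.subtype lV = l := rfl
    have hs : (U - (PowerSeries.C (lV ^ (p + 1)) * FV ^ (p + 1) -
        PowerSeries.C lV * (FV ^ 2 * H ^ k))).map V.subtype = U.map V.subtype -
        ((l ^ (p + 1)) • (FV.map V.subtype) ^ (p + 1) -
          l • ((FV.map V.subtype) ^ 2 * (H.map V.subtype) ^ k)) := by
      rw [PowerSeries.smul_eq_C_mul, PowerSeries.smul_eq_C_mul]
      simp only [map_sub, map_mul, map_pow, PowerSeries.map_C, hlm]
    rw [hs]
    refine (hU.cast (by push_cast; ring)).sub (MF.sub ?_ ?_)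
    · exact ((hfV.pow (p + 1)).cast (by push_cast; ring)).smul (l ^ (p + 1))
    · refine MF.smul l (((hfV.pow 2).mul (hH.pow k)).cast ?_)
      push_cast [Nat.cast_sub hp1]
      ring
  have hres : (U - (PowerSeries.C (lV ^ (p + 1)) * FV ^ (p + 1) -
        PowerSeries.C lV * (FV ^ 2 * H ^ k))).map (residue V) = 0 := by
    rw [map_sub, hUr']
    simp only [map_sub, map_mul, map_pow, hH1, one_pow]
    ring
  have := MF.value_mem (V := V.toSubring) (I := maxGroup V) (inv_1728_mem hp5 hV)
    mul_mem_maxGroup (τ := τ) (w := v) h4 h6 hΨ (coeff_mem_maxGroup hres)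
  rw [mem_maxGroup] at this
  simp only [Pi.sub_apply, Pi.smul_apply, Pi.pow_apply, Pi.mul_apply, smul_eq_mul,
    heckeProd_eq_zero hf h] at this
  rw [← Valuation.map_neg]
  convert this using 2
  have e1 : v ^ (k * (p + 1)) = (v ^ k) ^ 2 * (v ^ (p - 1)) ^ k := by
    rw [← pow_mul, ← pow_mul, ← pow_add]
    congr 1
    obtain ⟨q, rfl⟩ : ∃ q, p = q + 1 := ⟨p - 1, by omega⟩
    simp; ring
  rw [mul_pow, mul_pow, mul_pow, ← pow_mul v k (p + 1)]
  rw [zero_sub, neg_mul, sub_mul]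
  congr 2
  · ring
  · rw [e1]; ring

end

section

variable {p : ℕ} [hp : Fact p.Prime] {V : ValuationSubring ℂ} {τ : ℍ} {x y z w : ℤ} {c v : ℂ}

lemma hasse_value_pow (hp5 : 5 ≤ p) (hV : V.valuation (p : ℂ) < 1) (hk3 : 3 ≤ p - 1)
    {κ : V} (h4 : E₄ τ * v ^ 4 = κ) (h6 : E₆ τ * v ^ 6 = κ) (hκ : residue V κ ≠ 0)
    (hκp : residue V κ ^ p = residue V κ) (hd : x * w - y * z = p) (h1 : c * τ = x * τ + y)
    (h2 : c = z * τ + w) (ht : ¬ (p : ℤ) ∣ x + w) {e : V} (he : E hk3 τ * v ^ (p - 1) = e)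
    {k : ℕ} (hk : k ≠ 0) {f : ℍ → ℂ} {F : PowerSeries ℤ}
    (hf : MF k f (F.map (Int.castRingHom ℂ))) (hfv : f τ * v ^ k = κ) :
    residue V e ^ k = ((x + w : ℤ) : ResidueField V) ^ k := by
  have hchar : CharP (ResidueField V) p := residueField_charP V hp.out hV
  obtain ⟨u, hu, huV, hut⟩ := exists_multiplier hV hd h1 h2
  have huV' : u ∈ V := (V.valuation_le_one_iff _).mp huV
  set uV : V := ⟨u, huV'⟩ with huVdef
  have hur : residue V uV = ((x + w : ℤ) : ResidueField V) := by
    rw [← sub_eq_zero, ← map_intCast (residue V), ← map_sub, residue_eq_zero_iff_val]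
    push_cast
    push_cast at hut
    exact hut
  set t : ResidueField V := ((x + w : ℤ) : ResidueField V) with htdef
  have ht0 : t ≠ 0 := by
    rw [htdef, Ne, CharP.intCast_eq_zero_iff (ResidueField V) p]
    exact ht
  have htp : t ^ p = t := by rw [htdef, ← frobenius_def, map_intCast]
  have hrel : u ^ k * f τ = p ^ k * f (mulPt p τ) ∨ ∃ i : ℤ, u ^ k * f τ = f (divPt p i τ) := by
    rcases hu with rfl | rfl
    · exact hf.hecke_value' hd h1 h2
    · exact hf.hecke_value hd h1 h2
  have hval := val_multiplier_relation hp5 hV hk3 hk hf (pow_mem huV' k) hrel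
    (h4 ▸ κ.2) (h6 ▸ κ.2)
  rw [hfv, he] at hval
  have hr : residue V ((uV ^ k) ^ (p + 1) * κ ^ (p + 1) - uV ^ k * κ ^ 2 * e ^ k) = 0 := by
    rw [residue_eq_zero_iff_val]
    push_cast
    exact hval
  simp only [map_sub, map_mul, map_pow, hur] at hr
  have e1 : (t ^ k) ^ (p + 1) = t ^ k * t ^ k := by
    rw [pow_succ, pow_right_comm, htp]
  rw [e1, pow_succ _ p, hκp] at hr
  have hne : t ^ k * residue V κ ^ 2 ≠ 0 := mul_ne_zero (pow_ne_zero _ ht0) (pow_ne_zero _ hκ)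
  apply mul_left_cancel₀ hne
  linear_combination -hr

/-- At the lift of a supersingular-free point the value of the weight `p - 1` Eisenstein series is
the trace of the multiplier up to sign. -/
lemma hasse_value_sq (hp5 : 5 ≤ p) (hV : V.valuation (p : ℂ) < 1) (hk3 : 3 ≤ p - 1)
    {κ : V} (h4 : E₄ τ * v ^ 4 = κ) (h6 : E₆ τ * v ^ 6 = κ) (hκ : residue V κ ≠ 0)
    (hκp : residue V κ ^ p = residue V κ) (hd : x * w - y * z = p) (h1 : c * τ = x * τ + y)
    (h2 : c = z * τ + w) (ht : ¬ (p : ℤ) ∣ x + w) {e : V} (he : E hk3 τ * v ^ (p - 1) = e) :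
    residue V e ^ 2 = ((x + w : ℤ) : ResidueField V) ^ 2 := by
  have hchar : CharP (ResidueField V) p := residueField_charP V hp.out hV
  have e4 := hasse_value_pow hp5 hV hk3 h4 h6 hκ hκp hd h1 h2 ht he (k := 4) (by norm_num)
    MF.E4 h4
  have e6 := hasse_value_pow hp5 hV hk3 h4 h6 hκ hκp hd h1 h2 ht he (k := 6) (by norm_num)
    MF.E6 h6
  have ht0 : ((x + w : ℤ) : ResidueField V) ≠ 0 := by
    rw [Ne, CharP.intCast_eq_zero_iff (ResidueField V) p]
    exact ht
  set t : ResidueField V := ((x + w : ℤ) : ResidueField V)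
  apply mul_left_cancel₀ (pow_ne_zero 4 ht0)
  calc t ^ 4 * residue V e ^ 2 = residue V e ^ 4 * residue V e ^ 2 := by rw [e4]
    _ = residue V e ^ 6 := by ring
    _ = t ^ 6 := e6
    _ = t ^ 4 * t ^ 2 := by ring

end

end

section

open UpperHalfPlane ModularForm MatrixGroups Filter Topology Manifold SlashInvariantForm
  ModularFormClass

section

/-- `f` is the sum of the power series `W` near the origin. -/
def HasPS (f : ℂ → ℂ) (W : PowerSeries ℂ) : Prop :=
  ∀ᶠ z in 𝓝 0, HasSum (fun n ↦ W.coeff n * z ^ n) (f z)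

namespace HasPS

variable {f g : ℂ → ℂ} {W U : PowerSeries ℂ}

lemma iff_hasFPowerSeriesAt :
    HasPS f W ↔ HasFPowerSeriesAt f (.ofScalars (𝕜 := ℂ) ℂ fun n ↦ W.coeff n) 0 := by
  rw [hasFPowerSeriesAt_iff, HasPS]
  simp [FormalMultilinearSeries.coeff_ofScalars, mul_comm]

lemma add (hf : HasPS f W) (hg : HasPS g U) : HasPS (f + g) (W + U) := by
  filter_upwards [hf, hg] with z h1 h2
  simpa [add_mul] using h1.add h2

lemma mul (hf : HasPS f W) (hg : HasPS g U) : HasPS (f * g) (W * U) := by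
  filter_upwards [hf, hg] with z hz hz'
  have h1 := hz.summable.norm
  have h2 := hz'.summable.norm
  have h3 := summable_norm_sum_mul_antidiagonal_of_summable_norm h1 h2
  have h4 := tsum_mul_tsum_eq_tsum_sum_antidiagonal_of_summable_norm h1 h2
  rw [hz.tsum_eq, hz'.tsum_eq] at h4
  rw [Pi.mul_apply, h4]
  refine h3.of_norm.hasSum.congr_fun fun n ↦ ?_
  rw [PowerSeries.coeff_mul, Finset.sum_mul]
  refine Finset.sum_congr rfl fun x hx ↦ ?_
  rw [← Finset.HasAntidiagonal.mem_antidiagonal.mp hx]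
  ring

lemma const (c : ℂ) : HasPS (fun _ ↦ c) (PowerSeries.C c) := by
  refine Eventually.of_forall fun z ↦ ?_
  convert hasSum_ite_eq (0 : ℕ) c using 2 with n
  rw [PowerSeries.coeff_C]
  split_ifs with h
  · simp [h]
  · simp

lemma id : HasPS (fun z ↦ z) PowerSeries.X := by
  refine Eventually.of_forall fun z ↦ ?_
  convert hasSum_ite_eq (1 : ℕ) z using 2 with n
  rw [PowerSeries.coeff_X]
  split_ifs with h
  · simp [h]
  · simp

lemma pow (hf : HasPS f W) (n : ℕ) : HasPS (f ^ n) (W ^ n) := by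
  induction n with
  | zero =>
    rw [pow_zero, pow_zero, ← map_one (PowerSeries.C (R := ℂ))]
    exact const 1
  | succ n ih => rw [pow_succ, pow_succ]; exact ih.mul hf

lemma eq_of_eventuallyEq_punctured (hf : HasPS f W) (hg : HasPS g U) (h : f =ᶠ[𝓝[≠] 0] g) :
    W = U := by
  have h1 := (iff_hasFPowerSeriesAt.mp hf)
  have h2 := (iff_hasFPowerSeriesAt.mp hg)
  have h3 : f =ᶠ[𝓝 0] g :=
    (h1.analyticAt.frequently_eq_iff_eventually_eq h2.analyticAt).mp h.frequently
  have := h1.eq_formalMultilinearSeries_of_eventually h2 h3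
  ext n
  have := congrArg (fun p ↦ FormalMultilinearSeries.coeff p n) this
  simpa [FormalMultilinearSeries.coeff_ofScalars] using this

end HasPS

namespace PeriodPair

variable (L : PeriodPair)

/-- The power series of `z ^ 2 * ℘ z` at the origin. -/
noncomputable def sqMulSeries : PowerSeries ℂ :=
  PowerSeries.mk fun n ↦ if n = 0 then 1 else if n < 3 then 0 else (n - 1) * L.G n

lemma hasPS_sq_mul : HasPS (fun z ↦ 1 + z ^ 2 * L.weierstrassPExcept 0 z) L.sqMulSeries := by
  have h0 := L.hasFPowerSeriesAt_weierstrassPExcept 0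
  have h1 : HasPS (L.weierstrassPExcept 0) (PowerSeries.mk fun i ↦
      if i = 0 then L.weierstrassPExcept 0 0 else (i + 1) * L.sumInvPow 0 (i + 2)) := by
    rw [HasPS.iff_hasFPowerSeriesAt]
    simpa using h0
  have h2 := (HasPS.const 1).add ((HasPS.id.pow 2).mul h1)
  have h3 : PowerSeries.C (1 : ℂ) + PowerSeries.X ^ 2 * (PowerSeries.mk fun i ↦
      if i = 0 then L.weierstrassPExcept 0 0 else (i + 1) * L.sumInvPow 0 (i + 2)) =
      L.sqMulSeries := by
    ext n
    rw [sqMulSeries, map_add, PowerSeries.coeff_mk, PowerSeries.coeff_C,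
      PowerSeries.coeff_X_pow_mul', L.sumInvPow_zero]
    rcases n with _ | _ | _ | n
    · simp
    · simp
    · simp
    · simp [add_assoc]; left; ring
  rw [← h3]
  exact h2

lemma hasPS_cube_mul : HasPS (fun z ↦ -2 + z ^ 3 * L.derivWeierstrassPExcept 0 z)
    (PowerSeries.X * PowerSeries.derivative ℂ L.sqMulSeries - 2 * L.sqMulSeries) := by
  have h0 := L.hasFPowerSeriesAt_derivWeierstrassPExcept 0
  have h1 : HasPS (L.derivWeierstrassPExcept 0) (PowerSeries.mk fun i ↦
      (i + 1) * (i + 2) * L.sumInvPow 0 (i + 3)) := by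
    rw [HasPS.iff_hasFPowerSeriesAt]
    simpa using h0
  have h2 := (HasPS.const (-2)).add ((HasPS.id.pow 3).mul h1)
  have h3 : PowerSeries.C (-2 : ℂ) + PowerSeries.X ^ 3 * (PowerSeries.mk fun i : ℕ ↦
      ((i : ℂ) + 1) * (i + 2) * L.sumInvPow 0 (i + 3)) =
      PowerSeries.X * PowerSeries.derivative ℂ L.sqMulSeries - 2 * L.sqMulSeries := by
    have h2C : (2 : PowerSeries ℂ) = PowerSeries.C 2 := (map_ofNat PowerSeries.C 2).symm
    ext n
    rw [h2C, map_add, map_sub, PowerSeries.coeff_C, PowerSeries.coeff_C_mul,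
      PowerSeries.coeff_X_pow_mul', L.sumInvPow_zero]
    rcases n with _ | n
    · simp [sqMulSeries]
    · rw [PowerSeries.coeff_succ_X_mul]
      rw [PowerSeries.coeff_derivative]
      rcases n with _ | _ | n
      · simp [sqMulSeries]
      · simp [sqMulSeries]
      · simp [sqMulSeries, show ¬ n + 1 + 1 + 1 < 3 by omega]; ring
  rw [← h3]
  exact h2

lemma sqMulSeries_ode :
    (PowerSeries.X * PowerSeries.derivative ℂ L.sqMulSeries - 2 * L.sqMulSeries) ^ 2 =
      4 * (L.sqMulSeries ^ 3 + PowerSeries.C (-L.g₂ / 4) * (PowerSeries.X ^ 2) ^ 2 * L.sqMulSeries +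
        PowerSeries.C (-L.g₃ / 4) * (PowerSeries.X ^ 2) ^ 3) := by
  have h4 : (4 : PowerSeries ℂ) = PowerSeries.C 4 := (map_ofNat PowerSeries.C 4).symm
  rw [h4]
  refine HasPS.eq_of_eventuallyEq_punctured (L.hasPS_cube_mul.pow 2)
    ((HasPS.const 4).mul (((L.hasPS_sq_mul.pow 3).add
      (((HasPS.const _).mul ((HasPS.id.pow 2).pow 2)).mul L.hasPS_sq_mul)).add
      ((HasPS.const _).mul ((HasPS.id.pow 2).pow 3)))) ?_
  have hnot : ∀ᶠ z in 𝓝[≠] (0 : ℂ), z ∉ L.lattice := by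
    have h := L.compl_lattice_sdiff_singleton_mem_nhds 0
    filter_upwards [nhdsWithin_le_nhds h, self_mem_nhdsWithin] with z hz hz0 hmem
    exact hz ⟨hmem, hz0⟩
  filter_upwards [hnot, self_mem_nhdsWithin] with z hz hz0
  have hz0 : z ≠ 0 := hz0
  have e1 := L.weierstrassPExcept_def 0 z
  have e2 := L.derivWeierstrassPExcept_def 0 z
  have e3 := L.derivWeierstrassP_sq z hz
  simp only [ZeroMemClass.coe_zero, sub_zero] at e1 e2
  simp only [Pi.mul_apply, Pi.add_apply, Pi.pow_apply, e1, e2]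
  have e4 : 1 + z ^ 2 * (L.weierstrassP z + (1 / 0 ^ 2 - 1 / z ^ 2)) = z ^ 2 * L.weierstrassP z := by
    field_simp; simp
  have e5 : -2 + z ^ 3 * (L.derivWeierstrassP z + 2 / z ^ 3) = z ^ 3 * L.derivWeierstrassP z := by
    field_simp; ring
  rw [e4, e5]
  linear_combination z ^ 6 * e3

end PeriodPair

end

section

lemma scaledPair_G_bernoulli (τ : ℍ) {v : ℂ} (hv : v ≠ 0)
    (hμ : 2 * Real.pi * Complex.I / v ≠ 0) {m : ℕ} (hk : 3 ≤ 2 * m) :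
    (scaledPair τ (2 * Real.pi * Complex.I / v) hμ).G (2 * m) =
      -((bernoulli (2 * m) : ℚ) : ℂ) / (2 * m).factorial * (E hk τ * v ^ (2 * m)) := by
  have hm : m ≠ 0 := by omega
  rw [scaledPair_G τ hμ hk]
  push_cast
  rw [riemannZeta_two_mul_nat hm]
  have hpi : (Real.pi : ℂ) ≠ 0 := by exact_mod_cast Real.pi_ne_zero
  have hf : ((2 * m).factorial : ℂ) ≠ 0 := by exact_mod_cast Nat.factorial_ne_zero _
  have h2 : (2 : ℂ) ^ (2 * m) = 2 * 2 ^ (2 * m - 1) := by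
    rw [← pow_succ']; congr 1; omega
  have hI : (Complex.I : ℂ) ^ (2 * m) = (-1) ^ m := by rw [pow_mul, Complex.I_sq]
  have hs : ((-1 : ℂ) ^ m) * (-1) ^ m = 1 := by rw [← mul_pow]; simp
  have hs0 : ((-1 : ℂ) ^ m) ≠ 0 := pow_ne_zero _ (by norm_num)
  rw [div_pow, mul_pow, mul_pow, hI, h2, pow_succ]
  field_simp

lemma scaledPair_G_bernoulli_of_even (τ : ℍ) {v : ℂ} (hv : v ≠ 0)
    (hμ : 2 * Real.pi * Complex.I / v ≠ 0) {n m : ℕ} (hn : n = 2 * m) (hk : 3 ≤ n) :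
    (scaledPair τ (2 * Real.pi * Complex.I / v) hμ).G n =
      -((bernoulli n : ℚ) : ℂ) / n.factorial * (E hk τ * v ^ n) := by
  subst hn
  exact scaledPair_G_bernoulli τ hv hμ hk

variable {p : ℕ} [hp : Fact p.Prime] {V : ValuationSubring ℂ} {τ : ℍ} {v : ℂ}

lemma val_bernoulli_mul_eisenstein (hp5 : 5 ≤ p) (hV : V.valuation (p : ℂ) < 1)
    (h4 : E₄ τ * v ^ 4 ∈ V) (h6 : E₆ τ * v ^ 6 ∈ V) {m : ℕ} (hm : 2 * m + 1 < p)
    (hk : 3 ≤ 2 * m) : ((bernoulli (2 * m) : ℚ) : ℂ) * (E hk τ * v ^ (2 * m)) ∈ V := by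
  have hB := val_bernoulli_le_one hV hm
  set B : ℂ := ((bernoulli (2 * m) : ℚ) : ℂ) with hBdef
  have hBV : B ∈ V := (V.valuation_le_one_iff _).mp hB
  have hMF := (MF.eisenstein hk).smul B
  have hcoe : ∀ n, (B • qEis hk).coeff n ∈ V.toSubring.toAddSubgroup := by
    intro n
    have h : (qEis hk).coeff n = if n = 0 then 1 else
        -(2 * ((2 * m : ℕ) : ℂ) / ((bernoulli (2 * m) : ℚ) : ℂ)) *
          (ArithmeticFunction.sigma (2 * m - 1) n : ℕ) := by
      exact_mod_cast EisensteinSeries.E_qExpansion_coeff hk (even_two_mul m) n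
    rw [map_smul, smul_eq_mul, h, ← hBdef]
    split_ifs with hn
    · rw [mul_one]; exact hBV
    · by_cases hB0 : B = 0
      · rw [hB0, zero_mul]; exact zero_mem _
      · have : B * (-(2 * ((2 * m : ℕ) : ℂ) / B) * (ArithmeticFunction.sigma (2 * m - 1) n : ℕ)) =
            ((-(2 * (2 * m : ℕ)) * (ArithmeticFunction.sigma (2 * m - 1) n : ℕ) : ℤ) : ℂ) := by
          push_cast; field_simp
        rw [this]
        exact (V.valuation_le_one_iff _).mp (val_intCast_le_one V _)
  have := MF.value_mem (V := V.toSubring) (I := V.toSubring.toAddSubgroup)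
    (inv_1728_mem hp5 hV) (fun a ha b hb ↦ V.toSubring.mul_mem ha hb) (τ := τ) (w := v) h4 h6
    (k := 2 * m) hMF hcoe
  rw [Pi.smul_apply, smul_eq_mul, mul_assoc] at this
  exact this

lemma val_factorial_add_one (hV : V.valuation (p : ℂ) < 1) :
    V.valuation (((p - 1).factorial : ℂ) + 1) < 1 := by
  have h : (p : ℤ) ∣ ((p - 1).factorial : ℤ) + 1 := by
    rw [← ZMod.intCast_zmod_eq_zero_iff_dvd]
    push_cast
    rw [ZMod.wilsons_lemma]
    ring
  have := (val_intCast_lt_one_iff V hp.out hV).mpr h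
  exact_mod_cast this

lemma val_inv_factorial (hV : V.valuation (p : ℂ) < 1) {n : ℕ} (hn : n < p) :
    V.valuation ((n.factorial : ℂ)⁻¹) = 1 :=
  val_inv_natCast_eq_one hV fun h ↦ by
    have := (hp.out.dvd_factorial).mp h
    omega

/-- The Hasse invariant of the curve attached to a lattice equals the value of the Eisenstein series
of weight `p - 1`, modulo `p`. -/
lemma val_hassePoly_sub (hp5 : 5 ≤ p) (hV : V.valuation (p : ℂ) < 1) (hk3 : 3 ≤ p - 1)
    (hv : v ≠ 0) {κ : ℂ} (hκ : κ ∈ V) (h4 : E₄ τ * v ^ 4 = κ) (h6 : E₆ τ * v ^ 6 = κ)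
    (he : E hk3 τ * v ^ (p - 1) ∈ V) :
    V.valuation (hassePoly p (-κ / 48) (κ / 864) - E hk3 τ * v ^ (p - 1)) < 1 := by
  have hp2 : p ≠ 2 := by omega
  obtain ⟨m, hm⟩ := hp.out.odd_of_ne_two hp2
  have hpm : p - 1 = 2 * m := by omega
  have hμ : 2 * Real.pi * Complex.I / v ≠ 0 :=
    div_ne_zero Complex.two_pi_I_ne_zero hv
  set L := scaledPair τ (2 * Real.pi * Complex.I / v) hμ with hL
  have hg2 : -L.g₂ / 4 = -κ / 48 := by
    have h := scaledPair_G_bernoulli τ hv hμ (m := 2) (by norm_num)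
    rw [PeriodPair.g₂]
    norm_num at h
    have hB : bernoulli 4 = -1 / 30 := by
      rw [bernoulli_eq_bernoulli'_of_ne_one (by norm_num), bernoulli'_four]
    rw [hB] at h
    rw [← h4, h]
    change _ = -(E (show 3 ≤ 4 by norm_num) τ * v ^ 4) / 48
    norm_num [Nat.factorial]
    ring
  have hg3 : -L.g₃ / 4 = κ / 864 := by
    have h := scaledPair_G_bernoulli τ hv hμ (m := 3) (by norm_num)
    rw [PeriodPair.g₃]
    norm_num at h
    have hB : bernoulli 6 = 1 / 42 := by
      have h5 : bernoulli' 5 = 0 := bernoulli'_eq_zero_of_odd (by decide) (by norm_num)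
      rw [bernoulli_eq_bernoulli'_of_ne_one (by norm_num), bernoulli'_def]
      norm_num [Finset.sum_range_succ, h5, bernoulli'_four, Nat.choose]
    rw [hB] at h
    rw [← h6, h]
    change _ = (E (show 3 ≤ 6 by norm_num) τ * v ^ 6) / 864
    norm_num [Nat.factorial]
    ring
  have hode := L.sqMulSeries_ode
  rw [hg2, hg3] at hode
  set u := L.sqMulSeries with hu
  have hu0 : PowerSeries.constantCoeff u = 1 := by
    rw [← PowerSeries.coeff_zero_eq_constantCoeff_apply, hu, PeriodPair.sqMulSeries]
    simp
  obtain ⟨s, hs⟩ : ∃ s, 2 * u * s = 2 * u - PowerSeries.X * PowerSeries.derivative ℂ u := by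
    refine ⟨PowerSeries.C (1 / 2) * (u⁻¹ * (2 * u - PowerSeries.X * PowerSeries.derivative ℂ u)),
      ?_⟩
    have h1 : u * u⁻¹ = 1 := PowerSeries.mul_inv_cancel u (by rw [hu0]; exact one_ne_zero)
    have h2 : (2 : PowerSeries ℂ) * PowerSeries.C (1 / 2) = 1 := by
      rw [← map_ofNat (PowerSeries.C (R := ℂ)) 2, ← map_mul]
      norm_num
    linear_combination (u * u⁻¹ * (2 * u - PowerSeries.X * PowerSeries.derivative ℂ u)) * h2 +
      (2 * u - PowerSeries.X * PowerSeries.derivative ℂ u) * h1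
  have hcoef := coeff_pow_eq_hasse (-κ / 48) (κ / 864) m u s hu0 hode hs
  have hh : PowerSeries.coeff (p - 1) (s ^ p) = hassePoly p (-κ / 48) (κ / 864) := by
    rw [hassePoly, cubicPoly, hpm, Nat.mul_div_cancel_left _ two_pos, hm, ← hcoef]
  have hu_int : ∀ i < p - 1, PowerSeries.coeff i u ∈ V := by
    intro i hi
    rw [hu, PeriodPair.sqMulSeries, PowerSeries.coeff_mk]
    split_ifs with hi0 hi3
    · exact V.one_mem
    · exact V.zero_mem
    · rcases Nat.even_or_odd' i with ⟨n, rfl | rfl⟩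
      · rw [scaledPair_G_bernoulli τ hv hμ (by omega)]
        have h1 := val_bernoulli_mul_eisenstein hp5 hV (h4 ▸ hκ) (h6 ▸ hκ) (m := n) (by omega)
          (by omega)
        have h2 : (((2 * n).factorial : ℂ)⁻¹) ∈ V :=
          (V.valuation_le_one_iff _).mp (val_inv_factorial hV (by omega)).le
        have h3 : (((1 - (2 * n : ℕ) : ℤ)) : ℂ) ∈ V :=
          (V.valuation_le_one_iff _).mp (val_intCast_le_one V _)
        convert mul_mem (mul_mem h3 h2) h1 using 1
        push_cast
        field_simp
        ring
      · rw [L.G_eq_zero_of_odd _ ⟨n, rfl⟩, mul_zero]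
        exact V.zero_mem
  set e := E hk3 τ * v ^ (p - 1) with hedef
  have hpB := val_mul_bernoulli_add_one hp2 hV
  have hpB1 := val_mul_bernoulli hp2 hV
  set β : ℂ := p * ((bernoulli (p - 1) : ℚ) : ℂ) with hβ
  have hN := val_factorial_add_one (p := p) hV
  have hN1 := val_inv_factorial hV (n := p - 1) (by omega)
  set N : ℂ := ((p - 1).factorial : ℂ) with hNdef
  have hN0 : N ≠ 0 := by rw [hNdef]; exact_mod_cast Nat.factorial_ne_zero _
  have htop : (p : ℂ) * PowerSeries.coeff (p - 1) u = (p - 2 : ℂ) * (-β * N⁻¹ * e) := by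
    rw [hu, PeriodPair.sqMulSeries, PowerSeries.coeff_mk, if_neg (by omega), if_neg (by omega)]
    have : L.G (p - 1) = -((bernoulli (p - 1) : ℚ) : ℂ) / N * e :=
      scaledPair_G_bernoulli_of_even τ hv hμ hpm hk3
    rw [this, hβ, Nat.cast_sub hp.out.one_le]
    push_cast
    field_simp
    ring
  have he1 : V.valuation e ≤ 1 := (V.valuation_le_one_iff _).mpr he
  have h2e : V.valuation ((p : ℂ) * PowerSeries.coeff (p - 1) u - 2 * e) < 1 := by
    have : (p : ℂ) * PowerSeries.coeff (p - 1) u - 2 * e =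
        N⁻¹ * (e * (-(p * β) + (2 : ℤ) * (β + 1) - (2 : ℤ) * (N + 1))) := by
      rw [htop]; push_cast; field_simp; ring
    rw [this, map_mul, hN1, one_mul, map_mul]
    refine (mul_le_of_le_one_left' he1).trans_lt ?_
    have hmul2 : ∀ y : ℂ, V.valuation y < 1 → V.valuation ((2 : ℤ) * y) < 1 := fun y hy ↦ by
      rw [map_mul]; exact (mul_le_of_le_one_left' (val_intCast_le_one V 2)).trans_lt hy
    refine V.valuation.map_sub_lt (V.valuation.map_add_lt ?_ (hmul2 _ hpB)) (hmul2 _ hN)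
    rw [Valuation.map_neg, map_mul, hpB1, mul_one]
    exact hV
  have hctop : (p : ℂ) * PowerSeries.coeff (p - 1) u ∈ V := by
    have h2e' : 2 * e ∈ V := mul_mem (by
      have := (V.valuation_le_one_iff _).mp (val_intCast_le_one V 2)
      exact_mod_cast this) he
    have := add_mem ((V.valuation_le_one_iff _).mp h2e.le) h2e'
    rwa [sub_add_cancel] at this
  have hfin := val_coeff_pow_sub_lt_one V p hp.out hp2 hV u s hu0 hu_int hctop hs
  have h2 := V.valuation.map_add_lt hfin h2e
  rw [hh] at h2
  have h3 : (2 * hassePoly p (-κ / 48) (κ / 864) - p * PowerSeries.coeff (p - 1) u +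
      (p * PowerSeries.coeff (p - 1) u - 2 * e)) =
      ((2 : ℤ) : ℂ) * (hassePoly p (-κ / 48) (κ / 864) - e) := by push_cast; ring
  rw [h3, map_mul, val_intCast_eq_one V hp.out hV (by
    intro h
    have := Int.le_of_dvd (by norm_num) h
    omega), one_mul] at h2
  exact h2

end

end

section

open UpperHalfPlane ModularForm MatrixGroups Filter Topology Manifold SlashInvariantForm
  ModularFormClass IsLocalRing

variable {p : ℕ} [hp : Fact p.Prime] {V : ValuationSubring ℂ}

/-- Lifting of a `j`-invariant in the prime field to a singular modulus with an endomorphism of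
norm `p`, whose trace is the Hasse invariant up to sign. -/
lemma exists_singular_lift (hp5 : 5 ≤ p) (hV : V.valuation (p : ℂ) < 1) {c : ℤ}
    (hc0 : ¬ (p : ℤ) ∣ c) (hc1 : ¬ (p : ℤ) ∣ c - 1728) :
    ∃ τ ∈ ModularGroup.fd, ∃ x y z w : ℤ, x * w - y * z = p ∧
      (z * τ + w : ℂ) * τ = x * τ + y ∧ V.valuation (modJ τ - c) < 1 ∧
      ((p : ℤ) ∣ x + w ∨ ∀ κ : ZMod p, κ * (c - 1728) = c →
        hassePoly p (-κ / 48) (κ / 864) ^ 2 = ((x + w : ℤ) : ZMod p) ^ 2) := by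
  obtain ⟨τ, hτ, hj, hiso⟩ := exists_modJ_isogeny hp5 hV c
  have hchar : CharP (ResidueField V) p := residueField_charP V hp.out hV
  have hk3 : 3 ≤ p - 1 := by omega
  have hD := discriminant_ne_zero τ
  have hval0 : V.valuation (modJ τ) = 1 := by
    have h1 := val_intCast_eq_one V hp.out hV hc0
    rw [show modJ τ = (c : ℂ) - (c - modJ τ) by ring, V.valuation.map_sub_eq_of_lt_left, h1]
    rw [h1, Valuation.map_sub_swap]; exact hj
  have hval1 : V.valuation (modJ τ - 1728) = 1 := by
    have h1 := val_intCast_eq_one V hp.out hV hc1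
    rw [show modJ τ - 1728 = ((c - 1728 : ℤ) : ℂ) - (c - modJ τ) by push_cast; ring,
      V.valuation.map_sub_eq_of_lt_left, h1]
    rw [h1, Valuation.map_sub_swap]; exact hj
  have hj0 : modJ τ ≠ 0 := fun h ↦ by simp [h] at hval0
  have hj1 : modJ τ - 1728 ≠ 0 := fun h ↦ by simp [h] at hval1
  have hE6sq : E₆ τ ^ 2 = (modJ τ - 1728) * ModularForm.discriminant τ := by
    rw [modJ, sub_mul, div_mul_cancel₀ _ hD, discriminant_eq_E₄_cube_sub_E₆_sq]
    ring
  have hE4cu : E₄ τ ^ 3 = modJ τ * ModularForm.discriminant τ := by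
    rw [modJ, div_mul_cancel₀ _ hD]
  have hE4 : E₄ τ ≠ 0 := fun h ↦ by
    rw [h] at hE4cu
    exact mul_ne_zero hj0 hD (by rw [← hE4cu]; norm_num)
  have hE6 : E₆ τ ≠ 0 := fun h ↦ by
    rw [h] at hE6sq
    exact mul_ne_zero hj1 hD (by rw [← hE6sq]; norm_num)
  obtain ⟨x, y, z, w, b, hd, h1, h2⟩ := exists_matrix_of_isogeny hE4 hE6 hiso
  refine ⟨τ, hτ, x, y, z, w, hd, h2 ▸ h1, hj, or_iff_not_imp_left.mpr fun ht κ₀ hκ₀ ↦ ?_⟩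
  obtain ⟨v, hv⟩ := IsAlgClosed.exists_pow_nat_eq (E₄ τ / E₆ τ) (n := 2) two_pos
  have hv0 : v ≠ 0 := fun h ↦ by
    rw [h] at hv
    exact div_ne_zero hE4 hE6 (by rw [← hv]; norm_num)
  have hκval : V.valuation (modJ τ / (modJ τ - 1728)) = 1 := by
    rw [map_div₀, hval0, hval1, div_one]
  set κ : V := ⟨modJ τ / (modJ τ - 1728), (V.valuation_le_one_iff _).mp hκval.le⟩ with hκdef
  have hκc : (κ : ℂ) = modJ τ / (modJ τ - 1728) := rfl
  have hκe : (κ : ℂ) = E₄ τ ^ 3 / E₆ τ ^ 2 := by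
    rw [hκc, hE4cu, hE6sq]; field_simp
  have h4 : E₄ τ * v ^ 4 = κ := by
    rw [show v ^ 4 = (v ^ 2) ^ 2 by ring, hv, hκe]; field_simp
  have h6 : E₆ τ * v ^ 6 = κ := by
    rw [show v ^ 6 = (v ^ 2) ^ 3 by ring, hv, hκe]; field_simp
  let φ : ZMod p →+* ResidueField V := ZMod.castHom dvd_rfl _
  have hφc : ∀ n : ℤ, φ n = (n : ResidueField V) := fun n ↦ map_intCast φ n
  have hjr : residue V ⟨modJ τ, (V.valuation_le_one_iff _).mp hval0.le⟩ = (c : ResidueField V) := by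
    rw [← sub_eq_zero, ← map_intCast (residue V), ← map_sub, residue_eq_zero_iff_val]
    exact_mod_cast hj
  have hc1' : (c - 1728 : ZMod p) ≠ 0 := by
    have := mt (ZMod.intCast_zmod_eq_zero_iff_dvd (c - 1728) p).mp hc1
    push_cast at this
    exact this
  have hκr : residue V κ = φ κ₀ := by
    have e1 : κ * (⟨modJ τ, (V.valuation_le_one_iff _).mp hval0.le⟩ - 1728) =
        ⟨modJ τ, (V.valuation_le_one_iff _).mp hval0.le⟩ := by
      apply Subtype.ext
      change (modJ τ / (modJ τ - 1728)) * (modJ τ - ((1728 : V) : ℂ)) = modJ τ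
      have : ((1728 : V) : ℂ) = 1728 := map_ofNat V.subtype 1728
      rw [this]; field_simp
    have e2 := congrArg (residue V) e1
    rw [map_mul, map_sub, hjr, map_ofNat] at e2
    have e3 := congrArg φ hκ₀
    rw [map_mul, map_sub, map_ofNat, hφc] at e3
    have e4 : (c - 1728 : ResidueField V) ≠ 0 := by
      have := (map_ne_zero φ).mpr hc1'
      rwa [map_sub, map_ofNat, hφc] at this
    exact mul_right_cancel₀ e4 (e2.trans e3.symm)
  have hκne : residue V κ ≠ 0 := fun h ↦ by
    rw [residue_eq_zero_iff_val] at h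
    exact absurd (hκval ▸ h) (lt_irrefl _)
  have hκp : residue V κ ^ p = residue V κ := by
    rw [hκr, ← map_pow, ZMod.pow_card]
  obtain ⟨H, hH, -⟩ := exists_hasse_series hp5 hV hk3
  have heV : E hk3 τ * v ^ (p - 1) ∈ V := by
    have := MF.value_mem (V := V.toSubring) (I := V.toSubring.toAddSubgroup)
      (inv_1728_mem hp5 hV) (fun a ha b hb ↦ V.toSubring.mul_mem ha hb) (τ := τ) (w := v)
      (h4 ▸ κ.2) (h6 ▸ κ.2) hH (fun n ↦ by rw [PowerSeries.coeff_map]; exact (H.coeff n).2)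
    exact this
  have hsq := hasse_value_sq hp5 hV hk3 h4 h6 hκne hκp hd h1 h2 ht (e := ⟨_, heV⟩) rfl
  have hhv := val_hassePoly_sub hp5 hV hk3 hv0 κ.2 h4 h6 heV
  have hunit : ∀ n : ℕ, ¬ p ∣ n → ((n : ℂ)⁻¹) ∈ V := fun n hn ↦
    (V.valuation_le_one_iff _).mp (val_inv_natCast_eq_one hV hn).le
  have h23 : ∀ i j : ℕ, ¬ p ∣ 2 ^ i * 3 ^ j := fun i j h ↦ by
    rcases hp.out.dvd_mul.mp h with h | h
    · have := Nat.le_of_dvd two_pos (hp.out.dvd_of_dvd_pow h); omega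
    · have := Nat.le_of_dvd three_pos (hp.out.dvd_of_dvd_pow h); omega
  have h48 : ((48 : ℂ)⁻¹) ∈ V := by exact_mod_cast hunit _ (h23 4 1)
  have h864 : ((864 : ℂ)⁻¹) ∈ V := by exact_mod_cast hunit _ (h23 5 3)
  set i48 : V := ⟨_, h48⟩ with hi48
  set i864 : V := ⟨_, h864⟩ with hi864
  have ha : ((-κ * i48 : V) : ℂ) = -κ / 48 := rfl
  have hb : ((κ * i864 : V) : ℂ) = κ / 864 := rfl
  have hmap := hassePoly_map V.subtype p (-κ * i48) (κ * i864)
  have hmapr := hassePoly_map (residue V) p (-κ * i48) (κ * i864)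
  have hmapφ := hassePoly_map φ p (-κ₀ / 48) (κ₀ / 864)
  have e48 : residue V i48 = φ (1 / 48) := by
    have e1 : i48 * 48 = 1 := by
      apply Subtype.ext
      change (48 : ℂ)⁻¹ * ((48 : V) : ℂ) = 1
      rw [show ((48 : V) : ℂ) = 48 from map_ofNat V.subtype 48]
      norm_num
    have e2 := congrArg (residue V) e1
    rw [map_mul, map_ofNat, map_one] at e2
    rw [map_div₀, map_ofNat, map_one]
    exact eq_one_div_of_mul_eq_one_left e2
  have e864 : residue V i864 = φ (1 / 864) := by
    have e1 : i864 * 864 = 1 := by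
      apply Subtype.ext
      change (864 : ℂ)⁻¹ * ((864 : V) : ℂ) = 1
      rw [show ((864 : V) : ℂ) = 864 from map_ofNat V.subtype 864]
      norm_num
    have e2 := congrArg (residue V) e1
    rw [map_mul, map_ofNat, map_one] at e2
    rw [map_div₀, map_ofNat, map_one]
    exact eq_one_div_of_mul_eq_one_left e2
  have hfin : residue V (hassePoly p (-κ * i48) (κ * i864)) = residue V ⟨_, heV⟩ := by
    rw [← sub_eq_zero, ← map_sub, residue_eq_zero_iff_val]
    have : ((hassePoly p (-κ * i48) (κ * i864) : V) : ℂ) = hassePoly p (-κ / 48 : ℂ) (κ / 864) :=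
      hmap
    push_cast
    rw [this]
    exact hhv
  apply φ.injective
  rw [map_pow, map_pow, hφc, hmapφ, ← hsq, ← hfin, hmapr, map_mul, map_mul, map_neg, e48, e864, hκr]
  congr 2
  · rw [← map_neg, ← map_mul]; congr 1; ring
  · rw [← map_mul]; congr 1; ring

end

section

open UpperHalfPlane ModularForm MatrixGroups

/-- Existence of a place of `ℂ` above a prime. -/
lemma exists_valuationSubring_natCast_lt_one {p : ℕ} (hp : p.Prime) :
    ∃ V : ValuationSubring ℂ, V.valuation (p : ℂ) < 1 := by
  let f : ℤ →+* ℂ := Int.castRingHom ℂ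
  have hf : Function.Injective f := Int.cast_injective
  let e := RingHom.rangeRestrict f
  have hI : (Ideal.span {e p}) ≠ ⊤ := by
    rw [Ne, Ideal.span_singleton_eq_top]
    intro hu
    obtain ⟨⟨y, m, rfl⟩, hy⟩ := hu.exists_right_inv
    have h1 : f p * f m = 1 := congrArg Subtype.val hy
    rw [← map_mul, ← map_one f] at h1
    have h2 := Int.isUnit_iff.1 (IsUnit.of_mul_eq_one _ (hf h1))
    have := hp.two_le
    omega
  obtain ⟨B, -, hB⟩ := Ideal.image_subset_nonunits_valuationSubring _ hI
  refine ⟨B, ?_⟩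
  rw [← ValuationSubring.mem_nonunits_iff]
  apply hB
  exact ⟨e p, Ideal.subset_span rfl, by simp [e, f]⟩

/-- The relation between a quadratic datum `(t, z, b)` and the reductions of the modular invariant
at the corresponding point of the upper half plane. -/
def CMRel (V : ValuationSubring ℂ) (p : ℕ) (d : ℤ × ℤ × ℤ) (j : ZMod p) : Prop :=
  ∃ (τ : ℍ) (c : ℤ), (2 * d.2.1 * (τ : ℂ) + d.2.2) ^ 2 = d.1 ^ 2 - 4 * p ∧
    V.valuation (modJ τ - c) < 1 ∧ (c : ZMod p) = j

lemma CMRel.unique {V : ValuationSubring ℂ} {p : ℕ} (hp : p.Prime) (hV : V.valuation (p : ℂ) < 1)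
    {d : ℤ × ℤ × ℤ} (hd : 1 ≤ d.2.1) {j j' : ZMod p} (h : CMRel V p d j) (h' : CMRel V p d j') :
    j = j' := by
  obtain ⟨τ, c, hτ, hc, rfl⟩ := h
  obtain ⟨σ, c', hσ, hc', rfl⟩ := h'
  have hz : (0 : ℝ) < d.2.1 := by exact_mod_cast hd
  have hτσ : τ = σ := by
    rcases sq_eq_sq_iff_eq_or_eq_neg.1 (hτ.trans hσ.symm) with h | h
    · have h2 : (2 * d.2.1 : ℂ) ≠ 0 := by
        simp only [ne_eq, mul_eq_zero, OfNat.ofNat_ne_zero, Int.cast_eq_zero, false_or]; omega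
      exact UpperHalfPlane.ext (mul_left_cancel₀ h2 (add_right_cancel h))
    · have h3 := congrArg Complex.im h
      simp at h3
      have := mul_pos hz τ.im_pos
      have := mul_pos hz σ.im_pos
      nlinarith
  subst hτσ
  have : V.valuation ((c - c' : ℤ) : ℂ) < 1 := by
    have h1 := Valuation.map_sub_lt _ hc' hc
    convert h1 using 2
    push_cast; ring
  rw [val_intCast_lt_one_iff V hp hV] at this
  rw [← sub_eq_zero, ← Int.cast_sub]
  exact (ZMod.intCast_zmod_eq_zero_iff_dvd _ _).2 this

/-- Every elliptic curve over a prime field with `j ≠ 0, 1728` gives rise to a reduced quadratic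
datum of discriminant `t² - 4p`, with `t` the Frobenius trace up to sign modulo `p` or `t = 0`. -/
lemma exists_CMRel {p : ℕ} [hp : Fact p.Prime] (hp5 : 5 ≤ p) {V : ValuationSubring ℂ}
    (hV : V.valuation (p : ℂ) < 1) {a b : ZMod p} (ha : a ≠ 0) (hb : b ≠ 0)
    (hab : 4 * a ^ 3 + 27 * b ^ 2 ≠ 0) :
    ∃ d : ℤ × ℤ × ℤ, 1 ≤ d.2.1 ∧ |d.2.2| ≤ d.2.1 ∧ 3 * d.2.1 ^ 2 ≤ 4 * p - d.1 ^ 2 ∧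
      4 * d.2.1 ∣ d.2.2 ^ 2 + 4 * p - d.1 ^ 2 ∧
      (d.1 = 0 ∨ (p : ℤ) ∣ affinePoints p a b - d.1 ∨ (p : ℤ) ∣ affinePoints p a b + d.1) ∧
      CMRel V p d (1728 * (4 * a ^ 3) / (4 * a ^ 3 + 27 * b ^ 2)) := by
  have hP : ∀ n : ℕ, 0 < n → n < 5 → ((n : ℕ) : ZMod p) ≠ 0 := by
    intro n h0 h1 h
    rw [ZMod.natCast_eq_zero_iff] at h
    exact absurd (Nat.le_of_dvd h0 h) (by omega)
  have h2 : (2 : ZMod p) ≠ 0 := by exact_mod_cast hP 2 (by norm_num) (by norm_num)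
  have h3 : (3 : ZMod p) ≠ 0 := by exact_mod_cast hP 3 (by norm_num) (by norm_num)
  have h1728 : (1728 : ZMod p) ≠ 0 := by
    rw [show (1728 : ZMod p) = 2 ^ 6 * 3 ^ 3 by norm_num]
    exact mul_ne_zero (pow_ne_zero _ h2) (pow_ne_zero _ h3)
  set j : ZMod p := 1728 * (4 * a ^ 3) / (4 * a ^ 3 + 27 * b ^ 2) with hj
  obtain ⟨c, hc⟩ : ∃ c : ℤ, (c : ZMod p) = j := ZMod.intCast_surjective j
  have h4a : 4 * a ^ 3 ≠ 0 := by
    rw [show (4 : ZMod p) = 2 ^ 2 by norm_num]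
    exact mul_ne_zero (pow_ne_zero _ h2) (pow_ne_zero _ ha)
  have h27b : 27 * b ^ 2 ≠ 0 := by
    rw [show (27 : ZMod p) = 3 ^ 3 by norm_num]
    exact mul_ne_zero (pow_ne_zero _ h3) (pow_ne_zero _ hb)
  have hj0 : j ≠ 0 := div_ne_zero (mul_ne_zero h1728 h4a) hab
  have hj1e : j - 1728 = - (1728 * (27 * b ^ 2)) / (4 * a ^ 3 + 27 * b ^ 2) := by
    rw [hj]; field_simp; ring
  have hj1 : j - 1728 ≠ 0 := by
    rw [hj1e]; exact div_ne_zero (neg_ne_zero.2 (mul_ne_zero h1728 h27b)) hab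
  have hc0 : ¬ (p : ℤ) ∣ c := by
    rw [← ZMod.intCast_zmod_eq_zero_iff_dvd, hc]; exact hj0
  have hc1 : ¬ (p : ℤ) ∣ c - 1728 := by
    rw [← ZMod.intCast_zmod_eq_zero_iff_dvd]; push_cast; rw [hc]; exact hj1
  obtain ⟨τ, hτ, x', y', z', w', hdet', hfix', hval, hh'⟩ := exists_singular_lift hp5 hV hc0 hc1
  obtain ⟨x, y, z, w, hdet, hfix, hh, hz⟩ : ∃ x y z w : ℤ, x * w - y * z = p ∧
      (z * τ + w : ℂ) * τ = x * τ + y ∧ ((p:ℤ) ∣ x+w ∨ ∀ κ : ZMod p, κ*(c-1728) = c →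
        hassePoly p (-κ/48) (κ/864) ^ 2 = ((x+w:ℤ) : ZMod p)^2) ∧ 0 ≤ z := by
    rcases le_total 0 z' with h | h
    · exact ⟨x', y', z', w', hdet', hfix', hh', h⟩
    · refine ⟨-x', -y', -z', -w', by linarith, ?_, ?_, by omega⟩
      · push_cast; linear_combination -hfix'
      · rcases hh' with h | h
        · left; rw [← neg_add]; exact (dvd_neg).2 h
        · right; intro κ hκ; rw [h κ hκ]; push_cast; ring
  -- real and imaginary parts
  have hs := τ.im_pos
  have hre := congrArg Complex.re hfix
  have him := congrArg Complex.im hfix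
  simp at hre him
  obtain ⟨hn, hr⟩ := hτ
  rw [Complex.normSq_apply] at hn
  simp only [coe_re, coe_im] at hn hre him
  have hA : (2 * z * τ.re : ℝ) = x - w := by
    apply mul_right_cancel₀ hs.ne'
    linarith
  have hB : (-y : ℝ) = z * (τ.re * τ.re + τ.im * τ.im) := by linear_combination hre - τ.re * hA
  have hz1 : 1 ≤ z := by
    by_contra hcon
    have hz0 : z = 0 := by omega
    subst hz0
    have hy : y = 0 := by
      have : (-y : ℝ) = 0 := by rw [hB]; simp
      exact_mod_cast neg_eq_zero.1 this
    have hxw : x = w := by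
      have : (x - w : ℝ) = 0 := by rw [← hA]; simp
      exact_mod_cast sub_eq_zero.1 this
    subst hy; subst hxw
    have h1 : x * x = p := by linarith
    have h2 : (p : ℕ) = x.natAbs * x.natAbs := by
      zify; rw [abs_mul_abs_self]; exact h1.symm
    have h3 : x.natAbs ≠ 1 := by intro h; rw [h] at h2; omega
    exact Nat.not_prime_mul h3 h3 (h2 ▸ hp.out)
  have hzR : (1 : ℝ) ≤ z := by exact_mod_cast hz1
  have hb1 : |w - x| ≤ z := by
    rw [abs_le] at hr ⊢
    constructor
    · have : (-z : ℝ) ≤ w - x := by nlinarith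
      exact_mod_cast this
    · have : (w - x : ℝ) ≤ z := by nlinarith
      exact_mod_cast this
  have hy1 : z ≤ -y := by
    have : (z : ℝ) ≤ -y := by rw [hB]; nlinarith
    exact_mod_cast this
  have hbsq : (w - x) ^ 2 ≤ z ^ 2 := sq_le_sq' (by linarith [(abs_le.1 hb1).1]) (abs_le.1 hb1).2
  have hmain : 3 * z ^ 2 ≤ 4 * p - (x + w) ^ 2 := by nlinarith
  refine ⟨(x + w, z, w - x), hz1, hb1, hmain, ⟨-y, by rw [← hdet]; ring⟩, ?_, τ, c, ?_, hval, hc⟩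
  · have hp' : (5 : ℤ) ≤ p := by exact_mod_cast hp5
    rcases hh with h | h
    · left
      obtain ⟨k, hk⟩ := h
      change x + w = 0
      rw [hk] at hmain ⊢
      have : k = 0 := by
        by_contra hk0
        have : 1 ≤ k ^ 2 := by have := sq_pos_of_ne_zero hk0; omega
        nlinarith [sq_nonneg z, mul_le_mul_of_nonneg_left this (sq_nonneg (p : ℤ))]
      simp [this]
    · right
      set κ : ZMod p := j / (j - 1728) with hκ
      have h4 := h κ (by rw [hκ, hc]; field_simp)
      -- twist
      have hκ' : κ = - (4 * a ^ 3) / (27 * b ^ 2) := by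
        rw [hκ, hj1e, hj]; field_simp
      have h48 : (48 : ZMod p) ≠ 0 := by
        rw [show (48 : ZMod p) = 2 ^ 4 * 3 by norm_num]; exact mul_ne_zero (pow_ne_zero _ h2) h3
      have h864 : (864 : ZMod p) ≠ 0 := by
        rw [show (864 : ZMod p) = 2 ^ 5 * 3 ^ 3 by norm_num]
        exact mul_ne_zero (pow_ne_zero _ h2) (pow_ne_zero _ h3)
      have h18 : (18 : ZMod p) ≠ 0 := by
        rw [show (18 : ZMod p) = 2 * 3 ^ 2 by norm_num]
        exact mul_ne_zero h2 (pow_ne_zero _ h3)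
      have h27 : (27 : ZMod p) ≠ 0 := by
        rw [show (27 : ZMod p) = 3 ^ 3 by norm_num]; exact (pow_ne_zero _ h3)
      have h4' : (4 : ZMod p) ≠ 0 := by
        rw [show (4 : ZMod p) = 2 ^ 2 by norm_num]; exact (pow_ne_zero _ h2)
      set s : ZMod p := -18 * b / a with hs
      have hs0 : s ≠ 0 := div_ne_zero (mul_ne_zero (neg_ne_zero.2 h18) hb) ha
      have ea : s ^ 2 * (-κ / 48) = a := by
        rw [hκ', hs]; field_simp; norm_num
      have eb : s ^ 3 * (κ / 864) = b := by
        rw [hκ', hs]; field_simp; norm_num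
      have hodd : Odd p := hp.out.odd_of_ne_two (by omega)
      have h5 := hassePoly_scale hodd (-κ / 48) (κ / 864) s hs0
      rw [ea, eb] at h5
      have h6 : hassePoly p a b ^ 2 = ((x + w : ℤ) : ZMod p) ^ 2 := by
        rw [h5, mul_pow, h4, ← pow_mul]
        obtain ⟨m, hm⟩ := hodd
        rw [show (p - 1) / 2 * 2 = p - 1 by omega, ZMod.pow_card_sub_one_eq_one hs0, one_mul]
      have h7 := affinePoints_cast (p := p) (by omega) a b
      simp only [← ZMod.intCast_zmod_eq_zero_iff_dvd]
      push_cast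
      rw [h7]
      rcases sq_eq_sq_iff_eq_or_eq_neg.1 h6 with h8 | h8
      · right; rw [h8]; push_cast; ring
      · left; rw [h8]; push_cast; ring
  · change (2 * (z : ℂ) * τ + ((w - x : ℤ) : ℂ)) ^ 2 = ((x + w : ℤ) : ℂ) ^ 2 - 4 * p
    have hdC : (x * w - y * z : ℂ) = p := by exact_mod_cast hdet
    rw [← hdC]; push_cast
    linear_combination 4 * (z : ℂ) * hfix

end

section

/-- Reduced quadratic data of discriminant `t² - 4n` whose trace `t` is compatible with the
residue class `a` modulo `ℓ`. -/
def CMDatum (a : ℤ) (ℓ n : ℕ) (t z b : ℤ) : Prop :=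
  1 ≤ z ∧ |b| ≤ z ∧ 3 * z ^ 2 ≤ 4 * n - t ^ 2 ∧ 4 * z ∣ b ^ 2 + 4 * n - t ^ 2 ∧
    ((t = 0 ∨ (ℓ : ℤ) ∣ t - a ∨ (ℓ : ℤ) ∣ t + a) ∨
      ((ℓ : ℤ) ∣ t - a + n ∨ (ℓ : ℤ) ∣ t - a - n ∨ (ℓ : ℤ) ∣ t + a + n ∨ (ℓ : ℤ) ∣ t + a - n))

/-- A set of integers in an interval lying in one residue class. -/
lemma card_le_of_dvd_sub {S : Finset ℤ} {u v m : ℤ} (hm : 0 < m) (hS : S ⊆ Finset.Icc u v)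
    (h : ∀ x ∈ S, ∀ y ∈ S, m ∣ x - y) (huv : u ≤ v + 1) : (S.card : ℝ) ≤ (v - u : ℤ) / m + 1 := by
  rcases S.eq_empty_or_nonempty with rfl | ⟨x, hx⟩
  · have h1 : (-1 : ℝ) ≤ (v - u : ℤ) := by exact_mod_cast (by omega : -1 ≤ v - u)
    have h2 : (1 : ℝ) ≤ m := by exact_mod_cast hm
    have : (-1 : ℝ) ≤ (v - u : ℤ) / m := by
      rw [le_div_iff₀ (by linarith)]; linarith
    push_cast at this ⊢
    simp only [Finset.card_empty, Nat.cast_zero]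
    linarith
  · set y := S.min' ⟨x, hx⟩ with hy
    have hyS : y ∈ S := S.min'_mem _
    have hcard : S.card ≤ (Finset.Icc 0 ((v - u) / m)).card := by
      refine Finset.card_le_card_of_injOn (fun n => (n - y) / m) ?_ ?_
      · intro n hn
        have h1 := S.min'_le n hn
        have h2 := Finset.mem_Icc.1 (hS hn)
        have h3 := Finset.mem_Icc.1 (hS hyS)
        simp only [Finset.coe_Icc, Set.mem_Icc]
        constructor
        · exact Int.ediv_nonneg (by omega) hm.le
        · exact Int.ediv_le_ediv hm (by omega)
      · intro n hn k hk hnk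
        have h1 := Int.ediv_mul_cancel (h n hn y hyS)
        have h2 := Int.ediv_mul_cancel (h k hk y hyS)
        simp only at hnk
        rw [hnk] at h1
        omega
    have hvu : 0 ≤ v - u := by
      have h3 := Finset.mem_Icc.1 (hS hyS)
      omega
    rw [Int.card_Icc] at hcard
    have h0 : 0 ≤ (v - u) / m := Int.ediv_nonneg hvu hm.le
    have h1 : (S.card : ℤ) ≤ (v - u) / m + 1 := by omega
    have h2 : (((v - u) / m : ℤ) : ℝ) ≤ (v - u : ℤ) / m := by
      rw [le_div_iff₀ (by exact_mod_cast hm)]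
      exact_mod_cast Int.ediv_mul_le _ hm.ne'
    calc (S.card : ℝ) ≤ (((v - u) / m + 1 : ℤ) : ℝ) := by exact_mod_cast h1
      _ ≤ _ := by push_cast at h2 ⊢; linarith

lemma card_nat_le_of_dvd_sub {S : Finset ℕ} {Y : ℕ} {m : ℤ} (hm : 0 < m)
    (hS : S ⊆ Finset.Icc 1 Y) (h : ∀ x ∈ S, ∀ y ∈ S, m ∣ (x : ℤ) - y) :
    (S.card : ℝ) ≤ Y / m + 1 := by
  have h1 := card_le_of_dvd_sub (S := S.map Nat.castEmbedding) (u := 1) (v := Y) hm ?_ ?_ (by omega)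
  · rw [Finset.card_map] at h1
    refine h1.trans ?_
    have : (0 : ℝ) < m := by exact_mod_cast hm
    gcongr
    push_cast; linarith
  · intro x hx
    obtain ⟨n, hn, rfl⟩ := Finset.mem_map.1 hx
    have := Finset.mem_Icc.1 (hS hn)
    simp only [Nat.castEmbedding_apply, Finset.mem_Icc]
    omega
  · intro x hx y hy
    obtain ⟨n, hn, rfl⟩ := Finset.mem_map.1 hx
    obtain ⟨k, hk, rfl⟩ := Finset.mem_map.1 hy
    exact h n hn k hk

lemma card_filter_dvd_affine {ℓ Y : ℕ} (hℓ : ℓ.Prime) {z b t s e : ℤ} (he : e = 1 ∨ e = -1)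
    (hz : 1 ≤ z) (S : Finset ℕ) (hS : S ⊆ Finset.Icc 1 Y)
    (h : ∀ n ∈ S, 4 * z ∣ b ^ 2 + 4 * n - t ^ 2 ∧ (ℓ : ℤ) ∣ s + e * n) :
    (S.card : ℝ) ≤ Y / (z * ℓ) + 1 + if (ℓ : ℤ) ∣ z then (Y / z : ℝ) else 0 := by
  have hz0 : (0 : ℝ) < z := by exact_mod_cast hz
  have hdz : ∀ x ∈ S, ∀ y ∈ S, z ∣ (x : ℤ) - y := by
    intro x hx y hy
    have h1 := dvd_sub (h x hx).1 (h y hy).1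
    have : b ^ 2 + 4 * (x : ℤ) - t ^ 2 - (b ^ 2 + 4 * y - t ^ 2) = 4 * (x - y) := by ring
    rw [this] at h1
    exact Int.dvd_of_mul_dvd_mul_left (by norm_num) h1
  have hdl : ∀ x ∈ S, ∀ y ∈ S, (ℓ : ℤ) ∣ (x : ℤ) - y := by
    intro x hx y hy
    have h1 := dvd_sub (h x hx).2 (h y hy).2
    rcases he with rfl | rfl
    · have e : (x : ℤ) - y = s + 1 * x - (s + 1 * y) := by ring
      rw [e]; exact h1
    · rw [← dvd_neg]
      have e : -((x : ℤ) - y) = s + -1 * x - (s + -1 * y) := by ring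
      rw [e]; exact h1
  split_ifs with hlz
  · have h1 := card_nat_le_of_dvd_sub (by omega) hS hdz
    have : (0 : ℝ) ≤ Y / (z * ℓ) := by positivity
    linarith
  · have hco : IsCoprime (z : ℤ) ℓ :=
      ((Nat.prime_iff_prime_int.1 hℓ).coprime_iff_not_dvd.2 hlz).symm
    have h1 := card_nat_le_of_dvd_sub (m := z * ℓ)
      (mul_pos (by omega) (by exact_mod_cast hℓ.pos)) hS
      (fun x hx y hy => hco.mul_dvd (hdz x hx y hy) (hdl x hx y hy))
    push_cast at h1
    linarith

open Classical in
/-- The number of `n ≤ Y` for which a given triple is a datum. -/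
lemma card_filter_CMDatum {a : ℤ} {ℓ Y : ℕ} (hℓ : ℓ.Prime) {t z b : ℤ} (hz : 1 ≤ z) :
    (((Finset.Icc 1 Y).filter fun n => CMDatum a ℓ n t z b).card : ℝ) ≤
      (if t = 0 ∨ (ℓ : ℤ) ∣ t - a ∨ (ℓ : ℤ) ∣ t + a then (Y / z + 1 : ℝ) else 0) +
      4 * (Y / (z * ℓ) + 1 + if (ℓ : ℤ) ∣ z then (Y / z : ℝ) else 0) := by
  have hz0 : (0 : ℝ) < z := by exact_mod_cast hz
  set F := fun (s e : ℤ) => (Finset.Icc 1 Y).filter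
    fun n : ℕ => 4 * z ∣ b ^ 2 + 4 * n - t ^ 2 ∧ (ℓ : ℤ) ∣ s + e * n with hF
  have hFc : ∀ s e, (e = 1 ∨ e = -1) → ((F s e).card : ℝ) ≤
      Y / (z * ℓ) + 1 + if (ℓ : ℤ) ∣ z then (Y / z : ℝ) else 0 := by
    intro s e he
    exact card_filter_dvd_affine hℓ (b := b) (t := t) (s := s) he hz _ (Finset.filter_subset _ _)
      (fun n hn => (Finset.mem_filter.1 hn).2)
  by_cases h1 : t = 0 ∨ (ℓ : ℤ) ∣ t - a ∨ (ℓ : ℤ) ∣ t + a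
  · rw [if_pos h1]
    have h2 : (((Finset.Icc 1 Y).filter fun n => CMDatum a ℓ n t z b).card : ℝ) ≤ Y / z + 1 := by
      refine card_nat_le_of_dvd_sub (by omega) (Finset.filter_subset _ _) ?_
      intro x hx y hy
      have h1 := dvd_sub (Finset.mem_filter.1 hx).2.2.2.2.1 (Finset.mem_filter.1 hy).2.2.2.2.1
      have : b ^ 2 + 4 * (x : ℤ) - t ^ 2 - (b ^ 2 + 4 * y - t ^ 2) = 4 * (x - y) := by ring
      rw [this] at h1
      exact Int.dvd_of_mul_dvd_mul_left (by norm_num) h1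
    have h3 : (0 : ℝ) ≤ 4 * (Y / (z * ℓ) + 1 + if (ℓ : ℤ) ∣ z then (Y / z : ℝ) else 0) := by
      split_ifs <;> positivity
    linarith
  · rw [if_neg h1]
    have hsub : ((Finset.Icc 1 Y).filter fun n => CMDatum a ℓ n t z b) ⊆
        (F (t - a) 1 ∪ F (t - a) (-1)) ∪ (F (t + a) 1 ∪ F (t + a) (-1)) := by
      intro n hn
      obtain ⟨hn, -, -, -, hd, hc⟩ := Finset.mem_filter.1 hn
      simp only [hF, Finset.mem_union, Finset.mem_filter, hn, hd, true_and, one_mul, neg_one_mul,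
        ← sub_eq_add_neg]
      tauto
    have h2 := (Finset.card_le_card hsub).trans ((Finset.card_union_le _ _).trans
      (add_le_add (Finset.card_union_le _ _) (Finset.card_union_le _ _)))
    have h3 : (((Finset.Icc 1 Y).filter fun n => CMDatum a ℓ n t z b).card : ℝ) ≤
        (F (t - a) 1).card + (F (t - a) (-1)).card + ((F (t + a) 1).card + (F (t + a) (-1)).card) := by
      exact_mod_cast h2
    have e1 := hFc (t - a) 1 (by simp)
    have e2 := hFc (t - a) (-1) (by simp)
    have e3 := hFc (t + a) 1 (by simp)
    have e4 := hFc (t + a) (-1) (by simp)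
    linarith

/-- A box containing all data for `n`. -/
noncomputable def cmBox (s : ℕ) : Finset (ℤ × ℤ × ℤ) :=
  Finset.Icc (-s : ℤ) s ×ˢ Finset.Icc 1 (s : ℤ) ×ˢ Finset.Icc (-s : ℤ) s

lemma CMDatum.mem_cmBox {a : ℤ} {ℓ n s : ℕ} {t z b : ℤ} (h : CMDatum a ℓ n t z b)
    (hs : Nat.sqrt (4 * n) ≤ s) : (t, z, b) ∈ cmBox s := by
  obtain ⟨h1, h2, h3, -, -⟩ := h
  have key : ∀ m : ℤ, m ^ 2 ≤ 4 * n → |m| ≤ s := by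
    intro m hm
    have : m.natAbs ≤ Nat.sqrt (4 * n) := by
      rw [Nat.le_sqrt]
      zify
      rw [abs_mul_abs_self]; linarith
    have := this.trans hs
    zify at this
    exact this
  have ht := abs_le.1 (key t (by nlinarith [sq_nonneg z]))
  have hz := abs_le.1 (key z (by nlinarith [sq_nonneg t, sq_nonneg z]))
  have hb := abs_le.1 h2
  simp only [cmBox, Finset.mem_product, Finset.mem_Icc]
  omega

open Classical in
/-- The average over `n ≤ Y` of the number of data. -/
lemma sum_card_CMDatum_le {a : ℤ} {ℓ Y : ℕ} (hℓ : ℓ.Prime) :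
    ∑ n ∈ Finset.Icc 1 Y, ((((cmBox (Nat.sqrt (4 * n))).filter
      fun d => CMDatum a ℓ n d.1 d.2.1 d.2.2).card : ℕ) : ℝ) ≤
      504 * ((Y : ℝ) ^ 2 / ℓ + Y * √Y) := by
  rcases Nat.eq_zero_or_pos Y with rfl | hY
  · simp
  set R := Nat.sqrt (4 * Y) with hR
  have hℓ0 : (0 : ℝ) < ℓ := by exact_mod_cast hℓ.pos
  have hY1 : (1 : ℝ) ≤ Y := by exact_mod_cast hY
  have hR1 : 1 ≤ R := by rw [hR, Nat.le_sqrt]; omega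
  have hR1' : (1 : ℝ) ≤ R := by exact_mod_cast hR1
  have hRR : (R : ℝ) ^ 2 ≤ 4 * Y := by
    have := Nat.sqrt_le (4 * Y)
    rw [sq]; exact_mod_cast this
  have hR2 : (R : ℝ) ≤ 2 * √Y := by
    have : √(4 * Y) = 2 * √(Y : ℝ) := by
      rw [Real.sqrt_mul (by norm_num), show (4 : ℝ) = 2 ^ 2 by norm_num,
        Real.sqrt_sq (by norm_num)]
    rw [← this]
    exact Real.le_sqrt_of_sq_le hRR
  set G : ℤ → ℤ → ℝ := fun t z =>
      (if t = 0 ∨ (ℓ : ℤ) ∣ t - a ∨ (ℓ : ℤ) ∣ t + a then (Y / z + 1 : ℝ) else 0) +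
      4 * (Y / (z * ℓ) + 1 + if (ℓ : ℤ) ∣ z then (Y / z : ℝ) else 0) with hG
  calc _ ≤ ∑ n ∈ Finset.Icc 1 Y, ((((cmBox R).filter
      fun d => CMDatum a ℓ n d.1 d.2.1 d.2.2).card : ℕ) : ℝ) := by
        refine Finset.sum_le_sum fun n hn => ?_
        have hn := Finset.mem_Icc.1 hn
        refine Nat.cast_le.2 (Finset.card_le_card fun d hd => ?_)
        have hd := (Finset.mem_filter.1 hd).2
        exact Finset.mem_filter.2 ⟨hd.mem_cmBox (Nat.sqrt_le_sqrt (by omega)), hd⟩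
    _ = ∑ d ∈ cmBox R, ((((Finset.Icc 1 Y).filter
          fun n => CMDatum a ℓ n d.1 d.2.1 d.2.2).card : ℕ) : ℝ) := by
        simp only [Finset.card_filter]
        push_cast
        exact Finset.sum_comm
    _ = ∑ t ∈ Finset.Icc (-R : ℤ) R, ∑ z ∈ Finset.Icc 1 (R : ℤ), ∑ b ∈ Finset.Icc (-R : ℤ) R,
          ((((Finset.Icc 1 Y).filter fun n => CMDatum a ℓ n t z b).card : ℕ) : ℝ) := by
        simp only [cmBox, Finset.sum_product]
    _ ≤ ∑ t ∈ Finset.Icc (-R : ℤ) R, ∑ z ∈ Finset.Icc 1 (R : ℤ), 3 * z * G t z := by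
        refine Finset.sum_le_sum fun t _ => Finset.sum_le_sum fun z hz => ?_
        have hz := Finset.mem_Icc.1 hz
        have hz0 : (1 : ℝ) ≤ z := by exact_mod_cast hz.1
        rw [← Finset.sum_subset (s₁ := Finset.Icc (-z) z)]
        · calc _ ≤ ∑ b ∈ Finset.Icc (-z) z, G t z :=
                Finset.sum_le_sum fun b _ => card_filter_CMDatum hℓ hz.1
            _ = ((2 * z + 1 : ℤ) : ℝ) * G t z := by
                rw [Finset.sum_const, Int.card_Icc, nsmul_eq_mul]
                congr 1
                rw [show z + 1 - -z = 2 * z + 1 by ring]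
                have : ((2 * z + 1).toNat : ℤ) = 2 * z + 1 := Int.toNat_of_nonneg (by omega)
                exact_mod_cast this
            _ ≤ _ := by
                have hG0 : 0 ≤ G t z := by
                  simp only [hG]
                  split_ifs <;> positivity
                gcongr
                push_cast; linarith
        · intro b hb
          rw [Finset.mem_Icc] at hb ⊢
          omega
        · intro b _ hb
          rw [Nat.cast_eq_zero, Finset.card_eq_zero, Finset.filter_eq_empty_iff]
          intro n _ h
          exact hb (Finset.mem_Icc.2 (abs_le.1 h.2.1))
    _ ≤ ∑ t ∈ Finset.Icc (-R : ℤ) R,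
          ((if t = 0 ∨ (ℓ : ℤ) ∣ t - a ∨ (ℓ : ℤ) ∣ t + a then (9 * Y * R : ℝ) else 0) +
            (24 * Y * R / ℓ + 12 * R ^ 2)) := by
        refine Finset.sum_le_sum fun t _ => ?_
        have hterm : ∀ z ∈ Finset.Icc 1 (R : ℤ), 3 * z * G t z ≤
            (if t = 0 ∨ (ℓ : ℤ) ∣ t - a ∨ (ℓ : ℤ) ∣ t + a then (9 * Y : ℝ) else 0) +
            (12 * Y / ℓ + 12 * R) + if (ℓ : ℤ) ∣ z then (12 * Y : ℝ) else 0 := by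
          intro z hz
          have hz := Finset.mem_Icc.1 hz
          have hz0 : (1 : ℝ) ≤ z := by exact_mod_cast hz.1
          have hzR : (z : ℝ) ≤ R := by exact_mod_cast hz.2
          have hzY : (z : ℝ) ≤ 2 * Y := by
            have : (R : ℝ) ≤ 2 * Y := by nlinarith
            linarith
          have e1 : (z : ℝ) * (Y / z) = Y := by field_simp
          have e2 : (z : ℝ) * (Y / (z * ℓ)) = Y / ℓ := by field_simp
          have e3 : 12 * (Y : ℝ) / ℓ = 12 * (Y / ℓ) := by ring
          simp only [hG]
          rw [e3, ← e2]
          have : (3 * z : ℝ) * (4 * (Y / (z * ℓ) + 1 + if (ℓ : ℤ) ∣ z then (Y / z : ℝ) else 0)) =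
              12 * (z * (Y / (z * ℓ))) + 12 * z + if (ℓ : ℤ) ∣ z then (12 * Y : ℝ) else 0 := by
            split_ifs
            · linear_combination 12 * e1
            · ring
          rw [mul_add, this]
          have : (3 * z : ℝ) * (if t = 0 ∨ (ℓ : ℤ) ∣ t - a ∨ (ℓ : ℤ) ∣ t + a then (Y / z + 1 : ℝ)
              else 0) ≤ if t = 0 ∨ (ℓ : ℤ) ∣ t - a ∨ (ℓ : ℤ) ∣ t + a then (9 * Y : ℝ) else 0 := by
            split_ifs
            · linear_combination 3 * e1 + 3 * hzY
            · simp
          linarith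
        refine (Finset.sum_le_sum hterm).trans ?_
        rw [Finset.sum_add_distrib, Finset.sum_const, Int.card_Icc, nsmul_eq_mul,
          ← Finset.sum_filter, Finset.sum_const, nsmul_eq_mul]
        have hc : (((Finset.Icc 1 (R : ℤ)).filter fun z => (ℓ : ℤ) ∣ z).card : ℝ) ≤ R / ℓ := by
          have h0 : ((Finset.Icc 1 (R : ℤ)).filter fun z => (ℓ : ℤ) ∣ z).card ≤ R / ℓ := by
            rw [← Nat.Ioc_filter_dvd_card_eq_div]
            refine Finset.card_le_card_of_injOn Int.toNat ?_ ?_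
            · intro z hz
              obtain ⟨h1, h2⟩ := Finset.mem_filter.1 hz
              have h1 := Finset.mem_Icc.1 h1
              have h3 : (z.toNat : ℤ) = z := Int.toNat_of_nonneg (by omega)
              refine Finset.mem_coe.2 (Finset.mem_filter.2 ⟨Finset.mem_Ioc.2 (by omega), ?_⟩)
              rwa [← Int.natCast_dvd_natCast, h3]
            · intro z hz w hw h
              have h1 := Finset.mem_Icc.1 (Finset.mem_filter.1 hz).1
              have h2 := Finset.mem_Icc.1 (Finset.mem_filter.1 hw).1
              omega
          exact (Nat.cast_le.2 h0).trans Nat.cast_div_le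
        have h1 : (((R : ℤ) + 1 - 1).toNat : ℝ) = R := by simp
        rw [h1]
        have h2 : (((Finset.Icc 1 (R : ℤ)).filter fun z => (ℓ : ℤ) ∣ z).card : ℝ) * (12 * Y) ≤
          R / ℓ * (12 * Y) := by gcongr
        have h3 : (R : ℝ) * ((if t = 0 ∨ (ℓ : ℤ) ∣ t - a ∨ (ℓ : ℤ) ∣ t + a then (9 * Y : ℝ) else 0) +
            (12 * Y / ℓ + 12 * R)) = (if t = 0 ∨ (ℓ : ℤ) ∣ t - a ∨ (ℓ : ℤ) ∣ t + a then
            (9 * Y * R : ℝ) else 0) + 12 * Y * R / ℓ + 12 * R ^ 2 := by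
          split_ifs <;> ring
        rw [h3]
        have h4 : 24 * Y * R / ℓ = 12 * Y * R / ℓ + R / ℓ * (12 * Y : ℝ) := by ring
        rw [h4]
        linarith
    _ ≤ (3 + 6 * R / ℓ) * (9 * Y * R) + 3 * R * (24 * Y * R / ℓ + 12 * R ^ 2) := by
        rw [Finset.sum_add_distrib, Finset.sum_const, Int.card_Icc, nsmul_eq_mul,
          ← Finset.sum_filter, Finset.sum_const, nsmul_eq_mul]
        gcongr
        · have hsub : ((Finset.Icc (-R : ℤ) R).filter
              fun t => t = 0 ∨ (ℓ : ℤ) ∣ t - a ∨ (ℓ : ℤ) ∣ t + a) ⊆ {0} ∪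
              (((Finset.Icc (-R : ℤ) R).filter fun t => (ℓ : ℤ) ∣ t - a) ∪
              ((Finset.Icc (-R : ℤ) R).filter fun t => (ℓ : ℤ) ∣ t + a)) := by
            intro t ht
            simp only [Finset.mem_filter, Finset.mem_union, Finset.mem_singleton] at ht ⊢
            tauto
          have h1 := (Finset.card_le_card hsub).trans ((Finset.card_union_le _ _).trans
            (add_le_add le_rfl (Finset.card_union_le _ _)))
          have h2 : ∀ c : ℤ, (((Finset.Icc (-R : ℤ) R).filter fun t => (ℓ : ℤ) ∣ t + c).card : ℝ) ≤
              2 * R / ℓ + 1 := by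
            intro c
            refine (card_le_of_dvd_sub (m := ℓ) (by exact_mod_cast hℓ.pos)
              (Finset.filter_subset _ _) ?_ (by omega)).trans ?_
            · intro x hx y hy
              have := dvd_sub (Finset.mem_filter.1 hx).2 (Finset.mem_filter.1 hy).2
              simpa using this
            · apply le_of_eq; push_cast; ring
          have h3 := h2 a
          have h4 := h2 (-a)
          simp only [← sub_eq_add_neg] at h4
          have h5 : (((Finset.Icc (-R : ℤ) R).filter
              fun t => t = 0 ∨ (ℓ : ℤ) ∣ t - a ∨ (ℓ : ℤ) ∣ t + a).card : ℝ) ≤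
              1 + ((((Finset.Icc (-R : ℤ) R).filter fun t => (ℓ : ℤ) ∣ t - a).card : ℝ) +
              ((Finset.Icc (-R : ℤ) R).filter fun t => (ℓ : ℤ) ∣ t + a).card) := by
            exact_mod_cast h1
          have h6 : 0 ≤ (R : ℝ) / ℓ := by positivity
          have h7 : 6 * (R : ℝ) / ℓ = 6 * (R / ℓ) := by ring
          have h8 : 2 * (R : ℝ) / ℓ = 2 * (R / ℓ) := by ring
          rw [h7]; rw [h8] at h3 h4
          linarith
        · have : ((R : ℤ) + 1 - -R).toNat ≤ 3 * R := by omega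
          exact_mod_cast this
    _ ≤ _ := by
        have e : (3 + 6 * R / ℓ) * (9 * Y * R) + 3 * R * (24 * Y * R / ℓ + 12 * R ^ 2) =
          27 * Y * R + 36 * R * R ^ 2 + 126 * (Y * R ^ 2 / ℓ : ℝ) := by ring
        rw [e]
        have h1 : (Y * R ^ 2 / ℓ : ℝ) ≤ Y * (4 * Y) / ℓ := by gcongr
        have h2 : (36 * R * R ^ 2 : ℝ) ≤ 36 * R * (4 * Y) := by gcongr
        have h3 : (Y : ℝ) * R ≤ Y * (2 * √Y) := by gcongr
        have h4 : (Y * (4 * Y) / ℓ : ℝ) = 4 * (Y ^ 2 / ℓ) := by ring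
        have h5 : (0 : ℝ) ≤ Y * √Y := by positivity
        rw [h4] at h1
        linarith

end

section

/-- Passing from sums to logarithmically weighted sums. -/
lemma sum_div_le_of_sum_le {f : ℕ → ℝ} (hf : ∀ n, 0 ≤ f n) {C L : ℝ} (hC : 0 ≤ C) (hL : 0 < L)
    (h : ∀ Y : ℕ, ∑ n ∈ Finset.Icc 1 Y, f n ≤ C * ((Y : ℝ) ^ 2 / L + Y * √Y)) (X : ℕ) :
    ∑ n ∈ Finset.Icc 1 X, f n / n ≤ 8 * C * (X / L + √X) := by
  induction X using Nat.strong_induction_on with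
  | _ X ih =>
    rcases Nat.eq_zero_or_pos X with rfl | hX
    · simp
    have hX0 : (0 : ℝ) < X := by exact_mod_cast hX
    have hsplit : Finset.Icc 1 X = Finset.Icc 1 (X / 2) ∪ Finset.Icc (X / 2 + 1) X := by
      ext n; simp only [Finset.mem_union, Finset.mem_Icc]; omega
    have hdisj : Disjoint (Finset.Icc 1 (X / 2)) (Finset.Icc (X / 2 + 1) X) := by
      rw [Finset.disjoint_left]; intro n; simp only [Finset.mem_Icc]; omega
    have h1 := ih (X / 2) (by omega)
    have h2 : ∑ n ∈ Finset.Icc (X / 2 + 1) X, f n / n ≤ 2 / X * ∑ n ∈ Finset.Icc 1 X, f n := by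
      rw [Finset.mul_sum]
      calc _ ≤ ∑ n ∈ Finset.Icc (X / 2 + 1) X, 2 / X * f n := by
            refine Finset.sum_le_sum fun n hn => ?_
            have hn := Finset.mem_Icc.1 hn
            have hn' : (X : ℝ) ≤ 2 * n := by exact_mod_cast (by omega : X ≤ 2 * n)
            have hn0 : (0 : ℝ) < n := by exact_mod_cast (by omega : 0 < n)
            rw [div_eq_inv_mul]
            refine mul_le_mul_of_nonneg_right ?_ (hf n)
            rw [inv_eq_one_div, div_le_div_iff₀ hn0 hX0]
            linarith
        _ ≤ _ := by
            refine Finset.sum_le_sum_of_subset_of_nonneg ?_ fun n _ _ =>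
              mul_nonneg (by positivity) (hf n)
            intro n; simp only [Finset.mem_Icc]; omega
    have h3 : 2 / X * ∑ n ∈ Finset.Icc 1 X, f n ≤ 2 * C * (X / L + √X) := by
      calc _ ≤ 2 / X * (C * ((X : ℝ) ^ 2 / L + X * √X)) := by gcongr; exact h X
        _ = _ := by field_simp
    have hhalf : ((X / 2 : ℕ) : ℝ) ≤ X / 2 := Nat.cast_div_le
    have h4 : √((X / 2 : ℕ) : ℝ) ≤ 3 / 4 * √X := by
      apply Real.sqrt_le_iff.2
      refine ⟨by positivity, ?_⟩
      rw [mul_pow, Real.sq_sqrt hX0.le]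
      linarith
    have h5 : 8 * C * (((X / 2 : ℕ) : ℝ) / L + √((X / 2 : ℕ) : ℝ)) ≤
        8 * C * (X / 2 / L + 3 / 4 * √X) := by gcongr
    have h6 : 0 ≤ C * (X / L) := by positivity
    rw [hsplit, Finset.sum_union hdisj]
    have h7 : (X : ℝ) / 2 / L = (X / L) / 2 := by ring
    rw [h7] at h5
    nlinarith

open Classical in
/-- The number of `j`-invariants of elliptic curves modulo `p` with Frobenius trace in a given
residue class is at most the number of quadratic data. -/
lemma card_jInvariants_le {p : ℕ} [hp : Fact p.Prime] (hp5 : 5 ≤ p) (a : ℤ) (ℓ : ℕ)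
    (J : Finset (ZMod p)) (hJ : ∀ j ∈ J, ∃ A B : ZMod p, A ≠ 0 ∧ B ≠ 0 ∧
      4 * A ^ 3 + 27 * B ^ 2 ≠ 0 ∧ j = 1728 * (4 * A ^ 3) / (4 * A ^ 3 + 27 * B ^ 2) ∧
      (ℓ : ℤ) ∣ p - affinePoints p A B - a) :
    J.card ≤ ((cmBox (Nat.sqrt (4 * p))).filter
      fun d => CMDatum a ℓ p d.1 d.2.1 d.2.2).card := by
  obtain ⟨V, hV⟩ := exists_valuationSubring_natCast_lt_one hp.out
  have key : ∀ j ∈ J, ∃ d : ℤ × ℤ × ℤ, CMDatum a ℓ p d.1 d.2.1 d.2.2 ∧ CMRel V p d j := by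
    intro j hj
    obtain ⟨A, B, hA, hB, hAB, rfl, hl⟩ := hJ j hj
    obtain ⟨⟨t, z, b⟩, hz, hb, h3, h4, h5, h6⟩ := exists_CMRel hp5 hV hA hB hAB
    refine ⟨(t, z, b), ⟨hz, hb, h3, h4, ?_⟩, h6⟩
    have hle := affinePoints_le A B
    set N : ℤ := (affinePoints p A B : ℤ) with hN
    have hN0 : 0 ≤ N := by positivity
    have hN2 : N ≤ 2 * p := by rw [hN]; exact_mod_cast hle
    have hp' : (5 : ℤ) ≤ p := by exact_mod_cast hp5
    simp only at h3 h5 hz ⊢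
    have htp : |t| < p := by
      rw [← abs_of_nonneg (show (0 : ℤ) ≤ p by omega)]
      apply sq_lt_sq.1
      nlinarith [sq_nonneg z]
    obtain ⟨ht1, ht2⟩ := abs_lt.1 htp
    rcases h5 with h | ⟨k, hk⟩ | ⟨k, hk⟩
    · exact Or.inl (Or.inl h)
    · have hk0 : -1 < k := by by_contra hc; nlinarith [not_lt.1 hc]
      have hk2 : k < 3 := by by_contra hc; nlinarith [not_lt.1 hc]
      have e : (p : ℤ) - N - a = -(t + a + (k - 1) * p) := by linear_combination -hk
      rw [e, dvd_neg] at hl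
      have : k = 0 ∨ k = 1 ∨ k = 2 := by omega
      rcases this with rfl | rfl | rfl
      · right; right; right; right; simpa [← sub_eq_add_neg] using hl
      · left; right; right; simpa using hl
      · right; right; right; left; norm_num at hl; simpa using hl
    · have hk0 : -1 < k := by by_contra hc; nlinarith [not_lt.1 hc]
      have hk2 : k < 3 := by by_contra hc; nlinarith [not_lt.1 hc]
      have e : (p : ℤ) - N - a = t - a + (1 - k) * p := by linear_combination -hk
      rw [e] at hl
      have : k = 0 ∨ k = 1 ∨ k = 2 := by omega
      rcases this with rfl | rfl | rfl
      · right; left; simpa using hl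
      · left; right; left; simpa using hl
      · right; right; left; norm_num at hl; simpa [← sub_eq_add_neg] using hl
  choose! F hF1 hF2 using key
  refine Finset.card_le_card_of_injOn F ?_ ?_
  · intro j hj
    exact Finset.mem_filter.2 ⟨(hF1 j hj).mem_cmBox le_rfl, hF1 j hj⟩
  · intro j hj j' hj' h
    exact CMRel.unique hp.out hV (hF1 j hj).1 (hF2 j hj) (h ▸ hF2 j' hj')

end

section

open Polynomial

section

variable {p : ℕ}

lemma ratRed_eq_cast [hp : Fact p.Prime] (q : ℚ) : ratRed p q = (q : ZMod p) := by
  rw [ratRed, Rat.cast_def, div_eq_mul_inv]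

/-- Reduction modulo `p` commutes with the evaluation of integral polynomials at `p`-integral
rational numbers. -/
lemma cast_evalQ [hp : Fact p.Prime] (A : ℤ[X]) {τ : ℚ} (hτ : (τ.den : ZMod p) ≠ 0) :
    ((evalQ A τ).den : ZMod p) ≠ 0 ∧
      ((evalQ A τ : ℚ) : ZMod p) = (A.map (Int.castRingHom (ZMod p))).eval (τ : ZMod p) := by
  induction A using Polynomial.induction_on' with
  | add P Q hP hQ =>
    have e : evalQ (P + Q) τ = evalQ P τ + evalQ Q τ := eval₂_add _ _
    rw [e]
    refine ⟨fun h => ?_, ?_⟩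
    · obtain ⟨k, hk⟩ := Rat.add_den_dvd (evalQ P τ) (evalQ Q τ)
      have h2 := congrArg (fun n : ℕ => (n : ZMod p)) hk
      simp only [Nat.cast_mul, h, zero_mul] at h2
      exact mul_ne_zero hP.1 hQ.1 h2
    · rw [Rat.cast_add_of_ne_zero hP.1 hQ.1, hP.2, hQ.2, Polynomial.map_add, eval_add]
  | monomial n a =>
    have e : evalQ (monomial n a) τ = a * τ ^ n := by simp [evalQ]
    have h1 : ((τ ^ n).den : ZMod p) ≠ 0 := by
      rw [Rat.den_pow]; push_cast; exact pow_ne_zero _ hτ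
    have h2 : (((a : ℚ).den : ℕ) : ZMod p) ≠ 0 := by simp
    rw [e]
    refine ⟨fun h => ?_, ?_⟩
    · obtain ⟨k, hk⟩ := Rat.mul_den_dvd (a : ℚ) (τ ^ n)
      have h3 := congrArg (fun n : ℕ => (n : ZMod p)) hk
      simp only [Nat.cast_mul, h, zero_mul] at h3
      exact mul_ne_zero h2 h1 h3
    · rw [Rat.cast_mul_of_ne_zero h2 h1, Rat.cast_intCast, map_monomial, eval_monomial]
      congr 1
      rw [Rat.cast_def, Rat.num_pow, Rat.den_pow, Rat.cast_def]
      push_cast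
      rw [div_pow]

/-- If the value of a nonconstant polynomial at `τ` is `p`-integral, then so is `τ`, provided the
leading coefficient is prime to `p`. -/
lemma not_dvd_den_of_evalQ (hp : p.Prime) {A : ℤ[X]} (hA : 1 ≤ A.natDegree)
    (hl : ¬ (p : ℤ) ∣ A.leadingCoeff) {τ : ℚ} (h : ¬ (p : ℤ) ∣ (evalQ A τ).den) :
    ¬ (p : ℤ) ∣ τ.den := by
  intro hd
  set q := evalQ A τ with hq
  set P : ℤ[X] := C (q.den : ℤ) * A - C q.num with hP
  have hden : (q.den : ℤ) ≠ 0 := by exact_mod_cast q.den_nz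
  have hdeg : (C q.num).degree < (C (q.den : ℤ) * A).degree := by
    rw [degree_C_mul hden]
    refine degree_C_le.trans_lt ?_
    rwa [← natDegree_pos_iff_degree_pos]
  have hlc : P.leadingCoeff = q.den * A.leadingCoeff := by
    rw [hP, leadingCoeff_sub_of_degree_lt hdeg, leadingCoeff_mul, leadingCoeff_C]
  have hroot : aeval τ P = 0 := by
    have : aeval τ A = q := by rw [hq, evalQ, aeval_def]; rfl
    simp only [hP, map_sub, map_mul, aeval_C, this]
    simp [Rat.den_mul_eq_num]
  have h1 := den_dvd_of_is_root hroot
  rw [hlc] at h1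
  have h2 : (τ.den : ℤ) ∣ q.den * A.leadingCoeff := by
    rw [← Rat.isFractionRingDen τ]
    exact Int.natAbs_dvd.2 h1
  rcases (Nat.prime_iff_prime_int.1 hp).dvd_or_dvd (hd.trans h2) with h3 | h3
  · exact h h3
  · exact hl h3

lemma fareyFrac_num_den {T : ℝ} {ab : ℕ × ℕ} (h : ab ∈ fareyPairs T) :
    (fareyFrac ab).num = ab.1 ∧ (fareyFrac ab).den = ab.2 := by
  obtain ⟨h1, h2⟩ := Finset.mem_filter.1 h
  have h3 := Finset.mem_Icc.1 (Finset.mem_product.1 h1).2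
  have h4 := Rat.num_div_eq_of_coprime (a := ab.1) (b := ab.2) (by omega) (by simpa using h2)
  have h5 := Rat.den_div_eq_of_coprime (a := ab.1) (b := ab.2) (by omega) (by simpa using h2)
  simp only [Int.cast_natCast] at h4 h5
  exact ⟨h4, by exact_mod_cast h5⟩

/-- Farey fractions in `(0, 1]` lying in one residue class. -/
lemma card_farey_class_le_aux {p : ℕ} (hp : 0 < p) (N : ℕ) (S : Finset (ℕ × ℕ))
    (hS : ∀ w ∈ S, 1 ≤ w.1 ∧ w.1 ≤ w.2 ∧ w.2 ≤ N ∧ Nat.Coprime w.1 w.2)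
    (h : ∀ w ∈ S, ∀ w' ∈ S, (p : ℤ) ∣ w.1 * w'.2 - w'.1 * w.2) :
    (S.card : ℝ) ≤ (N : ℝ) ^ 2 / p + 1 := by
  have hp0 : (0 : ℝ) < p := by exact_mod_cast hp
  have hcard : S.card ≤ (Finset.range (⌊(N : ℝ) ^ 2 / p⌋₊ + 1)).card := by
    refine Finset.card_le_card_of_injOn
      (fun w => ⌊(w.1 : ℝ) / w.2 * ((N : ℝ) ^ 2 / p)⌋₊) ?_ ?_
    · intro w hw
      obtain ⟨h1, h2, h3, h4⟩ := hS w hw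
      simp only [Finset.coe_range, Set.mem_Iio]
      refine Nat.lt_succ_of_le (Nat.floor_le_floor ?_)
      have h5 : (w.1 : ℝ) / w.2 ≤ 1 := by
        rw [div_le_one (by exact_mod_cast (by omega : 0 < w.2))]; exact_mod_cast h2
      exact mul_le_of_le_one_left (by positivity) h5
    · have main : ∀ w ∈ S, ∀ w' ∈ S, (w'.1 * w.2 : ℤ) < w.1 * w'.2 →
          ⌊(w.1 : ℝ) / w.2 * ((N : ℝ) ^ 2 / p)⌋₊ ≠ ⌊(w'.1 : ℝ) / w'.2 * ((N : ℝ) ^ 2 / p)⌋₊ := by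
        intro w hw w' hw' hlt heq
        obtain ⟨h1, h2, h3, h4⟩ := hS w hw
        obtain ⟨h1', h2', h3', h4'⟩ := hS w' hw'
        have hd := Int.le_of_dvd (by linarith) (h w hw w' hw')
        have hw2 : (0 : ℝ) < w.2 := by exact_mod_cast (by omega : 0 < w.2)
        have hw2' : (0 : ℝ) < w'.2 := by exact_mod_cast (by omega : 0 < w'.2)
        have hN0 : (0 : ℝ) < N := by exact_mod_cast (by omega : 0 < N)
        have hdR : (p : ℝ) ≤ w.1 * w'.2 - w'.1 * w.2 := by exact_mod_cast hd
        have hge : (w'.1 : ℝ) / w'.2 * ((N : ℝ) ^ 2 / p) + 1 ≤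
            (w.1 : ℝ) / w.2 * ((N : ℝ) ^ 2 / p) := by
          have e : (w.1 : ℝ) / w.2 * ((N : ℝ) ^ 2 / p) - (w'.1 : ℝ) / w'.2 * ((N : ℝ) ^ 2 / p) =
              (w.1 * w'.2 - w'.1 * w.2) * N ^ 2 / (w.2 * w'.2 * p) := by
            field_simp
          have h5 : 1 ≤ (w.1 * w'.2 - w'.1 * w.2) * (N : ℝ) ^ 2 / (w.2 * w'.2 * p) := by
            rw [le_div_iff₀ (by positivity), one_mul]
            have h6 : (w.2 : ℝ) * w'.2 ≤ N ^ 2 := by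
              rw [sq]; gcongr
            calc (w.2 : ℝ) * w'.2 * p ≤ N ^ 2 * p := by gcongr
              _ = p * N ^ 2 := by ring
              _ ≤ _ := by gcongr
          linarith
        have h7 := Nat.floor_le_floor hge
        rw [Nat.floor_add_one (by positivity)] at h7
        omega
      intro w hw w' hw' heq
      obtain ⟨h1, h2, h3, h4⟩ := hS w hw
      obtain ⟨h1', h2', h3', h4'⟩ := hS w' hw'
      rcases lt_trichotomy (w'.1 * w.2 : ℤ) (w.1 * w'.2) with hlt | he | hlt
      · exact absurd heq (main w hw w' hw' hlt)
      · have he' : w'.1 * w.2 = w.1 * w'.2 := by exact_mod_cast he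
        have d1 : w.1 ∣ w'.1 := h4.dvd_of_dvd_mul_right (Dvd.intro _ he'.symm)
        have d2 : w'.1 ∣ w.1 := h4'.dvd_of_dvd_mul_right (Dvd.intro _ he')
        have e1 := Nat.dvd_antisymm d1 d2
        rw [e1] at he'
        have e2 := Nat.eq_of_mul_eq_mul_left (by omega) he'
        exact Prod.ext e1 e2
      · exact absurd heq.symm (main w' hw' w hw hlt)
  rw [Finset.card_range] at hcard
  have h1 : (S.card : ℝ) ≤ ((⌊(N : ℝ) ^ 2 / p⌋₊ + 1 : ℕ) : ℝ) := by exact_mod_cast hcard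
  have h2 := Nat.floor_le (show (0 : ℝ) ≤ (N : ℝ) ^ 2 / p by positivity)
  push_cast at h1
  linarith

/-- Farey fractions lying in one residue class. -/
lemma card_farey_class_le [hp : Fact p.Prime] (T : ℝ) (u : ZMod p) (S : Finset (ℕ × ℕ)) (hS : S ⊆ fareyPairs T)
    (h : ∀ w ∈ S, (w.1 : ZMod p) = u * w.2) :
    (S.card : ℝ) ≤ 2 * ((⌊T⌋₊ : ℝ) ^ 2 / p) + 2 := by
  have hdvd : ∀ w ∈ S, ∀ w' ∈ S, (p : ℤ) ∣ w.1 * w'.2 - w'.1 * w.2 := by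
    intro w hw w' hw'
    rw [← ZMod.intCast_zmod_eq_zero_iff_dvd]
    push_cast
    rw [h w hw, h w' hw']
    ring
  have hmem : ∀ w ∈ S, 1 ≤ w.1 ∧ w.1 ≤ ⌊T⌋₊ ∧ 1 ≤ w.2 ∧ w.2 ≤ ⌊T⌋₊ ∧ Nat.Coprime w.1 w.2 := by
    intro w hw
    obtain ⟨h1, h2⟩ := Finset.mem_filter.1 (hS hw)
    obtain ⟨h3, h4⟩ := Finset.mem_product.1 h1
    obtain ⟨h5, h6⟩ := Finset.mem_Icc.1 h3
    obtain ⟨h7, h8⟩ := Finset.mem_Icc.1 h4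
    exact ⟨h5, h6, h7, h8, h2⟩
  have h1 := card_farey_class_le_aux hp.out.pos ⌊T⌋₊ (S.filter fun w => w.1 ≤ w.2)
    (fun w hw => by
      obtain ⟨hw, hle⟩ := Finset.mem_filter.1 hw
      obtain ⟨h5, h6, h7, h8, h2⟩ := hmem w hw
      exact ⟨h5, hle, h8, h2⟩)
    (fun w hw w' hw' => hdvd w (Finset.mem_filter.1 hw).1 w' (Finset.mem_filter.1 hw').1)
  have h2 := card_farey_class_le_aux hp.out.pos ⌊T⌋₊
    ((S.filter fun w => ¬ w.1 ≤ w.2).map (Equiv.prodComm ℕ ℕ).toEmbedding)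
    (fun w hw => by
      obtain ⟨v, hv, rfl⟩ := Finset.mem_map.1 hw
      obtain ⟨hv, hle⟩ := Finset.mem_filter.1 hv
      obtain ⟨h5, h6, h7, h8, h2⟩ := hmem v hv
      exact ⟨h7, (not_le.1 hle).le, h6, h2.symm⟩)
    (fun w hw w' hw' => by
      obtain ⟨v, hv, rfl⟩ := Finset.mem_map.1 hw
      obtain ⟨v', hv', rfl⟩ := Finset.mem_map.1 hw'
      have := hdvd v' (Finset.mem_filter.1 hv').1 v (Finset.mem_filter.1 hv).1
      simpa [mul_comm] using this)
  rw [Finset.card_map] at h2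
  have h3 := Finset.card_filter_add_card_filter_not (s := S) (fun w : ℕ × ℕ => w.1 ≤ w.2)
  have h4 : (S.card : ℝ) = (S.filter fun w => w.1 ≤ w.2).card +
    (S.filter fun w => ¬ w.1 ≤ w.2).card := by exact_mod_cast h3.symm
  rw [h4]; linarith

end

section

/-- If `j` is non-constant, then `A³` and `B²` are linearly independent. -/
lemma exists_minor_ne_zero {A B : ℤ[X]} (hΔ : 4 * A ^ 3 + 27 * B ^ 2 ≠ 0)
    (hj : jNonconstant A B) :
    ∃ i k : ℕ, (A ^ 3).coeff i * (B ^ 2).coeff k - (A ^ 3).coeff k * (B ^ 2).coeff i ≠ 0 := by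
  by_contra! hcon
  have hB : B ≠ 0 := by
    rintro rfl
    apply hj (-1728)
    simp only [Polynomial.map_zero]
    rw [show (C (-1728 : ℚ)) = -1728 by rw [map_neg]; rfl]
    ring
  obtain ⟨k, hk⟩ : ∃ k, (B ^ 2).coeff k ≠ 0 := by
    by_contra! h
    exact pow_ne_zero 2 hB (Polynomial.ext (by simpa using h))
  set s := (A ^ 3).coeff k
  set r := (B ^ 2).coeff k
  have h1 : C r * A ^ 3 = C s * B ^ 2 := by
    ext i
    rw [coeff_C_mul, coeff_C_mul]
    linear_combination hcon i k
  have h2 : C (4 * s + 27 * r) * B ^ 2 = C r * (4 * A ^ 3 + 27 * B ^ 2) := by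
    simp only [map_add, map_mul]
    rw [show (C (4 : ℤ)) = 4 from rfl, show (C (27 : ℤ)) = 27 from rfl]
    linear_combination -4 * h1
  have hsr : 4 * s + 27 * r ≠ 0 := by
    intro h
    rw [h, C_0, zero_mul] at h2
    exact mul_ne_zero (C_ne_zero.2 hk) hΔ h2.symm
  apply hj (-6912 * s / (4 * s + 27 * r))
  have h3 : C (r : ℚ) * A.map (Int.castRingHom ℚ) ^ 3 =
      C (s : ℚ) * B.map (Int.castRingHom ℚ) ^ 2 := by
    have h4 := congrArg (Polynomial.map (Int.castRingHom ℚ)) h1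
    simp only [Polynomial.map_mul, Polynomial.map_pow, map_C] at h4
    exact h4
  have hr : (C (r : ℚ)) ≠ 0 := C_ne_zero.2 (by exact_mod_cast hk)
  have hsr' : (4 * s + 27 * r : ℚ) ≠ 0 := by exact_mod_cast hsr
  apply mul_left_cancel₀ (mul_ne_zero (C_ne_zero.2 hsr') hr)
  set P := A.map (Int.castRingHom ℚ)
  set Q := B.map (Int.castRingHom ℚ)
  have h5 : C (4 * s + 27 * r : ℚ) * C (-6912 * s / (4 * s + 27 * r) : ℚ) = -6912 * C (s : ℚ) := by
    rw [← C_mul, mul_div_cancel₀ _ hsr', C_mul, C_neg]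
    rfl
  have h6 : C (4 * s + 27 * r : ℚ) = 4 * C (s : ℚ) + 27 * C (r : ℚ) := by
    rw [C_add, C_mul, C_mul]
    rfl
  calc C (4 * s + 27 * r : ℚ) * C (r : ℚ) * (-6912 * P ^ 3)
      = -6912 * C (4 * s + 27 * r : ℚ) * (C (r : ℚ) * P ^ 3) := by ring
    _ = (C (4 * s + 27 * r : ℚ) * C (-6912 * s / (4 * s + 27 * r) : ℚ)) * C (r : ℚ) *
          (4 * P ^ 3 + 27 * Q ^ 2) := by
        rw [h5, h6]
        linear_combination -6912 * 27 * C (r : ℚ) * h3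
    _ = _ := by ring

open Classical in
/-- The number of residues at which the specialised curve has Frobenius trace in a given class. -/
lemma card_residues_le {p : ℕ} [hp : Fact p.Prime] (hp5 : 5 ≤ p) (a : ℤ) (ℓ : ℕ) {A B : ℤ[X]}
    (hA : ¬ (p : ℤ) ∣ A.leadingCoeff) (hB : ¬ (p : ℤ) ∣ B.leadingCoeff) {i k : ℕ}
    (hm : ¬ (p : ℤ) ∣ (A ^ 3).coeff i * (B ^ 2).coeff k - (A ^ 3).coeff k * (B ^ 2).coeff i)
    (S : Finset (ZMod p))
    (hS : ∀ u ∈ S, 4 * (A.map (Int.castRingHom (ZMod p))).eval u ^ 3 +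
        27 * (B.map (Int.castRingHom (ZMod p))).eval u ^ 2 ≠ 0 ∧
      (ℓ : ℤ) ∣ p - affinePoints p ((A.map (Int.castRingHom (ZMod p))).eval u)
        ((B.map (Int.castRingHom (ZMod p))).eval u) - a) :
    S.card ≤ A.natDegree + B.natDegree + (3 * A.natDegree + 2 * B.natDegree) *
      ((cmBox (Nat.sqrt (4 * p))).filter fun d => CMDatum a ℓ p d.1 d.2.1 d.2.2).card := by
  set f := Int.castRingHom (ZMod p)
  set P := A.map f with hP
  set Q := B.map f with hQ
  have hPd : P.natDegree ≤ A.natDegree := natDegree_map_le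
  have hQd : Q.natDegree ≤ B.natDegree := natDegree_map_le
  have hne : ∀ F : ℤ[X], ¬ (p : ℤ) ∣ F.leadingCoeff → F.map f ≠ 0 := by
    intro F hF h
    have h1 := congrArg (fun R => R.coeff F.natDegree) h
    simp only [coeff_map, coeff_zero, coeff_natDegree, f, eq_intCast] at h1
    exact hF ((ZMod.intCast_zmod_eq_zero_iff_dvd _ _).1 h1)
  have hP0 : P ≠ 0 := hne A hA
  have hQ0 : Q ≠ 0 := hne B hB
  have hPrime : ∀ n : ℕ, 0 < n → n < 5 → ((n : ℕ) : ZMod p) ≠ 0 := by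
    intro n h0 h1 h
    rw [ZMod.natCast_eq_zero_iff] at h
    exact absurd (Nat.le_of_dvd h0 h) (by omega)
  have h2 : (2 : ZMod p) ≠ 0 := by exact_mod_cast hPrime 2 (by norm_num) (by norm_num)
  have h3 : (3 : ZMod p) ≠ 0 := by exact_mod_cast hPrime 3 (by norm_num) (by norm_num)
  set S' := S.filter fun u => P.eval u ≠ 0 ∧ Q.eval u ≠ 0 with hS'
  set jj : ZMod p → ZMod p := fun u =>
    1728 * (4 * P.eval u ^ 3) / (4 * P.eval u ^ 3 + 27 * Q.eval u ^ 2) with hjj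
  have hsub : S ⊆ (P.roots.toFinset ∪ Q.roots.toFinset) ∪ S' := by
    intro u hu
    simp only [Finset.mem_union, Multiset.mem_toFinset, mem_roots hP0, mem_roots hQ0, IsRoot.def,
      hS', Finset.mem_filter, hu, true_and]
    tauto
  have hroots : ∀ F : (ZMod p)[X], F.roots.toFinset.card ≤ F.natDegree := fun F =>
    (Multiset.toFinset_card_le _).trans (card_roots' F)
  have hS'card : S'.card ≤ (3 * A.natDegree + 2 * B.natDegree) * (S'.image jj).card := by
    refine Finset.card_le_mul_card_image _ _ fun j _ => ?_
    set R : (ZMod p)[X] := C (1728 * 4 - 4 * j) * P ^ 3 - C (27 * j) * Q ^ 2 with hR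
    have hR0 : R ≠ 0 := by
      intro h0
      have hc : ∀ n, (1728 * 4 - 4 * j) * f ((A ^ 3).coeff n) = 27 * j * f ((B ^ 2).coeff n) := by
        intro n
        have h1 := congrArg (fun F => F.coeff n) h0
        simp only [hR, hP, hQ, ← Polynomial.map_pow, coeff_sub, coeff_C_mul, coeff_map,
          coeff_zero] at h1
        exact sub_eq_zero.1 h1
      have hm' : f ((A ^ 3).coeff i) * f ((B ^ 2).coeff k) -
          f ((A ^ 3).coeff k) * f ((B ^ 2).coeff i) ≠ 0 := by
        rw [← map_mul, ← map_mul, ← map_sub]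
        exact fun h => hm ((ZMod.intCast_zmod_eq_zero_iff_dvd _ _).1 h)
      have h4 : j = 0 := by
        have : 3 ^ 3 * j * (f ((A ^ 3).coeff i) * f ((B ^ 2).coeff k) -
          f ((A ^ 3).coeff k) * f ((B ^ 2).coeff i)) = 0 := by
          linear_combination f ((A ^ 3).coeff k) * hc i - f ((A ^ 3).coeff i) * hc k
        rcases mul_eq_zero.1 this with h | h
        · exact (mul_eq_zero.1 h).resolve_left (pow_ne_zero _ h3)
        · exact absurd h hm'
      have h5 : 1728 * 4 - 4 * j = 0 := by
        have : (1728 * 4 - 4 * j) * (f ((A ^ 3).coeff i) * f ((B ^ 2).coeff k) -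
          f ((A ^ 3).coeff k) * f ((B ^ 2).coeff i)) = 0 := by
          linear_combination f ((B ^ 2).coeff k) * hc i - f ((B ^ 2).coeff i) * hc k
        exact (mul_eq_zero.1 this).resolve_right hm'
      rw [h4, mul_zero, sub_zero, show (1728 * 4 : ZMod p) = 2 ^ 8 * 3 ^ 3 by norm_num] at h5
      exact mul_ne_zero (pow_ne_zero _ h2) (pow_ne_zero _ h3) h5
    have hRd : R.natDegree ≤ 3 * A.natDegree + 2 * B.natDegree := by
      refine (natDegree_sub_le _ _).trans (max_le ?_ ?_)
      · refine (natDegree_C_mul_le _ _).trans (natDegree_pow_le.trans ?_)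
        omega
      · refine (natDegree_C_mul_le _ _).trans (natDegree_pow_le.trans ?_)
        omega
    refine (Finset.card_le_card ?_).trans ((hroots R).trans hRd)
    intro u hu
    obtain ⟨hu, huj⟩ := Finset.mem_filter.1 hu
    have hd := (hS u (Finset.mem_filter.1 hu).1).1
    rw [Multiset.mem_toFinset, mem_roots hR0, IsRoot.def, hR]
    simp only [eval_sub, eval_mul, eval_C, eval_pow]
    simp only [hjj] at huj
    rw [div_eq_iff hd] at huj
    linear_combination huj
  have hJ := card_jInvariants_le hp5 a ℓ (S'.image jj) (by
    intro j hj
    obtain ⟨u, hu, rfl⟩ := Finset.mem_image.1 hj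
    obtain ⟨hu, hPu, hQu⟩ := Finset.mem_filter.1 hu
    exact ⟨P.eval u, Q.eval u, hPu, hQu, (hS u hu).1, rfl, (hS u hu).2⟩)
  calc S.card ≤ _ := Finset.card_le_card hsub
    _ ≤ (P.roots.toFinset.card + Q.roots.toFinset.card) + S'.card :=
        (Finset.card_union_le _ _).trans (Nat.add_le_add_right (Finset.card_union_le _ _) _)
    _ ≤ _ := add_le_add (add_le_add ((hroots P).trans hPd) ((hroots Q).trans hQd))
        (hS'card.trans (Nat.mul_le_mul_left _ hJ))

open Classical in
/-- The Farey pairs for which `p` contributes to the average. -/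
noncomputable def fareyContrib (A B : ℤ[X]) (a : ℤ) (ℓ : ℕ) (T : ℝ) (p : ℕ) : Finset (ℕ × ℕ) :=
  (fareyPairs T).filter fun ab => discQ A B (fareyFrac ab) ≠ 0 ∧ p.Prime ∧
    goodRed A B (fareyFrac ab) p ∧ (ℓ : ℤ) ∣ (apFrob A B (fareyFrac ab) p - a)

open Classical in
lemma card_fareyContrib_le_sq (A B : ℤ[X]) (a : ℤ) (ℓ : ℕ) (T : ℝ) (p : ℕ) :
    (fareyContrib A B a ℓ T p).card ≤ ⌊T⌋₊ ^ 2 := by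
  refine (Finset.card_le_card ((Finset.filter_subset _ _).trans (Finset.filter_subset _ _))).trans ?_
  simp [sq]

lemma discQ_eq_evalQ (A B : ℤ[X]) (τ : ℚ) :
    discQ A B τ = evalQ (-16 * (4 * A ^ 3 + 27 * B ^ 2)) τ := by
  simp only [discQ, evalQ, eval₂_mul, eval₂_add, eval₂_pow, eval₂_neg, eval₂_ofNat]

open Classical in
/-- The contribution of a single prime of good behaviour. -/
lemma card_fareyContrib_le {p : ℕ} (hp : p.Prime) (hp5 : 5 ≤ p) (a : ℤ) (ℓ : ℕ) {A B : ℤ[X]}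
    (hA : ¬ (p : ℤ) ∣ A.leadingCoeff) (hB : ¬ (p : ℤ) ∣ B.leadingCoeff) {i k : ℕ}
    (hm : ¬ (p : ℤ) ∣ (A ^ 3).coeff i * (B ^ 2).coeff k - (A ^ 3).coeff k * (B ^ 2).coeff i)
    (T : ℝ) :
    ((fareyContrib A B a ℓ T p).card : ℝ) ≤ ⌊T⌋₊ * √p + 4 * (⌊T⌋₊ : ℝ) ^ 2 *
      ((A.natDegree + B.natDegree + (3 * A.natDegree + 2 * B.natDegree) *
      ((cmBox (Nat.sqrt (4 * p))).filter fun d => CMDatum a ℓ p d.1 d.2.1 d.2.2).card : ℕ) / p) := by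
  have : Fact p.Prime := ⟨hp⟩
  have hp0 : (0 : ℝ) < p := by exact_mod_cast hp.pos
  set W := fareyContrib A B a ℓ T p with hW
  set N := ⌊T⌋₊ with hN
  set K := A.natDegree + B.natDegree + (3 * A.natDegree + 2 * B.natDegree) *
      ((cmBox (Nat.sqrt (4 * p))).filter fun d => CMDatum a ℓ p d.1 d.2.1 d.2.2).card
  by_cases hpN : (N : ℝ) ^ 2 < p
  · have h1 : (W.card : ℝ) ≤ (N : ℝ) ^ 2 := by exact_mod_cast card_fareyContrib_le_sq A B a ℓ T p
    have h2 : (N : ℝ) ≤ √p := Real.le_sqrt_of_sq_le hpN.le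
    have h3 : (N : ℝ) ^ 2 ≤ N * √p := by rw [sq]; gcongr
    have h4 : 0 ≤ 4 * (N : ℝ) ^ 2 * ((K : ℝ) / p) := by positivity
    linarith
  rw [not_lt] at hpN
  have hdeg : 1 ≤ A.natDegree ∨ 1 ≤ B.natDegree := by
    by_contra! hcon
    obtain ⟨x, hx⟩ := natDegree_eq_zero.1 (Nat.lt_one_iff.1 hcon.1)
    obtain ⟨y, hy⟩ := natDegree_eq_zero.1 (Nat.lt_one_iff.1 hcon.2)
    apply hm
    rw [← hx, ← hy, ← C_pow, ← C_pow]
    simp only [coeff_C]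
    split_ifs <;> simp
  have hmem : ∀ w ∈ W, (w.2 : ZMod p) ≠ 0 ∧
      ((fareyFrac w : ℚ) : ZMod p) = w.1 / w.2 ∧
      4 * (A.map (Int.castRingHom (ZMod p))).eval ((fareyFrac w : ℚ) : ZMod p) ^ 3 +
        27 * (B.map (Int.castRingHom (ZMod p))).eval ((fareyFrac w : ℚ) : ZMod p) ^ 2 ≠ 0 ∧
      (ℓ : ℤ) ∣ p - affinePoints p
        ((A.map (Int.castRingHom (ZMod p))).eval ((fareyFrac w : ℚ) : ZMod p))
        ((B.map (Int.castRingHom (ZMod p))).eval ((fareyFrac w : ℚ) : ZMod p)) - a := by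
    intro w hw
    obtain ⟨hwT, -, -, ⟨hgA, hgB, hgD⟩, hl⟩ := Finset.mem_filter.1 hw
    obtain ⟨hnum, hden⟩ := fareyFrac_num_den hwT
    have hd : ¬ (p : ℤ) ∣ (fareyFrac w).den := by
      rcases hdeg with h | h
      · exact not_dvd_den_of_evalQ hp h hA hgA
      · exact not_dvd_den_of_evalQ hp h hB hgB
    have hd' : ((fareyFrac w).den : ZMod p) ≠ 0 := by
      rwa [Ne, ZMod.natCast_eq_zero_iff, ← Int.natCast_dvd_natCast]
    refine ⟨by rwa [hden] at hd', by rw [Rat.cast_def, hnum, hden]; simp, ?_, ?_⟩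
    · rw [ratRed_eq_cast, discQ_eq_evalQ, (cast_evalQ _ hd').2] at hgD
      simp only [Polynomial.map_mul, Polynomial.map_add, Polynomial.map_pow, eval_mul, eval_add,
        eval_pow] at hgD
      have h := right_ne_zero_of_mul hgD
      simpa using h
    · rw [apFrob, ratRed_eq_cast, ratRed_eq_cast, (cast_evalQ A hd').2, (cast_evalQ B hd').2] at hl
      exact hl
  set g : ℕ × ℕ → ZMod p := fun w => ((fareyFrac w : ℚ) : ZMod p) with hg
  have hS : (W.image g).card ≤ K := by
    refine card_residues_le hp5 a ℓ hA hB hm _ fun u hu => ?_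
    obtain ⟨w, hw, rfl⟩ := Finset.mem_image.1 hu
    exact (hmem w hw).2.2
  have hfib : ∀ u ∈ W.image g, (((W.filter fun w => g w = u).card : ℕ) : ℝ) ≤
      4 * (N : ℝ) ^ 2 / p := by
    intro u _
    have h1 := card_farey_class_le T u (W.filter fun w => g w = u)
      ((Finset.filter_subset _ _).trans (Finset.filter_subset _ _)) (by
        intro w hw
        obtain ⟨hw, hgu⟩ := Finset.mem_filter.1 hw
        have h := hmem w hw
        rw [← hgu]
        simp only [hg]
        rw [h.2.1, div_mul_cancel₀ _ h.1])
    refine h1.trans ?_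
    have h2 : 1 ≤ (N : ℝ) ^ 2 / p := by rwa [le_div_iff₀ hp0, one_mul]
    rw [mul_div_assoc]
    linarith
  have h1 : (W.card : ℝ) = ∑ u ∈ W.image g, (((W.filter fun w => g w = u).card : ℕ) : ℝ) := by
    exact_mod_cast Finset.card_eq_sum_card_image g W
  rw [h1]
  calc _ ≤ ∑ u ∈ W.image g, 4 * (N : ℝ) ^ 2 / p := Finset.sum_le_sum hfib
    _ = (W.image g).card * (4 * (N : ℝ) ^ 2 / p) := by rw [Finset.sum_const, nsmul_eq_mul]
    _ ≤ K * (4 * (N : ℝ) ^ 2 / p) := by gcongr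
    _ = 4 * (N : ℝ) ^ 2 * (K / p) := by ring
    _ ≤ _ := le_add_of_nonneg_left (by positivity)

end

section

open Classical in
/-- Interchanging the sums over Farey fractions and over primes. -/
lemma sum_PiTraceMod_eq (A B : ℤ[X]) (a : ℤ) (ℓ : ℕ) (x T : ℝ) :
    ∑ ab ∈ fareyPairs T, (if discQ A B (fareyFrac ab) ≠ 0 then
        ((PiTraceMod A B (fareyFrac ab) a ℓ x : ℝ)) else 0) =
      ∑ p ∈ Finset.Icc 1 ⌊x⌋₊, ((fareyContrib A B a ℓ T p).card : ℝ) := by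
  have h1 : ∀ ab ∈ fareyPairs T, (if discQ A B (fareyFrac ab) ≠ 0 then
      ((PiTraceMod A B (fareyFrac ab) a ℓ x : ℝ)) else 0) =
      ∑ p ∈ Finset.Icc 1 ⌊x⌋₊, if discQ A B (fareyFrac ab) ≠ 0 ∧ p.Prime ∧
        goodRed A B (fareyFrac ab) p ∧ (ℓ : ℤ) ∣ (apFrob A B (fareyFrac ab) p - a)
        then (1 : ℝ) else 0 := by
    intro ab _
    by_cases hd : discQ A B (fareyFrac ab) ≠ 0
    · simp only [hd, if_true, true_and, ne_eq, not_false_eq_true]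
      rw [Finset.sum_boole, PiTraceMod]
      congr 2
      ext p
      simp only [Finset.mem_filter, Finset.mem_range, Finset.mem_Icc]
      constructor
      · rintro ⟨h, h'⟩
        exact ⟨⟨h'.1.one_le, by omega⟩, h'⟩
      · rintro ⟨h, h'⟩
        exact ⟨by omega, h'⟩
    · simp [hd]
  rw [Finset.sum_congr rfl h1, Finset.sum_comm]
  refine Finset.sum_congr rfl fun p _ => ?_
  rw [Finset.sum_boole, fareyContrib]

lemma sum_sqrt_le (X : ℕ) : ∑ p ∈ Finset.Icc 1 X, √(p : ℝ) ≤ X * √X := by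
  have h : ∀ p ∈ Finset.Icc 1 X, √(p : ℝ) ≤ √X := fun p hp =>
    Real.sqrt_le_sqrt (by exact_mod_cast (Finset.mem_Icc.1 hp).2)
  simpa using Finset.sum_le_sum h

end

end

/-- For `a ≠ 0` and every `ε > 0` there is `C > 0` such that for all positive real
`x, T` and every prime `ℓ ≥ 17`:
`Σ_{τ ∈ F(T), Δ(τ)≠0} Π_{E(τ)}(a, x) ≤ Σ_{τ ∈ F(T), Δ(τ)≠0} #{p ≤ x : p ∤ N(τ), a_p(τ) ≡ a (mod ℓ)}
  ≤ C·(T²·x·ℓ⁻¹ + ℓ·T²·x^{1/2} + T·x^{3/2+ε})`. -/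
theorem avg_lang_trotter_trace_mod_ell (A B : Polynomial ℤ)
    (hΔ : 4 * A ^ 3 + 27 * B ^ 2 ≠ 0) (hj : jNonconstant A B)
    (a : ℤ) (ha : a ≠ 0) (ε : ℝ) (hε : 0 < ε) :
    ∃ C : ℝ, 0 < C ∧ ∀ x T : ℝ, 0 < x → 0 < T → ∀ ℓ : ℕ, ℓ.Prime → 17 ≤ ℓ →
      (∑ ab ∈ fareyPairs T,
          (if discQ A B (fareyFrac ab) ≠ 0 then
            ((PiTrace A B (fareyFrac ab) a x : ℝ)) else 0) ≤
        ∑ ab ∈ fareyPairs T,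
          (if discQ A B (fareyFrac ab) ≠ 0 then
            ((PiTraceMod A B (fareyFrac ab) a ℓ x : ℝ)) else 0)) ∧
      ∑ ab ∈ fareyPairs T,
          (if discQ A B (fareyFrac ab) ≠ 0 then
            ((PiTraceMod A B (fareyFrac ab) a ℓ x : ℝ)) else 0) ≤
        C * (T ^ 2 * x / ℓ + ℓ * T ^ 2 * x ^ ((1 : ℝ) / 2) + T * x ^ ((3 : ℝ) / 2 + ε)) := by
  classical
  obtain ⟨i, k, hm⟩ := exists_minor_ne_zero hΔ hj
  have hA0 : A ≠ 0 := by rintro rfl; simp at hm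
  have hB0 : B ≠ 0 := by rintro rfl; simp at hm
  set m := (A ^ 3).coeff i * (B ^ 2).coeff k - (A ^ 3).coeff k * (B ^ 2).coeff i with hm_def
  set K₂ : ℕ := (A.leadingCoeff * B.leadingCoeff * m).natAbs + 4 with hK₂
  set K₀ : ℕ := A.natDegree + B.natDegree with hK₀
  set D : ℕ := 3 * A.natDegree + 2 * B.natDegree with hD
  set c : ℝ := K₀ + 504 * D with hc
  have hc0 : 0 ≤ c := by positivity
  refine ⟨K₂ + 1 + 32 * c, by positivity, fun x T hx hT ℓ hℓ hℓ17 => ⟨?_, ?_⟩⟩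
  · refine Finset.sum_le_sum fun ab _ => ?_
    split_ifs with hd
    · have : PiTrace A B (fareyFrac ab) a x ≤ PiTraceMod A B (fareyFrac ab) a ℓ x := by
        unfold PiTrace PiTraceMod
        refine Finset.card_le_card fun p hp => ?_
        simp only [Finset.mem_filter] at hp ⊢
        exact ⟨hp.1, hp.2.1, hp.2.2.1, by rw [hp.2.2.2, sub_self]; exact dvd_zero _⟩
      exact_mod_cast this
    · exact le_rfl
  rw [sum_PiTraceMod_eq]
  set X := ⌊x⌋₊ with hX
  set N := ⌊T⌋₊ with hN
  have hℓ0 : (0 : ℝ) < ℓ := by exact_mod_cast hℓ.pos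
  rcases Nat.eq_zero_or_pos X with hX0 | hX0
  · rw [hX0]
    simp only [Finset.Icc_eq_empty_of_lt zero_lt_one, Finset.sum_empty]
    positivity
  have hx1 : 1 ≤ x := (Nat.floor_pos).1 hX0
  have hXx : (X : ℝ) ≤ x := Nat.floor_le hx.le
  have hNT : (N : ℝ) ≤ T := Nat.floor_le hT.le
  set f : ℕ → ℝ := fun n => ((K₀ + D *
    ((cmBox (Nat.sqrt (4 * n))).filter fun d => CMDatum a ℓ n d.1 d.2.1 d.2.2).card : ℕ) : ℝ)
    with hf
  have hf0 : ∀ n, 0 ≤ f n := fun n => Nat.cast_nonneg _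
  have hfsum : ∀ Y : ℕ, ∑ n ∈ Finset.Icc 1 Y, f n ≤ c * ((Y : ℝ) ^ 2 / ℓ + Y * √Y) := by
    intro Y
    have h1 := sum_card_CMDatum_le (a := a) (Y := Y) hℓ
    have h2 : ∑ n ∈ Finset.Icc 1 Y, f n = Y * K₀ + D * ∑ n ∈ Finset.Icc 1 Y,
        ((((cmBox (Nat.sqrt (4 * n))).filter
          fun d => CMDatum a ℓ n d.1 d.2.1 d.2.2).card : ℕ) : ℝ) := by
      simp only [hf, Nat.cast_add, Nat.cast_mul, Finset.sum_add_distrib, Finset.mul_sum]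
      simp
    have h3 : (Y : ℝ) ≤ Y * √Y := by
      rcases Nat.eq_zero_or_pos Y with rfl | hY
      · simp
      · exact le_mul_of_one_le_right (Nat.cast_nonneg _)
          (Real.one_le_sqrt.2 (by exact_mod_cast hY))
    have h4 : (0 : ℝ) ≤ (Y : ℝ) ^ 2 / ℓ := by positivity
    rw [h2]
    calc _ ≤ ((Y : ℝ) ^ 2 / ℓ + Y * √Y) * K₀ + D * (504 * ((Y : ℝ) ^ 2 / ℓ + Y * √Y)) := by
          gcongr
          linarith
      _ = _ := by rw [hc]; ring
  have hfdiv := sum_div_le_of_sum_le hf0 hc0 hℓ0 hfsum X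
  have hterm : ∀ p ∈ Finset.Icc 1 X, ((fareyContrib A B a ℓ T p).card : ℝ) ≤
      (if p ≤ K₂ then (N : ℝ) ^ 2 else 0) + N * √p + 4 * (N : ℝ) ^ 2 * (f p / p) := by
    intro p _
    have h0 : 0 ≤ (N : ℝ) * √p := by positivity
    have h0' : 0 ≤ 4 * (N : ℝ) ^ 2 * (f p / p) :=
      mul_nonneg (by positivity) (div_nonneg (hf0 p) (Nat.cast_nonneg _))
    split_ifs with hpK
    · have h : ((fareyContrib A B a ℓ T p).card : ℝ) ≤ (N : ℝ) ^ 2 := by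
        exact_mod_cast card_fareyContrib_le_sq A B a ℓ T p
      linarith
    · rw [zero_add]
      by_cases hp : p.Prime
      · have hnd : ¬ (p : ℤ) ∣ A.leadingCoeff * B.leadingCoeff * m := by
          intro h
          have h1 := Int.natAbs_dvd_natAbs.2 h
          rw [Int.natAbs_natCast] at h1
          have h2 := Nat.le_of_dvd (Int.natAbs_pos.2 (mul_ne_zero (mul_ne_zero
            (Polynomial.leadingCoeff_ne_zero.2 hA0) (Polynomial.leadingCoeff_ne_zero.2 hB0)) hm)) h1
          omega
        exact card_fareyContrib_le hp (by omega) a ℓ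
          (fun h => hnd ((h.mul_right _).mul_right _))
          (fun h => hnd ((h.mul_left _).mul_right _)) (fun h => hnd (h.mul_left _)) T
      · have h : fareyContrib A B a ℓ T p = ∅ := by
          rw [fareyContrib, Finset.filter_eq_empty_iff]
          exact fun _ _ h => hp h.2.1
        rw [h, Finset.card_empty, Nat.cast_zero]
        linarith
  have hbad : ∑ p ∈ Finset.Icc 1 X, (if p ≤ K₂ then (N : ℝ) ^ 2 else 0) ≤ K₂ * (N : ℝ) ^ 2 := by
    rw [← Finset.sum_filter, Finset.sum_const, nsmul_eq_mul]
    gcongr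
    have : (Finset.Icc 1 X).filter (fun p => p ≤ K₂) ⊆ Finset.Icc 1 K₂ := by
      intro p; simp only [Finset.mem_filter, Finset.mem_Icc]; omega
    simpa using Finset.card_le_card this
  have hs : √(X : ℝ) ≤ x ^ ((1 : ℝ) / 2) := by
    rw [← Real.sqrt_eq_rpow]; exact Real.sqrt_le_sqrt hXx
  have hs1 : 1 ≤ x ^ ((1 : ℝ) / 2) := Real.one_le_rpow hx1 (by norm_num)
  have hs3 : (X : ℝ) * √X ≤ x ^ ((3 : ℝ) / 2 + ε) := by
    calc (X : ℝ) * √X ≤ x * x ^ ((1 : ℝ) / 2) := by gcongr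
      _ = x ^ ((3 : ℝ) / 2) := by
        rw [← Real.rpow_one_add' hx.le (by norm_num)]; norm_num
      _ ≤ _ := Real.rpow_le_rpow_of_exponent_le hx1 (by linarith)
  set R := x ^ ((1 : ℝ) / 2)
  set Z := x ^ ((3 : ℝ) / 2 + ε)
  have hℓ1 : (1 : ℝ) ≤ ℓ := by exact_mod_cast hℓ.one_le
  have hZ0 : 0 ≤ Z := le_trans (by positivity) hs3
  have hR : T ^ 2 * R ≤ ℓ * T ^ 2 * R := by
    rw [mul_assoc]; exact le_mul_of_one_le_left (by positivity) hℓ1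
  calc ∑ p ∈ Finset.Icc 1 X, ((fareyContrib A B a ℓ T p).card : ℝ)
      ≤ ∑ p ∈ Finset.Icc 1 X, ((if p ≤ K₂ then (N : ℝ) ^ 2 else 0) + N * √p +
          4 * (N : ℝ) ^ 2 * (f p / p)) := Finset.sum_le_sum hterm
    _ = ∑ p ∈ Finset.Icc 1 X, (if p ≤ K₂ then (N : ℝ) ^ 2 else 0) +
          N * ∑ p ∈ Finset.Icc 1 X, √(p : ℝ) +
          4 * (N : ℝ) ^ 2 * ∑ p ∈ Finset.Icc 1 X, f p / p := by
        rw [Finset.sum_add_distrib, Finset.sum_add_distrib, Finset.mul_sum, Finset.mul_sum]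
    _ ≤ K₂ * (N : ℝ) ^ 2 + N * (X * √X) + 4 * (N : ℝ) ^ 2 * (8 * c * (X / ℓ + √X)) := by
        gcongr
        exact sum_sqrt_le X
    _ ≤ K₂ * (T ^ 2 * R) + T * Z + 4 * T ^ 2 * (8 * c * (x / ℓ + R)) := by
        gcongr
        calc (N : ℝ) ^ 2 ≤ T ^ 2 := by gcongr
          _ ≤ T ^ 2 * R := le_mul_of_one_le_right (by positivity) hs1
    _ = K₂ * (T ^ 2 * R) + T * Z + 32 * c * (T ^ 2 * x / ℓ + T ^ 2 * R) := by ring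
    _ ≤ K₂ * (ℓ * T ^ 2 * R) + T * Z + 32 * c * (T ^ 2 * x / ℓ + ℓ * T ^ 2 * R) := by gcongr
    _ ≤ _ := by
        have e1 : 0 ≤ T ^ 2 * x / ℓ := by positivity
        have e2 : 0 ≤ ℓ * T ^ 2 * R := by positivity
        have e3 : 0 ≤ T * Z := by positivity
        have e4 : 0 ≤ (K₂ : ℝ) * (T ^ 2 * x / ℓ + T * Z) := by positivity
        have e5 : 0 ≤ 32 * c * (T * Z) := by positivity
        linarith
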